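/- Let Γ and Γ* be non-elementary hyperbolic groups and let π be a probability measure on Γ̄ = Γ × Γ* with finite first moment whose marginals μ and μ* are non-elementary, and suppose l(Γ,μ) ≥ l(Γ*,μ*). Then the harmonic measure ν_π on ∂Γ × ∂Γ* satisfies dimension conservation with respect to the projection to ∂Γ*: ν_π is exact dimensional, its projection ν_{μ*} on (∂Γ*,q*) is exact dimensional with dimension h(μ*)/l(Γ*,μ*), for ν_{μ*}-almost every η ∈ ∂Γ* the conditional measure ν_π^η is exact dimensional, and dim ν_π = dim ν_π^η + dim ν_{μ*}. -/

import Mathlib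

open MeasureTheory Filter Topology Metric Set
open scoped ENNReal Classical

noncomputable section

namespace HMDim

/-! ### Gromov products and hyperbolicity -/

/-- The Gromov product `(x|y)_o = (d(x,o)+d(o,y)-d(x,y))/2`. -/
def gp {X : Type*} [MetricSpace X] (o x y : X) : ℝ :=
  (dist x o + dist o y - dist x y) / 2

/-- `X` is `δ`-hyperbolic. -/
def IsHyperbolicWith (X : Type*) [MetricSpace X] (δ : ℝ) : Prop :=
  ∀ x y z w : X, min (gp w x z) (gp w z y) - δ ≤ gp w x y

/-- `X` is hyperbolic: `δ`-hyperbolic for some `δ ≥ 0`. -/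
def IsHyperbolic (X : Type*) [MetricSpace X] : Prop :=
  ∃ δ : ℝ, 0 ≤ δ ∧ IsHyperbolicWith X δ

/-- `X` is `C`-roughly geodesic for some `C ≥ 0`: any two points are joined by a
`C`-rough geodesic. -/
def IsRoughGeodesicSpace (X : Type*) [MetricSpace X] : Prop :=
  ∃ C : ℝ, 0 ≤ C ∧ ∀ x y : X, ∃ (b : ℝ) (γ : ℝ → X), 0 ≤ b ∧ γ 0 = x ∧ γ b = y ∧
    ∀ s ∈ Set.Icc (0:ℝ) b, ∀ t ∈ Set.Icc (0:ℝ) b, abs (dist (γ s) (γ t) - |s - t|) ≤ C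

/-- Bounded growth at some scale: there are `0 < r < R` and `N` such that every ball of
radius `R` is covered by at most `N` balls of radius `r`. -/
def HasBoundedGrowthAtSomeScale (X : Type*) [MetricSpace X] : Prop :=
  ∃ (r R : ℝ) (N : ℕ), 0 < r ∧ r < R ∧
    ∀ x : X, ∃ s : Finset X, s.card ≤ N ∧ Metric.ball x R ⊆ ⋃ y ∈ s, Metric.ball y r

/-! ### The Gromov boundary -/

/-- A sequence is divergent if it is Cauchy for the Gromov-product quasi-metric, i.e.
`(u n | u m)_o → ∞`. -/
def IsDivergent {X : Type*} [MetricSpace X] (o : X) (u : ℕ → X) : Prop :=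
  Tendsto (fun pr : ℕ × ℕ => gp o (u pr.1) (u pr.2)) atTop atTop

/-- The type of divergent sequences. -/
def DivSeq (X : Type*) [MetricSpace X] (o : X) : Type _ := {u : ℕ → X // IsDivergent o u}

/-- Two divergent sequences are equivalent when `(u n | v m)_o → ∞`. -/
def bndRel {X : Type*} [MetricSpace X] (o : X) (u v : DivSeq X o) : Prop :=
  Tendsto (fun pr : ℕ × ℕ => gp o (u.1 pr.1) (v.1 pr.2)) atTop atTop

/-- The Gromov boundary: equivalence classes of divergent sequences. -/
def Boundary (X : Type*) [MetricSpace X] (o : X) : Type _ := Quot (bndRel o)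

/-- The boundary point of a divergent sequence. -/
def mkB {X : Type*} [MetricSpace X] (o : X) (u : DivSeq X o) : Boundary X o :=
  Quot.mk _ u

/-- The extended Gromov product of two boundary points: the infimum over pairs of
representatives of the liminf of Gromov products. -/
def gpB {X : Type*} [MetricSpace X] (o : X) (ξ η : Boundary X o) : ℝ :=
  sInf {t : ℝ | ∃ u v : DivSeq X o, mkB o u = ξ ∧ mkB o v = η ∧
    t = Filter.liminf (fun pr : ℕ × ℕ => gp o (u.1 pr.1) (v.1 pr.2)) atTop}

/-- The quasi-metric `q(ξ,η) = exp(-(ξ|η)_o)` on the boundary (`0` on the diagonal). -/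
def qB {X : Type*} [MetricSpace X] (o : X) (ξ η : Boundary X o) : ℝ :=
  if ξ = η then 0 else Real.exp (-(gpB o ξ η))

/-- The extended Gromov product of an interior point with a boundary point. -/
def gpXB {X : Type*} [MetricSpace X] (o : X) (x : X) (ξ : Boundary X o) : ℝ :=
  sInf {t : ℝ | ∃ u : DivSeq X o, mkB o u = ξ ∧
    t = Filter.liminf (fun m : ℕ => gp o x (u.1 m)) atTop}

/-- Quasi-metric between an interior point and a boundary point. -/
def qXB {X : Type*} [MetricSpace X] (o : X) (x : X) (ξ : Boundary X o) : ℝ :=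
  Real.exp (-(gpXB o x ξ))

/-- The open ball of a quasi-metric. -/
def qball {A : Type*} (q : A → A → ℝ) (ξ : A) (r : ℝ) : Set A := {η | q ξ η < r}

/-- The max quasi-metric `q̄` on the product of two boundaries. -/
def qbb {X Xs : Type*} [MetricSpace X] [MetricSpace Xs] (o : X) (os : Xs)
    (ξ η : Boundary X o × Boundary Xs os) : ℝ :=
  max (qB o ξ.1 η.1) (qB os ξ.2 η.2)

/-- Boundaries are measurable spaces, with the σ-algebra generated by quasi-metric balls. -/
instance (X : Type*) [MetricSpace X] (o : X) : MeasurableSpace (Boundary X o) :=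
  MeasurableSpace.generateFrom {s | ∃ ξ r, s = qball (qB o) ξ r}

/-! ### The boundary action of isometries -/

lemma gp_isometry_le {X : Type*} [MetricSpace X] (o : X) (g : X ≃ᵢ X) (x y : X) :
    gp o x y - dist o (g o) ≤ gp o (g x) (g y) := by
  have e1 : dist (g x) (g o) = dist x o := g.dist_eq x o
  have e2 : dist (g o) (g y) = dist o y := g.dist_eq o y
  have e3 : dist (g x) (g y) = dist x y := g.dist_eq x y
  have e4 : dist (g o) o = dist o (g o) := dist_comm _ _
  have t1 : dist (g x) (g o) ≤ dist (g x) o + dist o (g o) := dist_triangle _ _ _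
  have t2 : dist (g o) (g y) ≤ dist (g o) o + dist o (g y) := dist_triangle _ _ _
  simp only [gp]
  linarith [t1, t2, e1, e2, e3, e4]

lemma isDivergent_comp {X : Type*} [MetricSpace X] (o : X) (g : X ≃ᵢ X) {u : ℕ → X}
    (h : IsDivergent o u) : IsDivergent o fun n => g (u n) := by
  have h' := tendsto_atTop_add_const_right atTop (-(dist o (g o)))
    (h : Tendsto (fun pr : ℕ × ℕ => gp o (u pr.1) (u pr.2)) atTop atTop)
  refine tendsto_atTop_mono (fun pr => ?_) h'
  have := gp_isometry_le o g (u pr.1) (u pr.2)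
  simpa [sub_eq_add_neg] using this

lemma bndRel_comp {X : Type*} [MetricSpace X] (o : X) (g : X ≃ᵢ X) {u v : DivSeq X o}
    (h : bndRel o u v) :
    bndRel o ⟨fun n => g (u.1 n), isDivergent_comp o g u.2⟩
      ⟨fun n => g (v.1 n), isDivergent_comp o g v.2⟩ := by
  have h' := tendsto_atTop_add_const_right atTop (-(dist o (g o)))
    (h : Tendsto (fun pr : ℕ × ℕ => gp o (u.1 pr.1) (v.1 pr.2)) atTop atTop)
  refine tendsto_atTop_mono (fun pr => ?_) h'
  have := gp_isometry_le o g (u.1 pr.1) (v.1 pr.2)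
  simpa [sub_eq_add_neg] using this

/-- The induced action of an isometry on the Gromov boundary. -/
def bAct {X : Type*} [MetricSpace X] (o : X) (g : X ≃ᵢ X) :
    Boundary X o → Boundary X o :=
  Quot.map (fun u : DivSeq X o =>
      (⟨fun n => g (u.1 n), isDivergent_comp o g u.2⟩ : DivSeq X o))
    (fun _ _ h => bndRel_comp o g h)

/-! ### Random walks on countable groups -/

/-- Convolution of two measures (as `ℝ≥0∞`-valued functions) on a group. -/
def conv {G : Type*} [Group G] (p q : G → ℝ≥0∞) : G → ℝ≥0∞ :=
  fun x => ∑' y : G, p y * q (y⁻¹ * x)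

/-- The `n`-fold convolution power `π_n` of `p`. -/
def piN {G : Type*} [Group G] (p : G → ℝ≥0∞) : ℕ → G → ℝ≥0∞
  | 0 => fun x => if x = 1 then 1 else 0
  | n + 1 => conv (piN p n) p

/-- The Shannon entropy `H(π_n)` of the `n`-th convolution power. -/
def entropySeq {G : Type*} [Group G] (p : G → ℝ≥0∞) (n : ℕ) : ℝ :=
  ∑' x : G, Real.negMulLog ((piN p n x).toReal)

/-- The first moment of `π_n` with respect to a displacement function `f`. -/
def momentSeq {G : Type*} [Group G] (p : G → ℝ≥0∞) (f : G → ℝ) (n : ℕ) : ℝ :=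
  ∑' x : G, (piN p n x).toReal * f x

/-- `h` is the asymptotic entropy of the `p`-random walk:
`h = lim (1/n) H(π_n)`. -/
def HasEntropy {G : Type*} [Group G] (p : G → ℝ≥0∞) (h : ℝ) : Prop :=
  Tendsto (fun n : ℕ => entropySeq p n / n) atTop (nhds h)

/-- `l` is the drift (rate of escape) of the `p`-random walk with respect to the
displacement `f`: `l = lim (1/n) Σ_x f(x) π_n(x)`. -/
def HasDrift {G : Type*} [Group G] (p : G → ℝ≥0∞) (f : G → ℝ) (l : ℝ) : Prop :=
  Tendsto (fun n : ℕ => momentSeq p f n / n) atTop (nhds l)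

/-- `p` is a probability distribution. -/
def IsProb {G : Type*} (p : G → ℝ≥0∞) : Prop := ∑' x : G, p x = 1

/-- Finite first moment with respect to a displacement function `f`. -/
def FiniteFirstMoment {G : Type*} (p : G → ℝ≥0∞) (f : G → ℝ) : Prop :=
  ∑' x : G, p x * ENNReal.ofReal (f x) ≠ ∞

/-- The pushforward of a distribution `p` by a map `f` (e.g. a marginal). -/
def marginalStar {G A : Type*} (p : G → ℝ≥0∞) (f : G → A) : A → ℝ≥0∞ :=
  fun a => ∑' x : G, if f x = a then p x else 0

/-- A subgroup is non-elementary (in the relevant sense) if it contains a free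
subgroup of rank 2. -/
def IsNonElementarySubgroup {G : Type*} [Group G] (H : Subgroup G) : Prop :=
  ∃ φ : FreeGroup (Fin 2) →* G, Function.Injective φ ∧ φ.range ≤ H

/-- A measure `p` on a group is non-elementary if the subgroup generated by its
support contains a free subgroup of rank 2. -/
def IsNonElemMeasure {G : Type*} [Group G] (p : G → ℝ≥0∞) : Prop :=
  IsNonElementarySubgroup (Subgroup.closure {x : G | p x ≠ 0})

/-- A group containing a free subgroup of rank 2 (a non-elementary group). -/
def HasFreeSubgroup (G : Type*) [Group G] : Prop :=
  ∃ φ : FreeGroup (Fin 2) →* G, Function.Injective φ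

/-! ### Path space -/

/-- The position `w_n = x_1 ⋯ x_n` of the random walk with increments `ω`. -/
def walk {G : Type*} [Group G] (ω : ℕ → G) (n : ℕ) : G := ((List.range n).map ω).prod

/-- The cylinder set `[w̄_0, …, w̄_n]` of trajectories whose positions agree with those
of `ω` up to time `n`. -/
def cyl {G : Type*} [Group G] (ω : ℕ → G) (n : ℕ) : Set (ℕ → G) :=
  {ω' | ∀ i ≤ n, walk ω' i = walk ω i}

/-- `P` is the distribution of the increments of the `p`-random walk: the product
measure `p^{⊗ℕ}` on the path space. -/
def IsRWMeasure {G : Type*} [Group G] [MeasurableSpace G] (p : G → ℝ≥0∞)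
    (P : Measure (ℕ → G)) : Prop :=
  IsProbabilityMeasure P ∧
    ∀ (n : ℕ) (g : ℕ → G), P {ω | ∀ i < n, ω i = g i} = ∏ i ∈ Finset.range n, p (g i)

/-- `ν` is the harmonic measure on the boundary of `X` for the random walk with path
measure `P` and orbit map `z`: the image of `P` under the a.s.-defined boundary map. -/
def IsHarmonic {Ω X : Type*} [MeasurableSpace Ω] [MetricSpace X] (o : X)
    (P : Measure Ω) (z : Ω → ℕ → X) (ν : Measure (Boundary X o)) : Prop :=
  ∃ bnd : Ω → Boundary X o, Measurable bnd ∧ ν = P.map bnd ∧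
    ∀ᵐ ω ∂P, ∃ h : IsDivergent o (z ω), bnd ω = mkB o ⟨z ω, h⟩

/-- `ν` is the harmonic measure on the product of the boundaries of `X` and `Xs` for
the random walk with path measure `P` and orbit maps `z`, `zs`. -/
def IsJointHarmonic {Ω X Xs : Type*} [MeasurableSpace Ω] [MetricSpace X] [MetricSpace Xs]
    (o : X) (os : Xs) (P : Measure Ω) (z : Ω → ℕ → X) (zs : Ω → ℕ → Xs)
    (ν : Measure (Boundary X o × Boundary Xs os)) : Prop :=
  ∃ bnd : Ω → Boundary X o × Boundary Xs os, Measurable bnd ∧ ν = P.map bnd ∧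
    ∀ᵐ ω ∂P, ∃ (h1 : IsDivergent o (z ω)) (h2 : IsDivergent os (zs ω)),
      bnd ω = (mkB o ⟨z ω, h1⟩, mkB os ⟨zs ω, h2⟩)

/-- `cond` is a disintegration (system of conditional measures) of `P` with respect to
the map `f`, over the pushforward `νB = f_* P`. -/
def IsDisintegration {A B : Type*} [MeasurableSpace A] [MeasurableSpace B]
    (P : Measure A) (f : A → B) (νB : Measure B) (cond : B → Measure A) : Prop :=
  νB = P.map f ∧ (∀ᵐ b ∂νB, IsProbabilityMeasure (cond b)) ∧
    (∀ᵐ b ∂νB, cond b (f ⁻¹' {b}) = 1) ∧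
    ∀ s : Set A, MeasurableSet s → P s = ∫⁻ b, cond b s ∂νB

/-! ### Hausdorff dimension for quasi-metrics -/

/-- Diameter of a set for a quasi-metric. -/
def qdiam {A : Type*} (q : A → A → ℝ) (E : Set A) : ℝ≥0∞ :=
  ⨆ x ∈ E, ⨆ y ∈ E, ENNReal.ofReal (q x y)

/-- Hausdorff pre-measure (content) at scale `Δ`. -/
def qHContent {A : Type*} (q : A → A → ℝ) (α Δ : ℝ) (E : Set A) : ℝ≥0∞ :=
  ⨅ (c : ℕ → Set A) (_ : E ⊆ ⋃ i, c i) (_ : ∀ i, qdiam q (c i) ≤ ENNReal.ofReal Δ),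
    ∑' i, qdiam q (c i) ^ α

/-- The `α`-dimensional Hausdorff measure of a set for a quasi-metric. -/
def qHMeasure {A : Type*} (q : A → A → ℝ) (α : ℝ) (E : Set A) : ℝ≥0∞ :=
  ⨆ (Δ : ℝ) (_ : 0 < Δ), qHContent q α Δ E

/-- The Hausdorff dimension of a set for a quasi-metric. -/
def qdimSet {A : Type*} (q : A → A → ℝ) (E : Set A) : ℝ :=
  sSup {α : ℝ | 0 ≤ α ∧ 0 < qHMeasure q α E}

/-- The upper Hausdorff dimension of a measure. -/
def qdimUpper {A : Type*} [MeasurableSpace A] (q : A → A → ℝ) (ν : Measure A) : ℝ :=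
  sInf {d : ℝ | ∃ E : Set A, MeasurableSet E ∧ ν Eᶜ = 0 ∧ d = qdimSet q E}

/-- The lower Hausdorff dimension of a measure. -/
def qdimLower {A : Type*} [MeasurableSpace A] (q : A → A → ℝ) (ν : Measure A) : ℝ :=
  sInf {d : ℝ | ∃ E : Set A, MeasurableSet E ∧ 0 < ν E ∧ d = qdimSet q E}

/-- The Hausdorff dimension of `ν` exists and equals `D`. -/
def HasDim {A : Type*} [MeasurableSpace A] (q : A → A → ℝ) (ν : Measure A) (D : ℝ) : Prop :=
  qdimUpper q ν = D ∧ qdimLower q ν = D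

/-- `ν` is exact dimensional with dimension `D` for the quasi-metric `q`:
`lim_{r→0} log ν(B(ξ,r))/log r = D` for `ν`-a.e. `ξ`. -/
def ExactDim {A : Type*} [MeasurableSpace A] (q : A → A → ℝ) (ν : Measure A) (D : ℝ) : Prop :=
  ∀ᵐ ξ ∂ν, Tendsto (fun r : ℝ => Real.log (ν (qball q ξ r)).toReal / Real.log r)
    (nhdsWithin 0 (Set.Ioi 0)) (nhds D)

/-! ### Differential entropy -/

/-- The differential entropy
`h(∂X*, μ*) = Σ_g μ*(g) ∫ log (d gν/dν) d(gν)` of a measure on the isometry group with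
respect to a boundary measure. -/
def diffEntropy {Xs : Type*} [MetricSpace Xs] (os : Xs) (pstar : (Xs ≃ᵢ Xs) → ℝ≥0∞)
    (νs : Measure (Boundary Xs os)) : ℝ :=
  ∑' g : (Xs ≃ᵢ Xs), (pstar g).toReal *
    ∫ η, Real.log ((Measure.rnDeriv (νs.map (bAct os g)) νs η).toReal)
      ∂(νs.map (bAct os g))

/-! ### Word metrics and hyperbolic groups -/

/-- The word length of `g` with respect to a (symmetrized) generating set `S`. -/
def wordLength {G : Type*} [Group G] (S : Set G) (g : G) : ℕ :=
  sInf {n : ℕ | ∃ f : Fin n → G, (∀ i, f i ∈ S ∨ (f i)⁻¹ ∈ S) ∧ g = (List.ofFn f).prod}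

/-- The metric of `G` is quasi-isometric to a word metric of a finite generating set. -/
def IsQIToWordMetric (G : Type*) [Group G] [MetricSpace G] : Prop :=
  ∃ S : Finset G, Subgroup.closure (S : Set G) = ⊤ ∧
    ∃ Λ c : ℝ, 1 ≤ Λ ∧ 0 ≤ c ∧ ∀ g : G,
      (wordLength (S : Set G) g : ℝ) / Λ - c ≤ dist (1 : G) g ∧
      dist (1 : G) g ≤ Λ * (wordLength (S : Set G) g) + c

/-- The metric of `G` is left invariant. -/
def LeftInvariantMetric (G : Type*) [Group G] [MetricSpace G] : Prop :=
  ∀ g x y : G, dist (g * x) (g * y) = dist x y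

/-- `G`, with its metric, is a hyperbolic group: the metric is left invariant,
hyperbolic and quasi-isometric to a word metric. -/
def IsHypGroupMetric (G : Type*) [Group G] [MetricSpace G] : Prop :=
  LeftInvariantMetric G ∧ IsHyperbolic G ∧ IsQIToWordMetric G

/-! ### Groups of isometries of a product -/

/-- First component of an element of a subgroup of `Isom X × Isom X*`. -/
def proj1 {X Xs : Type*} [MetricSpace X] [MetricSpace Xs]
    {Γb : Subgroup ((X ≃ᵢ X) × (Xs ≃ᵢ Xs))} (γ : Γb) : X ≃ᵢ X :=
  (γ : (X ≃ᵢ X) × (Xs ≃ᵢ Xs)).1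

/-- Second component of an element of a subgroup of `Isom X × Isom X*`. -/
def proj2 {X Xs : Type*} [MetricSpace X] [MetricSpace Xs]
    {Γb : Subgroup ((X ≃ᵢ X) × (Xs ≃ᵢ Xs))} (γ : Γb) : Xs ≃ᵢ Xs :=
  (γ : (X ≃ᵢ X) × (Xs ≃ᵢ Xs)).2

/-- Displacement `d̄(ō, γ·ō)` of the base point `ō = (o,o*)` (the metric of the product
is the max metric). -/
def disp {X Xs : Type*} [MetricSpace X] [MetricSpace Xs]
    {Γb : Subgroup ((X ≃ᵢ X) × (Xs ≃ᵢ Xs))} (o : X) (os : Xs) (γ : Γb) : ℝ :=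
  dist (o, os) (proj1 γ o, proj2 γ os)

/-- Finite exponential growth relative to a displacement function `f`:
`#{x : f(x) < r} ≤ c e^{c r}`. -/
def FinExpGrowth {G : Type*} (f : G → ℝ) : Prop :=
  ∃ c : ℝ, 0 < c ∧ ∀ r : ℝ, 0 < r →
    {x : G | f x < r}.Finite ∧ ({x : G | f x < r}.ncard : ℝ) ≤ c * Real.exp (c * r)

/-! ### The events of Lemmas `A` and `E_n(η)` -/

/-- The event `A_{ε,n} = ∩_{t ≥ n} {z̄_∞ exists and q̄(z̄_t, z̄_∞) ≤ e^{-(l*-ε)n}}`. -/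
def Aev {X Xs : Type*} [MetricSpace X] [MetricSpace Xs]
    (Γb : Subgroup ((X ≃ᵢ X) × (Xs ≃ᵢ Xs))) (o : X) (os : Xs) (ε lst : ℝ) (n : ℕ) :
    Set (ℕ → Γb) :=
  {ω | ∃ (h1 : IsDivergent o (fun t => proj1 (walk ω t) o))
        (h2 : IsDivergent os (fun t => proj2 (walk ω t) os)),
      ∀ t, n ≤ t →
        max (qXB o (proj1 (walk ω t) o) (mkB o ⟨_, h1⟩))
            (qXB os (proj2 (walk ω t) os) (mkB os ⟨_, h2⟩))
          ≤ Real.exp (-((lst - ε) * n))}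

/-- The event
`E_{ε,n}(η) = {P^η([w̄_0,…,w̄_n] ∩ A_{ε,n}) ≤ e^{n(h*+ε)} P([w̄_0,…,w̄_n] ∩ A_{ε,n})}`. -/
def Eev {X Xs : Type*} [MetricSpace X] [MetricSpace Xs]
    (Γb : Subgroup ((X ≃ᵢ X) × (Xs ≃ᵢ Xs))) [MeasurableSpace Γb] (o : X) (os : Xs)
    (P : Measure (ℕ → Γb)) (condP : Boundary Xs os → Measure (ℕ → Γb))
    (hst ε lst : ℝ) (η : Boundary Xs os) (n : ℕ) : Set (ℕ → Γb) :=
  {ω | condP η (cyl ω n ∩ Aev Γb o os ε lst n) ≤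
        ENNReal.ofReal (Real.exp (n * (hst + ε))) * P (cyl ω n ∩ Aev Γb o os ε lst n)}

/-! ### Special measures -/

/-- The measure `π^ρ = ρ μ×μ + (1-ρ) μ_diag` on `Γ × Γ`. -/
def pRho {Γ : Type*} (p : Γ → ℝ≥0∞) (ρ : ℝ) : Γ × Γ → ℝ≥0∞ :=
  fun g => ENNReal.ofReal ρ * (p g.1 * p g.2) +
    ENNReal.ofReal (1 - ρ) * (if g.1 = g.2 then p g.1 else 0)

/-- The uniform distribution on the symmetrized free basis of `F_{m+1}`. -/
def symFreeBasisUniform (m : ℕ) : FreeGroup (Fin (m + 1)) → ℝ≥0∞ :=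
  fun g => if ∃ i : Fin (m + 1), g = FreeGroup.of i ∨ g = (FreeGroup.of i)⁻¹
    then ENNReal.ofReal (1 / (2 * (m + 1))) else 0

/-- The homomorphism `F_{m+1} → F_m` sending `x_i ↦ y_i` for `i ≤ m` and `x_{m+1} ↦ 1`. -/
def projHom (m : ℕ) : FreeGroup (Fin (m + 1)) →* FreeGroup (Fin m) :=
  FreeGroup.lift (fun i => if h : (i : ℕ) < m then FreeGroup.of (⟨i, h⟩ : Fin m) else 1)

set_option linter.unusedVariables false
set_option linter.unusedSectionVars false


/-! ### Part 1: geometry -/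

section Geometry
variable {X : Type*} [MetricSpace X]

lemma gp_comm (o x y : X) : gp o x y = gp o y x := by
  simp only [gp, dist_comm x y, dist_comm x o, dist_comm y o]; ring

lemma gp_nonneg (o x y : X) : 0 ≤ gp o x y := by
  have := dist_triangle x o y
  simp only [gp]; linarith

lemma gp_self (o x : X) : gp o x x = dist o x := by
  simp only [gp, dist_self, dist_comm x o]; ring

lemma gp_le_left (o x y : X) : gp o x y ≤ dist o x := by
  have := dist_triangle o x y
  simp only [gp, dist_comm x o]; linarith

lemma gp_ge (o x y : X) : dist o x - dist x y ≤ gp o x y := by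
  have := dist_triangle x y o
  simp only [gp, dist_comm y o, dist_comm x o] at *; linarith

lemma dist_eq_gp (o x y : X) : dist x y = dist o x + dist o y - 2 * gp o x y := by
  simp only [gp, dist_comm x o]; ring

/-- eventual lower bound for Gromov products of two sequences -/
def Ev (o : X) (R : ℝ) (u v : ℕ → X) : Prop :=
  ∃ N, ∀ i, N ≤ i → ∀ j, N ≤ j → R ≤ gp o (u i) (v j)

lemma tendsto_iff_ev (o : X) (u v : ℕ → X) :
    Tendsto (fun pr : ℕ × ℕ => gp o (u pr.1) (v pr.2)) atTop atTop ↔ ∀ R, Ev o R u v := by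
  rw [Filter.tendsto_atTop]
  refine forall_congr' fun R => ?_
  rw [eventually_atTop]
  constructor
  · rintro ⟨⟨a, b⟩, h⟩
    exact ⟨max a b, fun i hi j hj => h (i, j) ⟨le_trans (le_max_left _ _) hi,
      le_trans (le_max_right _ _) hj⟩⟩
  · rintro ⟨N, h⟩
    exact ⟨(N, N), fun p hp => h p.1 hp.1 p.2 hp.2⟩

lemma Ev.symm {o : X} {R : ℝ} {u v : ℕ → X} (h : Ev o R u v) : Ev o R v u := by
  obtain ⟨N, h⟩ := h
  exact ⟨N, fun i hi j hj => by rw [gp_comm]; exact h j hj i hi⟩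

lemma Ev.mono {o : X} {R R' : ℝ} {u v : ℕ → X} (h : Ev o R u v) (hR : R' ≤ R) : Ev o R' u v := by
  obtain ⟨N, h⟩ := h
  exact ⟨N, fun i hi j hj => hR.trans (h i hi j hj)⟩

lemma Ev.trans {o : X} {δ R : ℝ} (hδ : IsHyperbolicWith X δ) {u v w : ℕ → X}
    (h : Ev o R u v) (h' : Ev o R v w) : Ev o (R - δ) u w := by
  obtain ⟨N, h⟩ := h
  obtain ⟨N', h'⟩ := h'
  refine ⟨max N N', fun i hi j hj => ?_⟩
  have h1 := h i (le_trans (le_max_left _ _) hi) (max N N') (le_max_left _ _)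
  have h2 := h' (max N N') (le_max_right _ _) j (le_trans (le_max_right _ _) hj)
  have := hδ (u i) (w j) (v (max N N')) o
  have h3 := le_min h1 h2
  linarith

lemma bndRel_equiv {o : X} {δ : ℝ} (hδ : IsHyperbolicWith X δ) :
    Equivalence (bndRel o) := by
  refine ⟨fun u => u.2, fun {u v} h => ?_, fun {u v w} h h' => ?_⟩
  · rw [bndRel, tendsto_iff_ev] at *
    exact fun R => (h R).symm
  · rw [bndRel, tendsto_iff_ev] at *
    exact fun R => ((h (R + δ)).trans hδ (h' (R + δ))).mono (by linarith)

lemma mkB_eq_iff {o : X} {δ : ℝ} (hδ : IsHyperbolicWith X δ) (u v : DivSeq X o) :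
    mkB o u = mkB o v ↔ ∀ R, Ev o R u.1 v.1 := by
  rw [← tendsto_iff_ev]
  constructor
  · intro h
    have := Quot.eqvGen_exact h
    rwa [(bndRel_equiv hδ).eqvGen_iff] at this
  · intro h
    exact Quot.sound h

lemma liminf_gp_nonneg (o : X) (u v : ℕ → X) :
    0 ≤ Filter.liminf (fun pr : ℕ × ℕ => gp o (u pr.1) (v pr.2)) atTop := by
  rw [Filter.liminf_eq]
  exact Real.sSup_nonneg' ⟨0, Eventually.of_forall fun p => gp_nonneg _ _ _, le_rfl⟩

lemma ev_of_lt_gpB {o : X} {R : ℝ} (u v : DivSeq X o)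
    (h : R < gpB o (mkB o u) (mkB o v)) : Ev o R u.1 v.1 := by
  have hle : gpB o (mkB o u) (mkB o v) ≤
      Filter.liminf (fun pr : ℕ × ℕ => gp o (u.1 pr.1) (v.1 pr.2)) atTop := by
    refine csInf_le ⟨0, ?_⟩ ⟨u, v, rfl, rfl, rfl⟩
    rintro t ⟨u', v', -, -, rfl⟩
    exact liminf_gp_nonneg _ _ _
  have h2 := Filter.eventually_lt_of_lt_liminf (h.trans_le hle)
    ⟨0, Filter.eventually_map.2 (Eventually.of_forall fun p : ℕ × ℕ => gp_nonneg o (u.1 p.1) (v.1 p.2))⟩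
  rw [eventually_atTop] at h2
  obtain ⟨⟨a, b⟩, h2⟩ := h2
  exact ⟨max a b, fun i hi j hj => (h2 (i, j) ⟨le_trans (le_max_left _ _) hi,
      le_trans (le_max_right _ _) hj⟩).le⟩

lemma le_gpB_of_ev {o : X} {δ R : ℝ} (hδ : IsHyperbolicWith X δ) (hδ0 : 0 ≤ δ) (u v : DivSeq X o)
    (hne : mkB o u ≠ mkB o v) (h : Ev o R u.1 v.1) : R - 2 * δ ≤ gpB o (mkB o u) (mkB o v) := by
  refine le_csInf ⟨_, u, v, rfl, rfl, rfl⟩ ?_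
  rintro t ⟨u', v', hu, hv, rfl⟩
  have h1 : Ev o R u'.1 u.1 := (mkB_eq_iff hδ _ _).1 hu R
  have h2 : Ev o (R - δ) v.1 v'.1 := (mkB_eq_iff hδ _ _).1 hv.symm (R - δ)
  have h3 : Ev o (R - 2 * δ) u'.1 v'.1 := ((h1.trans hδ h).trans hδ h2).mono (by linarith)
  rw [Filter.liminf_eq]
  refine le_csSup ?_ ?_
  · by_contra hb
    apply hne
    rw [← hu, ← hv, mkB_eq_iff hδ]
    intro S
    rw [not_bddAbove_iff] at hb
    obtain ⟨a, ha, haS⟩ := hb S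
    simp only [Set.mem_ofPred_eq] at ha
    rw [eventually_atTop] at ha
    obtain ⟨⟨p, q⟩, ha⟩ := ha
    exact ⟨max p q, fun i hi j hj => haS.le.trans (ha (i, j) ⟨le_trans (le_max_left _ _) hi,
      le_trans (le_max_right _ _) hj⟩)⟩
  · obtain ⟨N, h3⟩ := h3
    simp only [Set.mem_ofPred_eq]
    rw [eventually_atTop]
    exact ⟨(N, N), fun p hp => h3 p.1 hp.1 p.2 hp.2⟩

lemma ev_of_qB_lt {o : X} {δ R : ℝ} (hδ : IsHyperbolicWith X δ) (u v : DivSeq X o)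
    (h : qB o (mkB o u) (mkB o v) < Real.exp (-R)) : Ev o R u.1 v.1 := by
  by_cases he : mkB o u = mkB o v
  · exact (mkB_eq_iff hδ _ _).1 he R
  · simp only [qB, he, if_false, Real.exp_lt_exp] at h
    exact ev_of_lt_gpB u v (by linarith)

lemma qB_le_of_ev {o : X} {δ R : ℝ} (hδ : IsHyperbolicWith X δ) (hδ0 : 0 ≤ δ) (u v : DivSeq X o)
    (h : Ev o R u.1 v.1) : qB o (mkB o u) (mkB o v) ≤ Real.exp (-(R - 2 * δ)) := by
  by_cases he : mkB o u = mkB o v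
  · simp only [qB, he, if_true]; positivity
  · simp only [qB, he, if_false, Real.exp_le_exp]
    have := le_gpB_of_ev hδ hδ0 u v he h
    linarith

/-- quasi-metric axioms in a convenient form -/
structure QM {A : Type*} (q : A → A → ℝ) (κ : ℝ) : Prop where
  one_le : 1 ≤ κ
  nonneg : ∀ x y, 0 ≤ q x y
  self : ∀ x, q x x = 0
  symm : ∀ x y r, q x y < r → q y x ≤ κ * r
  tri : ∀ x y z r, q x y < r → q y z < r → q x z ≤ κ * r

lemma qB_nonneg (o : X) (ξ η : Boundary X o) : 0 ≤ qB o ξ η := by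
  simp only [qB]; split_ifs <;> positivity

lemma qm_qB {o : X} {δ : ℝ} (hδ : IsHyperbolicWith X δ) (hδ0 : 0 ≤ δ) :
    QM (qB o) (Real.exp (3 * δ)) := by
  refine ⟨Real.one_le_exp (by positivity), qB_nonneg o, fun x => by simp [qB], ?_, ?_⟩
  · intro x y r h
    have hr : 0 < r := (qB_nonneg o x y).trans_lt h
    obtain ⟨u, rfl⟩ := Quot.exists_rep x
    obtain ⟨v, rfl⟩ := Quot.exists_rep y
    rw [← Real.exp_log hr, ← neg_neg (Real.log r)] at h
    have h1 := qB_le_of_ev hδ hδ0 v u (ev_of_qB_lt hδ u v h).symm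
    refine h1.trans ?_
    conv_rhs => rw [← Real.exp_log hr, ← Real.exp_add]
    apply Real.exp_le_exp.2; linarith
  · intro x y z r h h'
    have hr : 0 < r := (qB_nonneg o x y).trans_lt h
    obtain ⟨u, rfl⟩ := Quot.exists_rep x
    obtain ⟨v, rfl⟩ := Quot.exists_rep y
    obtain ⟨w, rfl⟩ := Quot.exists_rep z
    rw [← Real.exp_log hr, ← neg_neg (Real.log r)] at h h'
    have h1 := qB_le_of_ev hδ hδ0 u w ((ev_of_qB_lt hδ u v h).trans hδ (ev_of_qB_lt hδ v w h'))
    refine h1.trans ?_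
    conv_rhs => rw [← Real.exp_log hr, ← Real.exp_add]
    apply Real.exp_le_exp.2; linarith

lemma QM.mono {A : Type*} {q : A → A → ℝ} {κ κ' : ℝ} (h : QM q κ) (hk : κ ≤ κ') : QM q κ' := by
  refine ⟨h.one_le.trans hk, h.nonneg, h.self, fun x y r hr => ?_, fun x y z r h1 h2 => ?_⟩
  · have hr0 : 0 < r := (h.nonneg x y).trans_lt hr
    exact (h.symm x y r hr).trans (by gcongr)
  · have hr0 : 0 < r := (h.nonneg x y).trans_lt h1
    exact (h.tri x y z r h1 h2).trans (by gcongr)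

lemma QM.prod {A B : Type*} {q : A → A → ℝ} {q' : B → B → ℝ} {κ κ' : ℝ}
    (h : QM q κ) (h' : QM q' κ') :
    QM (fun x y : A × B => max (q x.1 y.1) (q' x.2 y.2)) (max κ κ') := by
  have h := h.mono (le_max_left κ κ')
  have h' := h'.mono (le_max_right κ κ')
  refine ⟨h.one_le, fun x y => le_max_of_le_left (h.nonneg _ _), fun x => ?_, ?_, ?_⟩
  · simp [h.self, h'.self]
  · intro x y r hr
    rw [max_lt_iff] at hr
    exact max_le (h.symm _ _ _ hr.1) (h'.symm _ _ _ hr.2)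
  · intro x y z r hr hr'
    rw [max_lt_iff] at hr hr'
    exact max_le (h.tri _ _ _ _ hr.1 hr'.1) (h'.tri _ _ _ _ hr.2 hr'.2)

lemma qm_qbb {Xs : Type*} [MetricSpace Xs] {o : X} {os : Xs} {δ δs : ℝ}
    (hδ : IsHyperbolicWith X δ) (hδ0 : 0 ≤ δ)
    (hδs : IsHyperbolicWith Xs δs) (hδs0 : 0 ≤ δs) :
    QM (qbb o os) (max (Real.exp (3 * δ)) (Real.exp (3 * δs))) :=
  (qm_qB hδ hδ0).prod (qm_qB hδs hδs0)

/-- chain lemma -/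
lemma chain_lemma {o : X} {δ a b : ℝ} (hδ : IsHyperbolicWith X δ) (hδ0 : 0 ≤ δ)
    {K N L : ℕ} (hK : 1 ≤ K) (hKa : δ ≤ a * K)
    {u : ℕ → X}
    (h : ∀ n, N ≤ n → ∀ i, i ≤ K → n + i ≤ L → a * n - b ≤ gp o (u n) (u (n + i)))
    (n : ℕ) (hn : N ≤ n) (k : ℕ) (hk : n + k ≤ L) : a * n - b - δ ≤ gp o (u n) (u (n + k)) := by
  induction k using Nat.strong_induction_on generalizing n with
  | _ k ih =>
    by_cases hk' : k ≤ K
    · have := h n hn k hk' hk; linarith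
    · push Not at hk'
      have h1 := h n hn K le_rfl (by omega)
      have h2 := ih (k - K) (by omega) (n + K) (by omega) (by omega)
      have e : n + K + (k - K) = n + k := by omega
      rw [e] at h2
      have h3 := hδ (u n) (u (n + k)) (u (n + K)) o
      push_cast at h2
      have h4 : a * n - b ≤ min (gp o (u n) (u (n + K))) (gp o (u (n + K)) (u (n + k))) :=
        le_min h1 (by nlinarith)
      linarith

/-- tracking at time `t` with radius `R` and error `e` -/
def Track (o : X) (u : ℕ → X) (t : ℕ) (R e : ℝ) : Prop :=
  |dist o (u t) - R| ≤ e ∧ ∀ m, t ≤ m → R - e ≤ gp o (u t) (u m)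

lemma Track.mono {o : X} {u : ℕ → X} {t : ℕ} {R e e' : ℝ} (h : Track o u t R e) (he : e ≤ e') :
    Track o u t R e' :=
  ⟨h.1.trans he, fun m hm => (by linarith : R - e' ≤ R - e).trans (h.2 m hm)⟩

lemma Track.shift {o : X} {u : ℕ → X} {t : ℕ} {R e R' e' : ℝ} (h : Track o u t R e)
    (he : e + |R - R'| ≤ e') : Track o u t R' e' := by
  refine ⟨?_, fun m hm => ?_⟩
  · have h1 := h.1
    rw [abs_le] at h1 ⊢
    have h2 := neg_abs_le (R - R')
    have h3 := le_abs_self (R - R')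
    constructor <;> linarith [h1.1, h1.2]
  · have h2 := neg_abs_le (R - R')
    have := h.2 m hm
    linarith

lemma track_close {o : X} {δ : ℝ} (hδ : IsHyperbolicWith X δ) (hδ0 : 0 ≤ δ) (u v : DivSeq X o)
    {t : ℕ} {R e : ℝ} (hu : Track o u.1 t R e) (hv : Track o v.1 t R e) (huv : u.1 t = v.1 t) :
    qB o (mkB o u) (mkB o v) ≤ Real.exp (-(R - e - 3 * δ)) := by
  have : Ev o (R - e - δ) u.1 v.1 := by
    refine ⟨t, fun i hi j hj => ?_⟩
    have h1 := hu.2 i hi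
    have h2 := hv.2 j hj
    rw [gp_comm] at h1
    rw [← huv] at h2
    have := hδ (u.1 i) (v.1 j) (u.1 t) o
    have := le_min h1 h2
    linarith
  refine (qB_le_of_ev hδ hδ0 u v this).trans (Real.exp_le_exp.2 (by linarith))

lemma track_near {o : X} {δ : ℝ} (hδ : IsHyperbolicWith X δ) (hδ0 : 0 ≤ δ) (u v : DivSeq X o)
    {t : ℕ} {R e S : ℝ} (hu : Track o u.1 t R e) (hv : Track o v.1 t R e)
    (hS : S ≤ R - e)
    (h : qB o (mkB o u) (mkB o v) < Real.exp (-S)) :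
    dist (u.1 t) (v.1 t) ≤ 2 * (R - S) + 2 * e + 4 * δ := by
  obtain ⟨N, hN⟩ := ev_of_qB_lt hδ u v h
  set M := max N t
  have h1 := hu.2 M (le_max_right _ _)
  have h2 := hN M (le_max_left _ _) M (le_max_left _ _)
  have h3 := hv.2 M (le_max_right _ _)
  rw [gp_comm] at h3
  have h4 := hδ (u.1 t) (v.1 M) (u.1 M) o
  have h5 := hδ (u.1 t) (v.1 t) (v.1 M) o
  have h6 : S - δ ≤ gp o (u.1 t) (v.1 M) := by
    have := le_min (hS.trans h1) h2
    linarith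
  have h7 : S - 2 * δ ≤ gp o (u.1 t) (v.1 t) := by
    have := le_min h6 (by linarith : S - δ ≤ gp o (v.1 M) (v.1 t))
    linarith
  have := dist_eq_gp o (u.1 t) (v.1 t)
  have h8 := (abs_le.1 hu.1).2
  have h9 := (abs_le.1 hv.1).2
  linarith

lemma measurableSet_qball (o : X) (ξ : Boundary X o) (r : ℝ) :
    MeasurableSet (qball (qB o) ξ r) :=
  MeasurableSpace.measurableSet_generateFrom ⟨ξ, r, rfl⟩

lemma qball_qbb {Xs : Type*} [MetricSpace Xs] (o : X) (os : Xs)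
    (b : Boundary X o × Boundary Xs os) (r : ℝ) :
    qball (qbb o os) b r = qball (qB o) b.1 r ×ˢ qball (qB os) b.2 r := by
  ext ⟨x, y⟩
  simp [qball, qbb]

lemma measurableSet_qball_qbb {Xs : Type*} [MetricSpace Xs] (o : X) (os : Xs)
    (b : Boundary X o × Boundary Xs os) (r : ℝ) :
    MeasurableSet (qball (qbb o os) b r) := by
  rw [qball_qbb]
  exact (measurableSet_qball _ _ _).prod (measurableSet_qball _ _ _)

end Geometry

/-! ### Part 2: word metrics, growth and boundary covers -/

section Words
variable {G : Type*} [Group G]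

/-- `g` is a product of a word of length `n`. -/
def IsWord (S : Set G) (n : ℕ) (g : G) : Prop :=
  ∃ L : List G, L.length = n ∧ (∀ y ∈ L, y ∈ S ∨ y⁻¹ ∈ S) ∧ L.prod = g

lemma wordLength_eq (S : Set G) (g : G) : wordLength S g = sInf {n | IsWord S n g} := by
  unfold wordLength
  congr 1
  ext n
  constructor
  · rintro ⟨f, hf, rfl⟩
    refine ⟨List.ofFn f, by simp, ?_, rfl⟩
    intro y hy
    rw [List.mem_ofFn] at hy
    obtain ⟨i, rfl⟩ := hy
    exact hf i
  · rintro ⟨L, rfl, hL, rfl⟩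
    refine ⟨fun i => L.get i, fun i => hL _ (List.get_mem _ _), ?_⟩
    rw [List.ofFn_get]

lemma wordLength_le {S : Set G} {g : G} {n : ℕ} (h : IsWord S n g) : wordLength S g ≤ n := by
  rw [wordLength_eq]; exact Nat.sInf_le h

lemma isWord_wordLength {S : Set G} (hS : Subgroup.closure S = ⊤) (g : G) :
    IsWord S (wordLength S g) g := by
  rw [wordLength_eq]
  have : {n | IsWord S n g}.Nonempty := by
    have hg : g ∈ (Subgroup.closure S).toSubmonoid := by rw [hS]; trivial
    rw [Subgroup.closure_toSubmonoid] at hg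
    obtain ⟨L, hL, hp⟩ := Submonoid.exists_list_of_mem_closure hg
    exact ⟨L.length, L, rfl, hL, hp⟩
  exact Nat.sInf_mem this

lemma IsWord.mul {S : Set G} {m n : ℕ} {g h : G} (hg : IsWord S m g) (hh : IsWord S n h) :
    IsWord S (m + n) (g * h) := by
  obtain ⟨L, rfl, hL, rfl⟩ := hg
  obtain ⟨L', rfl, hL', rfl⟩ := hh
  refine ⟨L ++ L', by simp, ?_, by simp⟩
  intro y hy
  rcases List.mem_append.1 hy with h | h
  · exact hL y h
  · exact hL' y h

/-- prefixes of geodesic words -/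
lemma word_prefix {S : Set G} (hS : Subgroup.closure S = ⊤) (g : G) :
    ∃ u : ℕ → G, u 0 = 1 ∧ u (wordLength S g) = g ∧
      (∀ t, t ≤ wordLength S g → wordLength S (u t) = t) ∧
      ∀ t i, wordLength S ((u t)⁻¹ * u (t + i)) ≤ i := by
  obtain ⟨L, hlen, hL, hp⟩ := isWord_wordLength hS g
  have hu : ∀ t i, (L.take (t + i)).prod = (L.take t).prod * ((L.drop t).take i).prod := by
    intro t i
    rw [← List.prod_append, List.take_add]
  have hsub : ∀ t i, IsWord S ((L.drop t).take i).length (((L.take t).prod)⁻¹ * (L.take (t+i)).prod) := by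
    intro t i
    refine ⟨(L.drop t).take i, rfl, fun y hy => hL y ?_, ?_⟩
    · exact List.mem_of_mem_drop (List.mem_of_mem_take hy)
    · rw [hu]; group
  refine ⟨fun t => (L.take t).prod, by simp, ?_, ?_, ?_⟩
  · show (L.take _).prod = g
    rw [← hlen, List.take_length, hp]
  · intro t ht
    refine le_antisymm ?_ ?_
    · refine (wordLength_le (n := (L.take t).length) ⟨L.take t, rfl, fun y hy => hL y (List.mem_of_mem_take hy), rfl⟩).trans ?_
      simp
    · by_contra hlt
      push Not at hlt
      have h1 := isWord_wordLength hS (L.take t).prod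
      have h2 : IsWord S (L.drop t).length (L.drop t).prod :=
        ⟨_, rfl, fun y hy => hL y (List.mem_of_mem_drop hy), rfl⟩
      have h3 := h1.mul h2
      rw [← List.prod_append, List.take_append_drop, hp] at h3
      have := wordLength_le h3
      rw [List.length_drop] at this
      omega
  · intro t i
    refine (wordLength_le (hsub t i)).trans ?_
    simp

/-- finite set of elements of word length at most `n` -/
lemma word_count (S : Finset G) (hS : Subgroup.closure (S : Set G) = ⊤) :
    ∃ k : ℕ, 1 ≤ k ∧ ∀ n : ℕ, ∃ F : Finset G, F.card ≤ k ^ n ∧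
      ∀ g, wordLength (S : Set G) g ≤ n → g ∈ F := by
  let T : Finset G := insert 1 (S ∪ S.image (fun x => x⁻¹))
  refine ⟨T.card, Finset.card_pos.2 ⟨1, Finset.mem_insert_self _ _⟩, fun n => ?_⟩
  refine ⟨(Fintype.piFinset (fun _ : Fin n => T)).image (fun f => (List.ofFn f).prod), ?_, ?_⟩
  · refine Finset.card_image_le.trans ?_
    rw [Fintype.card_piFinset]
    simp
  · intro g hg
    obtain ⟨L, hlen, hL, hp⟩ := isWord_wordLength hS g
    rw [Finset.mem_image]
    have hl2 : (L ++ List.replicate (n - L.length) 1).length = n := by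
      simp; omega
    refine ⟨fun i => (L ++ List.replicate (n - L.length) 1).get (Fin.cast hl2.symm i), ?_, ?_⟩
    · rw [Fintype.mem_piFinset]
      intro i
      have := List.get_mem (L ++ List.replicate (n - L.length) 1) (Fin.cast hl2.symm i)
      rcases List.mem_append.1 this with h | h
      · rcases hL _ h with h | h
        · exact Finset.mem_insert_of_mem (Finset.mem_union_left _ (by exact_mod_cast h))
        · refine Finset.mem_insert_of_mem (Finset.mem_union_right _ ?_)
          rw [Finset.mem_image]
          exact ⟨_, by exact_mod_cast h, inv_inv _⟩
      · rw [List.eq_of_mem_replicate h]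
        exact Finset.mem_insert_self _ _
    · have : List.ofFn (fun i => (L ++ List.replicate (n - L.length) 1).get (Fin.cast hl2.symm i))
          = L ++ List.replicate (n - L.length) 1 := by
        apply List.ext_get
        · simp; omega
        · intro i h1 h2
          simp
      rw [this]
      simp [hp]

end Words

/-- exponential growth of balls -/
def Growth (G : Type*) [MetricSpace G] (C v : ℝ) : Prop :=
  0 < C ∧ 0 < v ∧ ∀ (x : G) (R : ℝ), 0 ≤ R → {g | dist x g ≤ R}.Finite ∧
    ({g | dist x g ≤ R}.ncard : ℝ) ≤ C * Real.exp (v * R)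

lemma growth_of_hyp {G : Type*} [Group G] [MetricSpace G] (h : IsHypGroupMetric G) :
    ∃ C v, Growth G C v := by
  obtain ⟨hinv, -, S, hS, Λ, c, hΛ, hc, hd⟩ := h
  obtain ⟨k, hk, hF⟩ := word_count S hS
  have hk0 : (1:ℝ) ≤ k := by exact_mod_cast hk
  have hk2 : (0:ℝ) < (k:ℝ) + 1 := by positivity
  have hlog : 0 < Real.log (k + 1) := Real.log_pos (by linarith)
  refine ⟨Real.exp (Real.log (k + 1) * (Λ * c + 1)), Real.log (k + 1) * Λ, Real.exp_pos _,
    by positivity, fun x R hR => ?_⟩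
  obtain ⟨F, hFc, hFm⟩ := hF ⌊Λ * (R + c)⌋₊
  have hsub : {g | dist x g ≤ R} ⊆ ((F.image (fun h => x * h) : Finset G) : Set G) := by
    intro g hg
    rw [Finset.coe_image]
    refine ⟨x⁻¹ * g, ?_, by simp⟩
    apply hFm
    have h1 := (hd (x⁻¹ * g)).1
    have h2 : dist 1 (x⁻¹ * g) = dist x g := by
      rw [← hinv x 1 (x⁻¹ * g)]; simp
    rw [h2] at h1
    have h3 : dist x g ≤ R := hg
    apply Nat.le_floor
    have h4 : (wordLength (S : Set G) (x⁻¹ * g) : ℝ) / Λ ≤ R + c := by linarith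
    rw [div_le_iff₀ (by linarith)] at h4
    linarith
  have hfin := (F.image (fun h => x * h)).finite_toSet.subset hsub
  refine ⟨hfin, ?_⟩
  have h1 : {g | dist x g ≤ R}.ncard ≤ k ^ ⌊Λ * (R + c)⌋₊ := by
    refine (Set.ncard_le_ncard hsub (Finset.finite_toSet _)).trans ?_
    rw [Set.ncard_coe_finset]
    exact Finset.card_image_le.trans hFc
  calc ({g | dist x g ≤ R}.ncard : ℝ) ≤ (k:ℝ) ^ ⌊Λ * (R + c)⌋₊ := by exact_mod_cast h1
    _ ≤ ((k:ℝ)+1) ^ ⌊Λ * (R + c)⌋₊ := by gcongr; linarith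
    _ = Real.exp (Real.log (k + 1) * ⌊Λ * (R + c)⌋₊) := by
        rw [mul_comm (Real.log _) _, Real.exp_nat_mul, Real.exp_log hk2]
    _ ≤ Real.exp (Real.log (k+1) * (Λ * (R + c))) := by
        gcongr
        exact Nat.floor_le (by positivity)
    _ ≤ _ := by
        rw [← Real.exp_add]
        apply Real.exp_le_exp.2
        nlinarith

/-- uniform exponential covers -/
def CoverBdd {A : Type*} (q : A → A → ℝ) : Prop :=
  ∃ k : ℕ, 1 ≤ k ∧ ∀ n : ℕ, ∃ F : Finset (Set A), F.card ≤ k ^ (n + 1) ∧ (∀ x, ∃ s ∈ F, x ∈ s) ∧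
    ∀ s ∈ F, ∀ x ∈ s, ∀ y ∈ s, q x y ≤ Real.exp (-n)

lemma CoverBdd.prod {A B : Type*} {q : A → A → ℝ} {q' : B → B → ℝ}
    (h : CoverBdd q) (h' : CoverBdd q') :
    CoverBdd (fun x y : A × B => max (q x.1 y.1) (q' x.2 y.2)) := by
  obtain ⟨k, hk, h⟩ := h
  obtain ⟨k', hk', h'⟩ := h'
  refine ⟨k * k', Nat.mul_pos hk hk', fun n => ?_⟩
  obtain ⟨F, hF, hc, hd⟩ := h n
  obtain ⟨F', hF', hc', hd'⟩ := h' n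
  refine ⟨(F ×ˢ F').image (fun s => s.1 ×ˢ s.2), ?_, ?_, ?_⟩
  · refine Finset.card_image_le.trans ?_
    rw [Finset.card_product, mul_pow]
    exact Nat.mul_le_mul hF hF'
  · rintro ⟨x, y⟩
    obtain ⟨s, hs, hxs⟩ := hc x
    obtain ⟨s', hs', hys⟩ := hc' y
    exact ⟨s ×ˢ s', Finset.mem_image.2 ⟨(s, s'), Finset.mem_product.2 ⟨hs, hs'⟩, rfl⟩, hxs, hys⟩
  · intro s hs x hx y hy
    obtain ⟨⟨s1, s2⟩, hs', rfl⟩ := Finset.mem_image.1 hs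
    rw [Finset.mem_product] at hs'
    exact max_le (hd _ hs'.1 _ hx.1 _ hy.1) (hd' _ hs'.2 _ hx.2 _ hy.2)

lemma word_track {G : Type*} [Group G] [MetricSpace G] (h : IsHypGroupMetric G) :
    ∃ (Λ b : ℝ) (k : ℕ), 1 ≤ Λ ∧ 0 ≤ b ∧ 1 ≤ k ∧ ∀ t : ℕ, ∃ F : Finset G, F.card ≤ k ^ t ∧
      ∀ g : G, Λ * t + b ≤ dist 1 g → ∃ p ∈ F, t / Λ - b ≤ gp 1 p g := by
  obtain ⟨hinv, ⟨δ, hδ0, hδ⟩, S, hS, Λ, c, hΛ, hc, hd⟩ := h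
  obtain ⟨k, hk, hF⟩ := word_count S hS
  have hΛ0 : 0 < Λ := by linarith
  set K : ℕ := ⌈δ * Λ⌉₊ + 1
  have hK : δ ≤ 1 / Λ * K := by
    rw [div_mul_eq_mul_div, le_div_iff₀ hΛ0, one_mul]
    refine (Nat.le_ceil _).trans ?_
    simp [K]
  refine ⟨Λ, 2 * c + Λ * K + δ, k, hΛ, by positivity, hk, fun t => ?_⟩
  obtain ⟨F, hFc, hFm⟩ := hF t
  refine ⟨F, hFc, fun g hg => ?_⟩
  obtain ⟨u, hu0, hug, hul, hui⟩ := word_prefix hS g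
  have ht : t ≤ wordLength (S : Set G) g := by
    have := (hd g).2
    have h2 : Λ * t ≤ Λ * wordLength (S : Set G) g := by
      have : 0 ≤ Λ * K := by positivity
      linarith
    exact_mod_cast le_of_mul_le_mul_left h2 hΛ0
  refine ⟨u t, hFm _ (hul t ht).le, ?_⟩
  have := chain_lemma (o := (1:G)) (a := 1 / Λ) (b := 2 * c + Λ * K) hδ hδ0 (K := K) (N := 0)
    (L := wordLength (S : Set G) g) (by simp [K]) hK (u := u) ?_ t (Nat.zero_le _)
    (wordLength (S : Set G) g - t) (by omega)
  · rw [Nat.add_sub_cancel' ht, hug] at this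
    have e : (t:ℝ) / Λ = 1 / Λ * t := by ring
    rw [e]; linarith
  · intro n _ i hi hn
    have h1 := gp_ge 1 (u n) (u (n + i))
    have h2 := (hd (u n)).1
    rw [hul n (by omega)] at h2
    have h3 : dist (u n) (u (n + i)) = dist 1 ((u n)⁻¹ * u (n + i)) := by
      rw [← hinv (u n) 1]; simp
    have h4 := (hd ((u n)⁻¹ * u (n + i))).2
    have h5 : (wordLength (S : Set G) ((u n)⁻¹ * u (n + i)) : ℝ) ≤ K := by
      exact_mod_cast (hui n i).trans hi
    have h6 := mul_le_mul_of_nonneg_left h5 hΛ0.le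
    have e : (n:ℝ) / Λ = 1 / Λ * n := by ring
    rw [e] at h2
    linarith

lemma coverBdd_qB {G : Type*} [Group G] [MetricSpace G] (h : IsHypGroupMetric G) :
    CoverBdd (qB (1 : G)) := by
  obtain ⟨Λ, b, k, hΛ, hb, hk, hF⟩ := word_track h
  obtain ⟨-, ⟨δ, hδ0, hδ⟩, -⟩ := h
  have hΛ0 : 0 < Λ := by linarith
  obtain ⟨m, hm⟩ := exists_nat_ge (Λ * (1 + b + 4 * δ))
  refine ⟨k ^ m, Nat.one_le_pow _ _ hk, fun n => ?_⟩
  set t := m * (n + 1)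
  obtain ⟨F, hFc, hFm⟩ := hF t
  have ht : n + b + 4 * δ ≤ t / Λ := by
    rw [le_div_iff₀ hΛ0]
    have : (t:ℝ) = m * (n + 1) := by simp [t]
    rw [this]
    have h1 : Λ * (1 + b + 4 * δ) * (n + 1) ≤ m * (n + 1) := by gcongr
    have h2 : 0 ≤ Λ * (b + 4 * δ) * n := by positivity
    nlinarith
  refine ⟨F.image (fun p => {ξ | ∃ u : DivSeq G 1, mkB 1 u = ξ ∧ ∃ N, ∀ j, N ≤ j →
    t / Λ - b - δ ≤ gp 1 p (u.1 j)}), ?_, ?_, ?_⟩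
  · refine Finset.card_image_le.trans (hFc.trans ?_)
    rw [pow_mul]
  · intro ξ
    obtain ⟨u, rfl⟩ := Quot.exists_rep ξ
    obtain ⟨N, hN⟩ := (tendsto_iff_ev _ _ _).1 u.2 (max (Λ * t + b) (t / Λ - b))
    have h1 := hN N le_rfl N le_rfl
    rw [gp_self] at h1
    obtain ⟨p, hp, hpg⟩ := hFm (u.1 N) ((le_max_left _ _).trans h1)
    refine ⟨_, Finset.mem_image.2 ⟨p, hp, rfl⟩, u, rfl, N, fun j hj => ?_⟩
    have h2 := (le_max_right _ _).trans (hN N le_rfl j hj)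
    have := hδ p (u.1 j) (u.1 N) 1
    have := le_min hpg h2
    linarith
  · intro s hs x hx y hy
    obtain ⟨p, hp, rfl⟩ := Finset.mem_image.1 hs
    obtain ⟨u, rfl, N, hN⟩ := hx
    obtain ⟨v, rfl, M, hM⟩ := hy
    have : Ev 1 (t / Λ - b - 2 * δ) u.1 v.1 := by
      refine ⟨max N M, fun i hi j hj => ?_⟩
      have h1 := hN i ((le_max_left _ _).trans hi)
      have h2 := hM j ((le_max_right _ _).trans hj)
      rw [gp_comm] at h1
      have := hδ (u.1 i) (v.1 j) p 1
      have := le_min h1 h2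
      linarith
    refine (qB_le_of_ev hδ hδ0 u v this).trans (Real.exp_le_exp.2 (by linarith))

/-! ### Part 3: path space -/

/-- shift by `n` -/
def Un {G : Type*} (n : ℕ) (ω : ℕ → G) : ℕ → G := fun i => ω (n + i)

/-- first `n` increments -/
def pre {G : Type*} (n : ℕ) (ω : ℕ → G) : Fin n → G := fun i => ω i

lemma Un_Un {G : Type*} (n m : ℕ) (ω : ℕ → G) : Un m (Un n ω) = Un (n + m) ω := by
  funext i; simp [Un, add_assoc]

lemma Un_zero {G : Type*} (ω : ℕ → G) : Un 0 ω = ω := by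
  funext i; simp [Un]

section Walk
variable {G : Type*} [Group G]

lemma walk_zero (ω : ℕ → G) : walk ω 0 = 1 := by simp [walk]

lemma walk_succ (ω : ℕ → G) (n : ℕ) : walk ω (n + 1) = walk ω n * ω n := by
  simp [walk, List.range_succ]

lemma walk_add (ω : ℕ → G) (n m : ℕ) : walk ω (n + m) = walk ω n * walk (Un n ω) m := by
  induction m with
  | zero => simp [walk_zero]
  | succ m ih => rw [← add_assoc, walk_succ, ih, walk_succ, mul_assoc]; rfl

lemma walk_one (ω : ℕ → G) : walk ω 1 = ω 0 := by
  rw [walk_succ, walk_zero, one_mul]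

lemma walk_pre {n : ℕ} {ω ω' : ℕ → G} (h : pre n ω = pre n ω') : walk ω n = walk ω' n := by
  unfold walk
  congr 1
  apply List.map_congr_left
  intro i hi
  exact congrFun h ⟨i, List.mem_range.1 hi⟩

end Walk

section Path
variable {G : Type*} [Group G] [MeasurableSpace G] [DiscreteMeasurableSpace G] [Countable G]

lemma measurable_Un (n : ℕ) : Measurable (Un n : (ℕ → G) → ℕ → G) :=
  measurable_pi_lambda _ fun i => measurable_pi_apply _

lemma measurable_pre (n : ℕ) : Measurable (pre n : (ℕ → G) → Fin n → G) :=
  measurable_pi_lambda _ fun i => measurable_pi_apply _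

lemma measurable_walk (n : ℕ) : Measurable (fun ω : ℕ → G => walk ω n) := by
  induction n with
  | zero => simp only [walk_zero]; exact measurable_const
  | succ n ih =>
    simp only [walk_succ]
    exact (measurable_from_top (f := fun x : G × G => x.1 * x.2) |>.comp
      ((ih.prodMk (measurable_pi_apply n)).mono le_rfl (by
        intro s _; exact DiscreteMeasurableSpace.forall_measurableSet s)))

/-- cylinders -/
def cylS (G : Type*) : Set (Set (ℕ → G)) :=
  {s | ∃ (n : ℕ) (g : ℕ → G), s = {ω | ∀ i < n, ω i = g i}} ∪ {∅}

lemma isPi_cylS : IsPiSystem (cylS G) := by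
  have key : ∀ (n m : ℕ) (g h : ℕ → G), n ≤ m →
      {ω : ℕ → G | ∀ i < n, ω i = g i} ∩ {ω | ∀ i < m, ω i = h i} ∈ cylS G := by
    intro n m g h hnm
    by_cases hc : ∀ i < n, g i = h i
    · left
      refine ⟨m, h, ?_⟩
      ext ω
      constructor
      · rintro ⟨-, h2⟩; exact h2
      · intro h2
        exact ⟨fun i hi => (h2 i (hi.trans_le hnm)).trans (hc i hi).symm, h2⟩
    · right
      push Not at hc
      obtain ⟨i, hi, hne⟩ := hc
      rw [Set.mem_singleton_iff, Set.eq_empty_iff_forall_notMem]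
      rintro ω ⟨h1, h2⟩
      exact hne ((h1 i hi).symm.trans (h2 i (hi.trans_le hnm)))
  rintro s (⟨n, g, rfl⟩ | hs) t (⟨m, h, rfl⟩ | ht) -
  · rcases le_total n m with hnm | hnm
    · exact key n m g h hnm
    · rw [Set.inter_comm]; exact key m n h g hnm
  · rw [Set.mem_singleton_iff] at ht; right; simp [ht]
  · rw [Set.mem_singleton_iff] at hs; right; simp [hs]
  · rw [Set.mem_singleton_iff] at ht; right; simp [ht]

lemma measurableSet_cyl (n : ℕ) (g : ℕ → G) : MeasurableSet {ω : ℕ → G | ∀ i < n, ω i = g i} := by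
  have : {ω : ℕ → G | ∀ i < n, ω i = g i} = ⋂ i, ⋂ (_ : i < n), (fun ω : ℕ → G => ω i) ⁻¹' {g i} := by
    ext ω; simp
  rw [this]
  exact MeasurableSet.iInter fun i => MeasurableSet.iInter fun _ =>
    measurable_pi_apply i (MeasurableSet.singleton _)

lemma gen_cylS : (MeasurableSpace.pi : MeasurableSpace (ℕ → G)) =
    MeasurableSpace.generateFrom (cylS G) := by
  refine le_antisymm ?_ (MeasurableSpace.generateFrom_le ?_)
  · refine iSup_le fun i => ?_
    rintro s ⟨t, -, rfl⟩
    have : (fun ω : ℕ → G => ω i) ⁻¹' t = ⋃ (γ : Fin (i+1) → G) (_ : γ (Fin.last i) ∈ t),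
        {ω : ℕ → G | ∀ j < i + 1, ω j = (fun j => if h : j < i + 1 then γ ⟨j, h⟩ else 1) j} := by
      ext ω
      simp only [Set.mem_preimage, Set.mem_iUnion, exists_prop, Set.mem_ofPred_eq]
      constructor
      · intro h
        refine ⟨fun j => ω j, by simpa using h, fun j hj => ?_⟩
        simp [hj]
      · rintro ⟨γ, h1, h2⟩
        have := h2 i (by omega)
        simp at this
        rw [this]; exact h1
    rw [this]
    refine MeasurableSet.iUnion fun γ => MeasurableSet.iUnion fun _ => ?_
    exact MeasurableSpace.measurableSet_generateFrom (Or.inl ⟨_, _, rfl⟩)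
  · rintro s (⟨n, g, rfl⟩ | hs)
    · exact measurableSet_cyl n g
    · rw [Set.mem_singleton_iff] at hs; rw [hs]; exact MeasurableSet.empty

variable {p : G → ℝ≥0∞} {P : Measure (ℕ → G)}

lemma prefix_formula (hP : IsRWMeasure p P) (n : ℕ) (g : ℕ → G) {A : Set (ℕ → G)}
    (hA : MeasurableSet A) :
    P ({ω | ∀ i < n, ω i = g i} ∩ Un n ⁻¹' A) = P {ω | ∀ i < n, ω i = g i} * P A := by
  have := hP.1
  have h1 : ∀ s ∈ cylS G, ((P.restrict {ω | ∀ i < n, ω i = g i}).map (Un n)) s =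
      ((P {ω | ∀ i < n, ω i = g i}) • P) s := by
    rintro s (⟨m, h, rfl⟩ | hs)
    · rw [Measure.map_apply (measurable_Un n) (measurableSet_cyl m h),
        Measure.restrict_apply ((measurable_Un n) (measurableSet_cyl m h)),
        Measure.smul_apply, smul_eq_mul]
      let k : ℕ → G := fun i => if i < n then g i else h (i - n)
      have e : Un n ⁻¹' {ω | ∀ i < m, ω i = h i} ∩ {ω | ∀ i < n, ω i = g i} =
          {ω | ∀ i < n + m, ω i = k i} := by
        ext ω
        simp only [Set.mem_inter_iff, Set.mem_preimage, Set.mem_ofPred_eq, Un, k]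
        constructor
        · rintro ⟨a, b⟩ i hi
          by_cases hin : i < n
          · simp [hin, b i hin]
          · have := a (i - n) (by omega)
            rw [Nat.add_sub_cancel' (by omega)] at this
            simp [hin, this]
        · intro a
          refine ⟨fun i hi => ?_, fun i hi => ?_⟩
          · have := a (n + i) (by omega)
            simpa using this
          · have := a i (by omega)
            simpa [hi] using this
      rw [e, hP.2, hP.2, hP.2, Finset.prod_range_add]
      congr 1
      · exact Finset.prod_congr rfl fun i hi => by simp [k, Finset.mem_range.1 hi]
      · exact Finset.prod_congr rfl fun i hi => by simp [k]
    · rw [Set.mem_singleton_iff] at hs; simp [hs]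
  have h2 : (P.restrict {ω | ∀ i < n, ω i = g i}).map (Un n) = (P {ω | ∀ i < n, ω i = g i}) • P := by
    have : IsFiniteMeasure ((P.restrict {ω | ∀ i < n, ω i = g i}).map (Un n)) := inferInstance
    refine ext_of_generate_finite (cylS G) gen_cylS isPi_cylS h1 ?_
    have := h1 univ (Or.inl ⟨0, g, by simp⟩)
    exact this
  have h3 := congrArg (fun μ => μ A) h2
  simp only [Measure.smul_apply, smul_eq_mul] at h3
  rw [Measure.map_apply (measurable_Un n) hA, Measure.restrict_apply (measurable_Un n hA)] at h3
  rw [Set.inter_comm, h3]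

lemma pre_fiber (n : ℕ) (γ : Fin n → G) :
    pre n ⁻¹' {γ} = {ω : ℕ → G | ∀ i < n, ω i = (fun j => if h : j < n then γ ⟨j, h⟩ else 1) i} := by
  ext ω
  simp only [Set.mem_preimage, Set.mem_singleton_iff, Set.mem_ofPred_eq]
  constructor
  · rintro rfl i hi; simp [hi, pre]
  · intro h; funext i; have := h i i.2; simpa [pre] using this

lemma prefix_mul (hP : IsRWMeasure p P) (n : ℕ) (T : Set (Fin n → G)) {A : Set (ℕ → G)}
    (hA : MeasurableSet A) :
    P (pre n ⁻¹' T ∩ Un n ⁻¹' A) = P (pre n ⁻¹' T) * P A := by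
  have hm : ∀ s : Set (Fin n → G), MeasurableSet s := fun s =>
    DiscreteMeasurableSpace.forall_measurableSet s
  have e : ∀ B : Set (ℕ → G), MeasurableSet B →
      P (pre n ⁻¹' T ∩ B) = ∑' γ : T, P (pre n ⁻¹' {(γ : Fin n → G)} ∩ B) := by
    intro B hB
    rw [← measure_iUnion]
    · congr 1
      ext ω
      simp
    · intro γ γ' hne
      refine Set.disjoint_left.2 ?_
      rintro ω ⟨h1, -⟩ ⟨h2, -⟩
      exact hne (Subtype.ext (h1.symm.trans h2))
    · intro γ
      exact (measurable_pre n (hm _)).inter hB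
  rw [e _ (measurable_Un n hA)]
  have e2 := e univ MeasurableSet.univ
  simp only [Set.inter_univ] at e2
  rw [e2, ← ENNReal.tsum_mul_right]
  congr 1
  funext γ
  rw [pre_fiber, prefix_formula hP _ _ hA]

lemma map_Un (hP : IsRWMeasure p P) (n : ℕ) : MeasurePreserving (Un n) P P := by
  have := hP.1
  refine ⟨measurable_Un n, ?_⟩
  ext A hA
  rw [Measure.map_apply (measurable_Un n) hA]
  have := prefix_mul hP n univ hA
  simpa using this

lemma indep_pre_Un (hP : IsRWMeasure p P) (n : ℕ) :
    ProbabilityTheory.IndepFun (pre n) (Un n : (ℕ → G) → ℕ → G) P := by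
  have := hP.1
  rw [ProbabilityTheory.indepFun_iff_measure_inter_preimage_eq_mul]
  intro s t hs ht
  rw [prefix_mul hP n s ht, ← (map_Un hP n).measure_preimage ht.nullMeasurableSet]

/-- zero-one law -/
lemma zero_one (hP : IsRWMeasure p P) {A : Set (ℕ → G)} (hA : MeasurableSet A)
    (h : A ≤ᵐ[P] (Un 1 ⁻¹' A : Set (ℕ → G))) : P A = 0 ∨ P A = 1 := by
  have := hP.1
  have h1 : A =ᵐ[P] (Un 1 ⁻¹' A : Set (ℕ → G)) := by
    refine ae_eq_of_ae_subset_of_measure_ge h ?_ hA.nullMeasurableSet (measure_ne_top _ _)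
    rw [(map_Un hP 1).measure_preimage hA.nullMeasurableSet]
  have hn : ∀ n, A =ᵐ[P] (Un n ⁻¹' A : Set (ℕ → G)) := by
    intro n
    induction n with
    | zero =>
      have : (Un 0 ⁻¹' A : Set (ℕ → G)) = A := by ext ω; simp [Un_zero]
      rw [this]; exact ae_eq_refl _
    | succ n ih =>
      have h2 := (map_Un hP 1).quasiMeasurePreserving.preimage_ae_eq ih
      have h3 : (Un 1 ⁻¹' (Un n ⁻¹' A) : Set (ℕ → G)) = Un (n + 1) ⁻¹' A := by
        ext ω; simp [Un_Un, add_comm]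
      rw [h3] at h2
      exact h1.trans h2
  have h1 : ∀ s ∈ cylS G, (P.restrict A) s = (P A • P) s := by
    rintro s (⟨m, g, rfl⟩ | hs)
    · rw [Measure.restrict_apply (measurableSet_cyl m g), Measure.smul_apply, smul_eq_mul]
      have := prefix_formula hP m g hA
      rw [mul_comm, ← this]
      apply measure_congr
      have h3 := hn m
      exact (ae_eq_refl _).inter h3
    · rw [Set.mem_singleton_iff] at hs; simp [hs]
  have h2 : P.restrict A = P A • P :=
    ext_of_generate_finite (cylS G) gen_cylS isPi_cylS h1 (by simp)
  have h3 := congrArg (fun μ => μ A) h2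
  simp only [Measure.smul_apply, smul_eq_mul, Measure.restrict_apply hA, Set.inter_self] at h3
  by_cases h0 : P A = 0
  · exact Or.inl h0
  · right
    have h4 : P A * 1 = P A * P A := by rw [mul_one]; exact h3
    exact ((ENNReal.mul_right_inj h0 (measure_ne_top _ _)).1 h4).symm

/-- distribution of the walk -/
lemma P_walk {H : Type*} [Group H] (hP : IsRWMeasure p P) (φ : G →* H) {q : H → ℝ≥0∞}
    (hq : ∀ b, P {ω | φ (ω 0) = b} = q b) (n : ℕ) (a : H) :
    P {ω | φ (walk ω n) = a} = piN q n a := by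
  have := hP.1
  induction n generalizing a with
  | zero =>
    simp only [walk_zero, map_one, piN]
    split_ifs with h
    · simp [h]
    · have : {ω : ℕ → G | (1:H) = a} = ∅ := by
        ext ω; simp [Ne.symm h]
      rw [this]; simp
  | succ n ih =>
    simp only [piN, conv]
    have e : {ω | φ (walk ω (n+1)) = a} =
        ⋃ y : H, (pre n ⁻¹' {γ | ∃ ω, pre n ω = γ ∧ φ (walk ω n) = y}) ∩
          Un n ⁻¹' {ω | φ (ω 0) = y⁻¹ * a} := by
      ext ω
      simp only [Set.mem_iUnion, Set.mem_inter_iff, Set.mem_preimage, Set.mem_ofPred_eq,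
        walk_succ, map_mul]
      constructor
      · intro h
        refine ⟨φ (walk ω n), ⟨ω, rfl, rfl⟩, ?_⟩
        simp [Un, ← h]
      · rintro ⟨y, ⟨ω', h1, rfl⟩, h2⟩
        rw [walk_pre h1] at h2
        simp only [Un, add_zero] at h2
        rw [h2]; simp
    have hs : ∀ b, MeasurableSet {ω : ℕ → G | φ (ω 0) = b} := fun b =>
      (measurable_pi_apply (0:ℕ) : Measurable (fun ω : ℕ → G => ω 0))
        (DiscreteMeasurableSpace.forall_measurableSet {x : G | φ x = b})
    have hpre : ∀ y, pre n ⁻¹' {γ | ∃ ω : ℕ → G, pre n ω = γ ∧ φ (walk ω n) = y} =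
        {ω : ℕ → G | φ (walk ω n) = y} := by
      intro y
      ext ω
      constructor
      · rintro ⟨ω', h1, h2⟩
        show φ (walk ω n) = y
        rw [← walk_pre h1]; exact h2
      · intro h; exact ⟨ω, rfl, h⟩
    have hsupp : {ω | φ (walk ω (n+1)) = a} =
        ⋃ x : Set.range (fun g : G => φ g), {ω | φ (walk ω n) = x.1} ∩
          Un n ⁻¹' {ω | φ (ω 0) = x.1⁻¹ * a} := by
      rw [e]
      ext ω
      simp only [hpre, Set.mem_iUnion]
      constructor
      · rintro ⟨y, hy⟩
        exact ⟨⟨y, walk ω n, hy.1⟩, hy⟩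
      · rintro ⟨y, hy⟩
        exact ⟨y.1, hy⟩
    have : Countable (Set.range (fun g : G => φ g)) := (Set.countable_range _).to_subtype
    rw [hsupp, measure_iUnion]
    · have : ∀ x : H, P ({ω | φ (walk ω n) = x} ∩ Un n ⁻¹' {ω | φ (ω 0) = x⁻¹ * a}) =
          piN q n x * q (x⁻¹ * a) := by
        intro x
        rw [← hpre, prefix_mul hP n _ (hs _), hpre, ih, hq]
      simp only [this]
      rw [tsum_subtype (Set.range (fun g : G => φ g)) (fun x => piN q n x * q (x⁻¹ * a))]
      congr 1
      funext x
      by_cases hx : x ∈ Set.range (fun g : G => φ g)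
      · rw [Set.indicator_of_mem hx]
      · rw [Set.indicator_of_notMem hx, ← ih]
        have : {ω : ℕ → G | φ (walk ω n) = x} = ∅ := by
          ext ω
          simp only [Set.mem_ofPred_eq, Set.mem_empty_iff_false, iff_false]
          exact fun h => hx ⟨_, h⟩
        rw [this]; simp
    · intro x y hne
      refine Set.disjoint_left.2 ?_
      rintro ω ⟨h1, -⟩ ⟨h2, -⟩
      exact hne (Subtype.ext (h1.symm.trans h2))
    · intro x
      exact ((measurable_walk n) (DiscreteMeasurableSpace.forall_measurableSet
        {g : G | φ g = x.1})).inter (measurable_Un n (hs _))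

lemma P_first (hP : IsRWMeasure p P) (g : G) : P {ω | ω 0 = g} = p g := by
  have := hP.2 1 (fun _ => g)
  simpa using this

end Path

/-! ### Part 4: Kingman's theorem for the increments process -/

lemma avg_window {S : ℕ → ℝ} {b : ℝ} (h : Tendsto (fun n : ℕ => S n / n) atTop (𝓝 b)) (h0 : S 0 = 0)
    {ε : ℝ} (hε : 0 < ε) : ∀ᶠ n : ℕ in atTop, ∀ m ≤ n, |S m - b * m| ≤ ε * n := by
  have h1 : ∀ᶠ n : ℕ in atTop, |S n - b * n| ≤ ε * n := by
    filter_upwards [Metric.tendsto_nhds.1 h ε hε, eventually_gt_atTop 0] with n hn hn0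
    have hn0' : (0:ℝ) < n := by exact_mod_cast hn0
    rw [Real.dist_eq] at hn
    have e : S n - b * n = (S n / n - b) * n := by field_simp
    rw [e, abs_mul, abs_of_pos hn0']
    gcongr
  obtain ⟨N, hN⟩ := eventually_atTop.1 h1
  obtain ⟨M, hM⟩ : ∃ M : ℝ, ∀ m < N, |S m - b * m| ≤ M := by
    refine ⟨∑ m ∈ Finset.range N, |S m - b * m|, fun m hm => ?_⟩
    exact Finset.single_le_sum (f := fun m => |S m - b * m|) (fun i _ => abs_nonneg _)
      (Finset.mem_range.2 hm)
  have h2 : ∀ᶠ n : ℕ in atTop, M ≤ ε * n := by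
    have : Tendsto (fun n : ℕ => ε * (n:ℝ)) atTop atTop :=
      Tendsto.const_mul_atTop hε tendsto_natCast_atTop_atTop
    exact this.eventually_ge_atTop M
  filter_upwards [h2] with n hn m hm
  by_cases hmN : m < N
  · exact (hM m hmN).trans hn
  · refine (hN m (by omega)).trans ?_
    gcongr

section Kingman
variable {G : Type*} [Group G] [MeasurableSpace G] [DiscreteMeasurableSpace G] [Countable G]

/-- subadditive cocycle over the increments process -/
structure Coc0 (P : Measure (ℕ → G)) (f : ℕ → (ℕ → G) → ℝ) : Prop where
  nonneg : ∀ n ω, 0 ≤ f n ω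
  zero : ∀ ω, f 0 ω = 0
  sub : ∀ᵐ ω ∂P, ∀ n m, f (n + m) ω ≤ f n ω + f m (Un n ω)
  pre : ∀ n, ∃ F : (Fin n → G) → ℝ, f n = F ∘ pre n
  int : Integrable (f 1) P

/-- subadditive cocycle with its rate -/
structure Coc (P : Measure (ℕ → G)) (f : ℕ → (ℕ → G) → ℝ) (a : ℝ) : Prop extends Coc0 P f where
  lim : Tendsto (fun n : ℕ => (∫ ω, f n ω ∂P) / n) atTop (𝓝 a)

variable {p : G → ℝ≥0∞} {P : Measure (ℕ → G)} {f : ℕ → (ℕ → G) → ℝ} {a : ℝ}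

lemma Coc0.meas (hf : Coc0 P f) (n : ℕ) : Measurable (f n) := by
  obtain ⟨F, hF⟩ := hf.pre n
  rw [hF]
  have hFm : Measurable F := fun s _ => DiscreteMeasurableSpace.forall_measurableSet _
  exact hFm.comp (measurable_pre n)

lemma Coc.a_nonneg (hf : Coc P f a) : 0 ≤ a :=
  ge_of_tendsto' hf.lim fun n => div_nonneg (integral_nonneg (hf.nonneg n)) (Nat.cast_nonneg n)

lemma Coc0.sub' (hP : IsRWMeasure p P) (hf : Coc0 P f) :
    ∀ᵐ ω ∂P, ∀ k n m, f (n + m) (Un k ω) ≤ f n (Un k ω) + f m (Un (k + n) ω) := by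
  rw [ae_all_iff]
  intro k
  have := (map_Un hP k).quasiMeasurePreserving.ae hf.sub
  filter_upwards [this] with ω hω n m
  have := hω n m
  rwa [Un_Un] at this

lemma Coc0.le_sum (hP : IsRWMeasure p P) (hf : Coc0 P f) :
    ∀ᵐ ω ∂P, ∀ k n, f n (Un k ω) ≤ ∑ i ∈ Finset.range n, f 1 (Un (k + i) ω) := by
  filter_upwards [hf.sub' hP] with ω hω k n
  induction n with
  | zero => simp [hf.zero]
  | succ n ih =>
    rw [Finset.sum_range_succ]
    exact (hω k n 1).trans (by gcongr)

lemma int_comp_Un (hP : IsRWMeasure p P) {g : (ℕ → G) → ℝ} (hg : Integrable g P) (k : ℕ) :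
    Integrable (fun ω => g (Un k ω)) P :=
  ((map_Un hP k).integrable_comp hg.aestronglyMeasurable).2 hg

lemma integral_comp_Un (hP : IsRWMeasure p P) {g : (ℕ → G) → ℝ} (hg : Measurable g) (k : ℕ) :
    ∫ ω, g (Un k ω) ∂P = ∫ ω, g ω ∂P := by
  have h := (map_Un hP k).map_eq
  conv_rhs => rw [← h]
  rw [integral_map (measurable_Un k).aemeasurable hg.aestronglyMeasurable]

lemma Coc0.integrable (hP : IsRWMeasure p P) (hf : Coc0 P f) (n : ℕ) : Integrable (f n) P := by
  have h1 : Integrable (fun ω => ∑ i ∈ Finset.range n, f 1 (Un i ω)) P :=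
    integrable_finsetSum _ fun i _ => int_comp_Un hP hf.int i
  refine h1.mono' (hf.meas n).aestronglyMeasurable ?_
  filter_upwards [hf.le_sum hP] with ω hω
  rw [Real.norm_of_nonneg (hf.nonneg n ω)]
  have := hω 0 n
  simpa [Un_zero] using this

lemma Coc.slln (hP : IsRWMeasure p P) (hf : Coc P f a) {k : ℕ} (hk : 1 ≤ k) :
    ∀ᵐ ω ∂P, Tendsto (fun n : ℕ => (∑ j ∈ Finset.range n, f k (Un (k * j) ω)) / n) atTop
      (𝓝 (∫ ω, f k ω ∂P)) := by
  have := hP.1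
  have h := ProbabilityTheory.strong_law_ae_real (μ := P) (fun j ω => f k (Un (k * j) ω)) ?_ ?_ ?_
  · filter_upwards [h] with ω hω
    have e : ∀ ω : ℕ → G, f k (Un (k * 0) ω) = f k ω := fun ω => by simp [Un_zero]
    simpa only [e] using hω
  · exact int_comp_Un hP (hf.integrable hP k) _
  · have key : ∀ i j, i < j → ProbabilityTheory.IndepFun (fun ω => f k (Un (k * i) ω))
        (fun ω => f k (Un (k * j) ω)) P := by
      intro i j hij
      obtain ⟨F, hF⟩ := hf.pre k
      have hle : k * i + k ≤ k * j := by
        have : k * (i + 1) ≤ k * j := Nat.mul_le_mul_left k hij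
        linarith
      let φ : (Fin (k * j) → G) → ℝ := fun γ => F (fun t => γ ⟨k * i + t, by omega⟩)
      have hφ : Measurable φ := fun s _ => DiscreteMeasurableSpace.forall_measurableSet _
      have h1 := (indep_pre_Un hP (k * j)).comp (φ := φ) (ψ := f k) hφ (hf.meas k)
      have e1 : φ ∘ HMDim.pre (k * j) = fun ω => f k (Un (k * i) ω) := by
        funext ω; rw [hF]; rfl
      rw [e1] at h1
      exact h1
    intro i j hij
    rcases lt_or_gt_of_ne hij with h | h
    · exact key i j h
    · exact (key j i h).symm
  · intro i
    refine ⟨((hf.meas k).comp (measurable_Un _)).aemeasurable, ((hf.meas k).comp (measurable_Un _)).aemeasurable, ?_⟩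
    have e : ∀ i, Measure.map (fun ω => f k (Un (k * i) ω)) P = Measure.map (f k) P := by
      intro i
      conv_rhs => rw [← (map_Un hP (k * i)).map_eq, Measure.map_map (hf.meas k) (measurable_Un _)]
      rfl
    rw [e, e]

lemma Coc.block (hP : IsRWMeasure p P) (hf : Coc P f a) (k : ℕ) :
    ∀ᵐ ω ∂P, ∀ s n, f (k * n) (Un s ω) ≤ ∑ j ∈ Finset.range n, f k (Un (s + k * j) ω) := by
  filter_upwards [hf.sub' hP] with ω hω s n
  induction n with
  | zero => simp [hf.zero]
  | succ n ih =>
    rw [Finset.sum_range_succ, mul_add, mul_one]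
    exact (hω s (k * n) k).trans (by gcongr)

/-- window upper bound -/
lemma Coc.upper (hP : IsRWMeasure p P) (hf : Coc P f a) {ε : ℝ} (hε : 0 < ε) :
    ∀ᵐ ω ∂P, ∀ᶠ n : ℕ in atTop, ∀ m ≤ n, f (n - m) (Un m ω) ≤ a * (n - m : ℕ) + ε * n := by
  have ha := hf.a_nonneg
  set ε' := ε / 10 with hε'
  have hε0 : 0 < ε' := by positivity
  obtain ⟨k, hk1, hk⟩ : ∃ k : ℕ, 1 ≤ k ∧ ∫ ω, f k ω ∂P ≤ (a + ε') * k := by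
    have := (hf.lim.eventually_lt_const (show a < a + ε' by linarith)).and (eventually_ge_atTop 1)
    obtain ⟨k, h1, h2⟩ := this.exists
    have hk0 : (0:ℝ) < k := by exact_mod_cast h2
    exact ⟨k, h2, by rw [div_lt_iff₀ hk0] at h1; exact h1.le⟩
  have hkR : (1:ℝ) ≤ k := by exact_mod_cast hk1
  filter_upwards [hf.slln hP le_rfl, hf.slln hP hk1, hf.le_sum hP, hf.block hP k, hf.sub' hP]
    with ω h1 h2 hs hb hsub
  simp only [one_mul] at h1
  set b := ∫ ω, f 1 ω ∂P with hbdef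
  set bk := ∫ ω, f k ω ∂P with hbkdef
  have hb0 : 0 ≤ b := integral_nonneg (hf.nonneg 1)
  have hbk0 : 0 ≤ bk := integral_nonneg (hf.nonneg k)
  set S : ℕ → ℝ := fun n => ∑ i ∈ Finset.range n, f 1 (Un i ω) with hS
  set T : ℕ → ℝ := fun n => ∑ i ∈ Finset.range n, f k (Un (k * i) ω) with hT
  have w1 := avg_window (S := S) h1 (by simp [hS]) hε0
  have w2 := avg_window (S := T) h2 (by simp [hT]) hε0
  have w3 : ∀ᶠ n : ℕ in atTop, 2 * b * k ≤ ε' * n :=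
    (Tendsto.const_mul_atTop hε0 tendsto_natCast_atTop_atTop).eventually_ge_atTop _
  have hSw : ∀ m n, m ≤ n → f (n - m) (Un m ω) ≤ S n - S m := by
    intro m n hmn
    refine (hs m (n - m)).trans ?_
    have := Finset.sum_range_add_sum_Ico (fun i => f 1 (Un i ω)) hmn
    rw [Finset.sum_Ico_eq_sum_range] at this
    simp only [hS]; linarith
  have hTw : ∀ i j, i ≤ j → f (k * j - k * i) (Un (k * i) ω) ≤ T j - T i := by
    intro i j hij
    rw [← Nat.mul_sub]
    refine (hb (k * i) (j - i)).trans ?_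
    have := Finset.sum_range_add_sum_Ico (fun i => f k (Un (k * i) ω)) hij
    rw [Finset.sum_Ico_eq_sum_range] at this
    simp only [mul_add] at this
    simp only [hT]; linarith
  filter_upwards [w1, w2, w3] with n w1 w2 w3 m hm
  have hcast : ((n - m : ℕ) : ℝ) = n - m := by rw [Nat.cast_sub hm]
  have hmn : (m:ℝ) ≤ n := by exact_mod_cast hm
  have hn0 : (0:ℝ) ≤ n := Nat.cast_nonneg n
  have hεn : 0 ≤ ε' * n := by positivity
  have hεe : ε * n = 10 * (ε' * n) := by rw [hε']; ring
  have d1 : k * (n / k) ≤ n := Nat.mul_div_le n k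
  have d2 : n < k * (n / k + 1) := Nat.lt_mul_div_succ n hk1
  have d3 : k * (m / k) ≤ m := Nat.mul_div_le m k
  have d4 : m < k * (m / k + 1) := Nat.lt_mul_div_succ m hk1
  have hpos : 0 ≤ a * (n - m : ℝ) := mul_nonneg ha (by linarith)
  rw [hcast]
  by_cases hc : m / k + 1 ≤ n / k
  · have d5 : k * (m / k + 1) ≤ k * (n / k) := Nat.mul_le_mul_left k hc
    set r := k * (m / k + 1) with hr
    set t := k * (n / k) with ht
    have s1 := hsub m (r - m) (n - r)
    have s2 := hsub r (t - r) (n - t)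
    rw [show r - m + (n - r) = n - m by omega, show m + (r - m) = r by omega] at s1
    rw [show t - r + (n - t) = n - r by omega, show r + (t - r) = t by omega] at s2
    have b1 := hSw m r (by omega)
    have b2 := hSw t n d1
    have b3 := hTw _ _ hc
    rw [← hr, ← ht] at b3
    have q1 := abs_le.1 (w1 m hm)
    have q2 := abs_le.1 (w1 r (by omega))
    have q3 := abs_le.1 (w1 t d1)
    have q4 := abs_le.1 (w1 n le_rfl)
    have q5 := abs_le.1 (w2 (m / k + 1) (hc.trans (Nat.div_le_self _ _)))
    have q6 := abs_le.1 (w2 (n / k) (Nat.div_le_self _ _))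
    have e1 : (r:ℝ) ≤ m + k := by
      have : r ≤ m + k := by rw [hr, mul_add, mul_one]; omega
      exact_mod_cast this
    have e2 : (n:ℝ) ≤ t + k := by
      have : n ≤ t + k := by rw [mul_add, mul_one] at d2; omega
      exact_mod_cast this
    have e3 : (r:ℝ) = k * ((m/k + 1 : ℕ) : ℝ) := by rw [hr]; push_cast; ring
    have e4 : (t:ℝ) = k * ((n/k : ℕ) : ℝ) := by rw [ht]; push_cast; ring
    have e5 : (m:ℝ) ≤ r := by exact_mod_cast d4.le
    have e6 : (t:ℝ) ≤ n := by exact_mod_cast d1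
    have e7 : (r:ℝ) ≤ t := by exact_mod_cast d5
    have c1 : b * r ≤ b * (m + k) := by gcongr
    have c2 : b * n ≤ b * (t + k) := by gcongr
    have hij : ((m/k + 1 : ℕ) : ℝ) ≤ ((n/k : ℕ):ℝ) := by exact_mod_cast hc
    have c3 : bk * (((n/k : ℕ):ℝ) - ((m/k + 1 : ℕ) : ℝ)) ≤ ((a + ε') * k) * (((n/k : ℕ):ℝ) - ((m/k + 1 : ℕ) : ℝ)) :=
      mul_le_mul_of_nonneg_right hk (by linarith)
    have c4 : ((a + ε') * k) * (((n/k : ℕ):ℝ) - ((m/k + 1 : ℕ) : ℝ)) = (a + ε') * (t - r) := by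
      rw [e3, e4]; ring
    have c5 : (a + ε') * ((t:ℝ) - r) ≤ (a + ε') * (n - m) := by gcongr
    have c6 : ε' * ((n:ℝ) - m) ≤ ε' * n := by
      gcongr; linarith [show (0:ℝ) ≤ m from Nat.cast_nonneg m]
    have c7 : b * (m + k) = b * m + b * k := by ring
    have c8 : b * (t + k) = b * t + b * k := by ring
    have c9 : bk * (((n/k : ℕ):ℝ) - ((m/k + 1 : ℕ) : ℝ)) = bk * ((n/k : ℕ):ℝ) - bk * ((m/k + 1 : ℕ) : ℝ) := by ring
    have c10 : (a + ε') * ((n:ℝ) - m) = a * (n - m) + ε' * (n - m) := by ring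
    have c11 : 2 * b * k = b * k + b * k := by ring
    linarith
  · have hle : n ≤ m + 2 * k := by
      have : k * (n / k + 1) ≤ k * (m / k + 2) := Nat.mul_le_mul_left k (by omega)
      have e : k * (m / k + 2) = k * (m / k) + 2 * k := by ring
      omega
    have b1 := hSw m n hm
    have q1 := abs_le.1 (w1 m hm)
    have q4 := abs_le.1 (w1 n le_rfl)
    have e1 : (n:ℝ) ≤ m + 2 * k := by exact_mod_cast hle
    have c1 : b * n ≤ b * (m + 2 * k) := by gcongr
    have c2 : b * (m + 2 * k) = b * m + 2 * b * k := by ring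
    linarith

/-- stopping-time estimate -/
lemma Coc.stopped (hP : IsRWMeasure p P) (hf : Coc P f a) {c : ℝ} (hc : 0 ≤ c) (N₀ : ℕ) (N : ℕ) :
    ∀ᵐ ω ∂P, f N ω ≤ c * N + ∑ i ∈ Finset.range N,
      (({ω | ∃ n, 1 ≤ n ∧ n ≤ N₀ ∧ f n ω < c * n}ᶜ).indicator (f 1) (Un i ω) +
        if N ≤ i + N₀ then f 1 (Un i ω) else 0) := by
  filter_upwards [hf.sub' hP] with ω hsub
  set B := {ω | ∃ n, 1 ≤ n ∧ n ≤ N₀ ∧ f n ω < c * n} with hB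
  set W : ℕ → ℝ := fun i => Bᶜ.indicator (f 1) (Un i ω) + if N ≤ i + N₀ then f 1 (Un i ω) else 0
    with hW
  have hI0 : ∀ i, 0 ≤ Bᶜ.indicator (f 1) (Un i ω) := fun i =>
    Set.indicator_nonneg (fun x _ => hf.nonneg 1 x) _
  have hW0 : ∀ i, 0 ≤ W i := by
    intro i
    simp only [hW]
    have : (0:ℝ) ≤ if N ≤ i + N₀ then f 1 (Un i ω) else 0 := by
      split_ifs; exacts [hf.nonneg _ _, le_rfl]
    linarith [hI0 i]
  have key : ∀ L k, L + k = N → f L (Un k ω) ≤ c * L + ∑ i ∈ Finset.Ico k N, W i := by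
    intro L
    induction L using Nat.strong_induction_on with
    | _ L ih =>
      intro k hk
      rcases Nat.eq_zero_or_pos L with h0 | hpos
      · subst h0
        rw [hf.zero]
        have : 0 ≤ ∑ i ∈ Finset.Ico k N, W i := Finset.sum_nonneg fun i _ => hW0 i
        simpa using this
      · have step1 : f 1 (Un k ω) ≤ W k → f L (Un k ω) ≤ c * L + ∑ i ∈ Finset.Ico k N, W i := by
          intro hle
          have h1 := hsub k 1 (L - 1)
          rw [show 1 + (L - 1) = L by omega] at h1
          have h2 := ih (L - 1) (by omega) (k + 1) (by omega)
          rw [Finset.sum_eq_sum_Ico_succ_bot (by omega : k < N)]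
          have h3 : c * ((L - 1 : ℕ):ℝ) ≤ c * L := by gcongr; omega
          linarith
        by_cases hmem : Un k ω ∈ B
        · obtain ⟨n, hn1, hn2, hn3⟩ := hmem
          by_cases hnL : n ≤ L
          · have h1 := hsub k n (L - n)
            rw [show n + (L - n) = L by omega] at h1
            have h2 := ih (L - n) (by omega) (k + n) (by omega)
            have h3 : ∑ i ∈ Finset.Ico (k + n) N, W i ≤ ∑ i ∈ Finset.Ico k N, W i :=
              Finset.sum_le_sum_of_subset_of_nonneg
                (Finset.Ico_subset_Ico_left (by omega)) (fun i _ _ => hW0 i)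
            have h4 : ((L - n : ℕ):ℝ) = L - n := by rw [Nat.cast_sub hnL]
            rw [h4] at h2
            linarith
          · apply step1
            simp only [hW]
            rw [if_pos (by omega)]
            linarith [hI0 k]
        · apply step1
          simp only [hW]
          rw [Set.indicator_of_mem (show Un k ω ∈ Bᶜ from hmem)]
          have : (0:ℝ) ≤ if N ≤ k + N₀ then f 1 (Un k ω) else 0 := by
            split_ifs; exacts [hf.nonneg _ _, le_rfl]
          linarith
  have := key N 0 (by omega)
  rw [Un_zero, ← Finset.range_eq_Ico] at this
  exact this

lemma Coc.lower_aux (hP : IsRWMeasure p P) (hf : Coc P f a) {c : ℝ}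
    (h : ∀ᵐ ω ∂P, ∃ n, 1 ≤ n ∧ f n ω < c * n) : a ≤ c := by
  have := hP.1
  have hc : 0 ≤ c := by
    obtain ⟨ω, n, hn, h1⟩ := h.exists
    have h2 := (hf.nonneg n ω).trans_lt h1
    have h3 : (0:ℝ) ≤ n := Nat.cast_nonneg n
    by_contra hneg
    push Not at hneg
    nlinarith
  set B : ℕ → Set (ℕ → G) := fun N₀ => {ω | ∃ n, 1 ≤ n ∧ n ≤ N₀ ∧ f n ω < c * n} with hB
  have hBm : ∀ N₀, MeasurableSet (B N₀) := by
    intro N₀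
    have : B N₀ = ⋃ n, ⋃ (_ : 1 ≤ n), ⋃ (_ : n ≤ N₀), {ω | f n ω < c * n} := by
      ext ω; simp only [hB, Set.mem_iUnion, exists_prop, Set.mem_ofPred_eq]
    rw [this]
    exact MeasurableSet.iUnion fun n => MeasurableSet.iUnion fun _ => MeasurableSet.iUnion fun _ =>
      measurableSet_lt (hf.meas n) measurable_const
  set e : ℕ → ℝ := fun N₀ => ∫ ω, (B N₀)ᶜ.indicator (f 1) ω ∂P with he
  have hgm : ∀ N₀, Measurable ((B N₀)ᶜ.indicator (f 1)) := fun N₀ =>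
    (hf.meas 1).indicator (hBm N₀).compl
  have hgi : ∀ N₀, Integrable ((B N₀)ᶜ.indicator (f 1)) P := fun N₀ =>
    hf.int.indicator (hBm N₀).compl
  set b := ∫ ω, f 1 ω ∂P with hb
  have h1 : ∀ N₀ N : ℕ, ∫ ω, f N ω ∂P ≤ c * N + N * e N₀ + N₀ * b := by
    intro N₀ N
    have hIntg : ∀ i, Integrable (fun ω => (B N₀)ᶜ.indicator (f 1) (Un i ω) +
        if N ≤ i + N₀ then f 1 (Un i ω) else 0) P := by
      intro i
      refine (int_comp_Un hP (hgi N₀) i).add ?_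
      split_ifs
      · exact int_comp_Un hP hf.int i
      · exact integrable_zero _ _ _
    have h2 := integral_mono_ae (hf.integrable hP N) ?_ (hf.stopped hP hc N₀ N)
    · refine h2.trans ?_
      rw [integral_add (integrable_const _) (integrable_finsetSum _ fun i _ => hIntg i),
        integral_finsetSum _ fun i _ => hIntg i]
      have h3 : ∀ i, ∫ ω, ((B N₀)ᶜ.indicator (f 1) (Un i ω) +
        if N ≤ i + N₀ then f 1 (Un i ω) else 0) ∂P = e N₀ + if N ≤ i + N₀ then b else 0 := by
        intro i
        rw [integral_add (int_comp_Un hP (hgi N₀) i), integral_comp_Un hP (hgm N₀)]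
        · congr 1
          split_ifs
          · exact integral_comp_Un hP (hf.meas 1) i
          · simp
        · split_ifs
          · exact int_comp_Un hP hf.int i
          · exact integrable_zero _ _ _
      have hb0 : 0 ≤ b := integral_nonneg (hf.nonneg 1)
      have h4 : ∑ i ∈ Finset.range N, (if N ≤ i + N₀ then b else 0) ≤ N₀ * b := by
        rw [← Finset.sum_filter, Finset.sum_const, nsmul_eq_mul]
        gcongr
        have : (Finset.range N).filter (fun i => N ≤ i + N₀) ⊆ Finset.Ico (N - N₀) N := by
          intro i hi
          simp only [Finset.mem_filter, Finset.mem_range, Finset.mem_Ico] at hi ⊢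
          omega
        refine (Finset.card_le_card this).trans ?_
        rw [Nat.card_Ico]; omega
      simp only [h3]
      rw [Finset.sum_add_distrib]
      simp only [integral_const, probReal_univ, one_smul, Finset.sum_const, Finset.card_range, nsmul_eq_mul]
      linarith
    · exact (integrable_const _).add (integrable_finsetSum _ fun i _ => hIntg i)
  have h2 : ∀ N₀, a ≤ c + e N₀ := by
    intro N₀
    have l1 : Tendsto (fun N : ℕ => c + e N₀ + (N₀ * b) / N) atTop (𝓝 (c + e N₀ + 0)) :=
      tendsto_const_nhds.add (tendsto_const_div_atTop_nhds_zero_nat _)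
    rw [add_zero] at l1
    refine le_of_tendsto_of_tendsto hf.lim l1 ?_
    filter_upwards [eventually_gt_atTop 0] with N hN
    have hN' : (0:ℝ) < N := by exact_mod_cast hN
    rw [div_le_iff₀ hN']
    refine (h1 N₀ N).trans (le_of_eq ?_)
    field_simp
  have h3 : Tendsto e atTop (𝓝 0) := by
    have := tendsto_integral_of_dominated_convergence (μ := P) (F := fun N₀ => (B N₀)ᶜ.indicator (f 1))
      (f := fun _ => (0:ℝ)) (f 1) (fun n => (hgm n).aestronglyMeasurable) hf.int ?_ ?_
    · simpa using this
    · intro N₀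
      refine Eventually.of_forall fun ω => ?_
      rw [Real.norm_of_nonneg (Set.indicator_nonneg (fun x _ => hf.nonneg 1 x) _)]
      exact Set.indicator_le_self' (fun x _ => hf.nonneg 1 x) _
    · filter_upwards [h] with ω hω
      obtain ⟨n, hn, hlt⟩ := hω
      refine tendsto_const_nhds.congr' ?_
      filter_upwards [eventually_ge_atTop n] with N₀ hN₀
      rw [Set.indicator_of_notMem]
      simp only [Set.mem_compl_iff, not_not]
      exact ⟨n, hn, hN₀, hlt⟩
  have h4 : Tendsto (fun N₀ => c + e N₀) atTop (𝓝 (c + 0)) := tendsto_const_nhds.add h3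
  rw [add_zero] at h4
  exact ge_of_tendsto' h4 h2

lemma Coc.lower (hP : IsRWMeasure p P) (hf : Coc P f a) {ε : ℝ} (hε : 0 < ε) :
    ∀ᵐ ω ∂P, ∀ᶠ n : ℕ in atTop, (a - ε) * n ≤ f n ω := by
  have := hP.1
  set A : Set (ℕ → G) := {ω | ∀ j : ℕ, ∀ᶠ n : ℕ in atTop, (a - ε/2 - 1 / (j + 1)) * n ≤ f n ω} with hA
  have hAm : MeasurableSet A := by
    have : A = ⋂ j : ℕ, ⋃ N : ℕ, ⋂ n : ℕ, ⋂ (_ : N ≤ n), {ω | (a - ε/2 - 1 / (j + 1)) * n ≤ f n ω} := by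
      ext ω; simp [hA, eventually_atTop]
    rw [this]
    exact MeasurableSet.iInter fun j => MeasurableSet.iUnion fun N => MeasurableSet.iInter fun n =>
      MeasurableSet.iInter fun _ => measurableSet_le measurable_const (hf.meas n)
  have hinv : A ≤ᵐ[P] (Un 1 ⁻¹' A : Set (ℕ → G)) := by
    filter_upwards [hf.sub] with ω hsub hω
    intro j
    have h1 := hω (2 * j + 1)
    obtain ⟨N, hN⟩ := eventually_atTop.1 h1
    have hd : (0:ℝ) < 1 / ((j:ℝ) + 1) - 1 / (((2 * j + 1 : ℕ):ℝ) + 1) := by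
      push_cast
      have : (1:ℝ) / (2 * j + 1 + 1) < 1 / (j + 1) := by
        apply one_div_lt_one_div_of_lt
        · positivity
        · have : (0:ℝ) ≤ j := Nat.cast_nonneg j
          linarith
      linarith
    have h2 : ∀ᶠ n : ℕ in atTop, f 1 ω - (a - ε/2 - 1 / (((2 * j + 1 : ℕ):ℝ) + 1)) ≤
        (1 / ((j:ℝ) + 1) - 1 / (((2 * j + 1 : ℕ):ℝ) + 1)) * n :=
      (Tendsto.const_mul_atTop hd tendsto_natCast_atTop_atTop).eventually_ge_atTop _
    filter_upwards [h2, eventually_ge_atTop N] with n hn hnN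
    have h3 := hN (1 + n) (by omega)
    have h4 := hsub 1 n
    push_cast at h3 hn ⊢
    linarith
  rcases zero_one hP hAm hinv with h0 | h1
  · exfalso
    have h2 : ∀ᵐ ω ∂P, ω ∉ A := measure_eq_zero_iff_ae_notMem.1 h0
    have h3 : a ≤ a - ε / 2 := by
      refine hf.lower_aux hP ?_
      filter_upwards [h2] with ω hω
      simp only [hA, Set.mem_ofPred_eq, not_forall] at hω
      obtain ⟨j, hj⟩ := hω
      rw [not_eventually] at hj
      obtain ⟨n, hn1, hn⟩ := (hj.and_eventually (eventually_ge_atTop 1)).exists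
      refine ⟨n, hn, ?_⟩
      push Not at hn1
      refine hn1.trans_le ?_
      refine mul_le_mul_of_nonneg_right ?_ (Nat.cast_nonneg n)
      have : (0:ℝ) < 1 / (j + 1) := by positivity
      linarith
    linarith
  · have h2 : ∀ᵐ ω ∂P, ω ∈ A := by
      rw [← prob_compl_eq_zero_iff hAm] at h1
      exact h1
    obtain ⟨j, hj⟩ := exists_nat_one_div_lt (show 0 < ε / 2 by positivity)
    filter_upwards [h2] with ω hω
    filter_upwards [hω j] with n hn
    refine le_trans ?_ hn
    refine mul_le_mul_of_nonneg_right ?_ (Nat.cast_nonneg n)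
    linarith

end Kingman

/-! ### Part 5: drift and entropy cocycles -/

lemma Growth.prod {X Y : Type*} [MetricSpace X] [MetricSpace Y] {C v C' v' : ℝ}
    (h : Growth X C v) (h' : Growth Y C' v') : Growth (X × Y) (C * C') (v + v') := by
  obtain ⟨hC, hv, h⟩ := h
  obtain ⟨hC', hv', h'⟩ := h'
  refine ⟨by positivity, by positivity, fun x R hR => ?_⟩
  have e : {g | dist x g ≤ R} = {g | dist x.1 g ≤ R} ×ˢ {g | dist x.2 g ≤ R} := by
    ext g; simp [Prod.dist_eq]
  obtain ⟨f1, c1⟩ := h x.1 R hR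
  obtain ⟨f2, c2⟩ := h' x.2 R hR
  rw [e]
  refine ⟨f1.prod f2, ?_⟩
  rw [Set.ncard_prod]
  push_cast
  calc _ ≤ (C * Real.exp (v * R)) * (C' * Real.exp (v' * R)) := by gcongr
    _ = _ := by rw [add_mul, Real.exp_add]; ring

lemma Growth.sum {X : Type*} [MetricSpace X] {C v : ℝ} (h : Growth X C v) (o : X) :
    ∑' x : X, ENNReal.ofReal (Real.exp (-((v + 1) * dist o x))) ≠ ∞ := by
  obtain ⟨hC, hv, h⟩ := h
  have h1 : ∀ x : X, ENNReal.ofReal (Real.exp (-((v + 1) * dist o x))) ≤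
      ∑' n : ℕ, if dist o x ≤ n then ENNReal.ofReal (Real.exp (v + 1) * Real.exp (-((v + 1) * n))) else 0 := by
    intro x
    refine le_trans ?_ (ENNReal.le_tsum ⌈dist o x⌉₊)
    rw [if_pos (Nat.le_ceil _)]
    apply ENNReal.ofReal_le_ofReal
    rw [← Real.exp_add]
    apply Real.exp_le_exp.2
    have := (Nat.ceil_lt_add_one (dist_nonneg (x := o) (y := x))).le
    nlinarith
  refine ne_top_of_le_ne_top ?_ (ENNReal.tsum_le_tsum h1)
  rw [ENNReal.tsum_comm]
  have h2 : ∀ n : ℕ, (∑' x : X, if dist o x ≤ n then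
      ENNReal.ofReal (Real.exp (v + 1) * Real.exp (-((v + 1) * n))) else 0) ≤
      ENNReal.ofReal (C * Real.exp (v + 1) * Real.exp (-(n:ℝ))) := by
    intro n
    obtain ⟨hf, hc⟩ := h o n (Nat.cast_nonneg n)
    have e : (fun x : X => if dist o x ≤ n then
      ENNReal.ofReal (Real.exp (v + 1) * Real.exp (-((v + 1) * n))) else 0) =
      fun x => Set.indicator {x | dist o x ≤ n} (fun _ => ENNReal.ofReal (Real.exp (v + 1) * Real.exp (-((v + 1) * n)))) x := by
      funext x; simp [Set.indicator]
    rw [e, ← tsum_subtype, ENNReal.tsum_set_const, hf.encard_eq_coe_toFinset_card]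
    rw [← Set.ncard_eq_toFinset_card _ hf]
    have : ((({x | dist o x ≤ n}.ncard : ℕ∞) : ℝ≥0∞)) = ENNReal.ofReal ({x | dist o x ≤ n}.ncard : ℝ) := by
      simp
    rw [this, ← ENNReal.ofReal_mul (by positivity)]
    apply ENNReal.ofReal_le_ofReal
    calc _ ≤ (C * Real.exp (v * n)) * (Real.exp (v + 1) * Real.exp (-((v + 1) * n))) := by gcongr
      _ = C * Real.exp (v + 1) * (Real.exp (v * n) * Real.exp (-((v + 1) * n))) := by ring
      _ = _ := by rw [← Real.exp_add]; congr 2; ring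
  refine ne_top_of_le_ne_top ?_ (ENNReal.tsum_le_tsum h2)
  have hs : Summable (fun n : ℕ => C * Real.exp (v + 1) * Real.exp (-(n:ℝ))) := by
    refine Summable.mul_left _ ?_
    exact Real.summable_exp_neg_nat
  rw [← ENNReal.ofReal_tsum_of_nonneg (fun n => by positivity) hs]
  exact ENNReal.ofReal_ne_top

lemma neg_log_bound {t d s : ℝ} (ht0 : 0 ≤ t) (ht1 : t ≤ 1) (hd : 0 ≤ d) (hs : 0 ≤ s) :
    t * (-Real.log t) ≤ 2 * s * d * t + 2 * Real.exp (-(s * d)) := by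
  rcases ht0.eq_or_lt with rfl | ht
  · simp; positivity
  by_cases hc : Real.exp (-(2 * (s * d))) ≤ t
  · have h1 : -(2 * (s * d)) ≤ Real.log t := by
      rw [Real.le_log_iff_exp_le ht]; exact hc
    have : t * (-Real.log t) ≤ t * (2 * (s * d)) := by gcongr; linarith
    have := Real.exp_pos (-(s * d))
    linarith
  · push Not at hc
    set r := Real.sqrt t with hr
    have hr0 : 0 < r := Real.sqrt_pos.2 ht
    have htr : t = r ^ 2 := (Real.sq_sqrt ht.le).symm
    have hrb : r ≤ Real.exp (-(s * d)) := by
      rw [hr]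
      apply Real.sqrt_le_iff.2
      refine ⟨(Real.exp_pos _).le, ?_⟩
      rw [← Real.exp_nat_mul]
      refine hc.le.trans (le_of_eq ?_)
      congr 1; push_cast; ring
    have h1 : -Real.log r ≤ 1 / r - 1 := by
      have := Real.log_le_sub_one_of_pos (show 0 < 1 / r by positivity)
      rwa [one_div, Real.log_inv, ← one_div] at this
    have h2 : t * (-Real.log t) ≤ 2 * r := by
      rw [htr, Real.log_pow]
      push_cast
      have : r ^ 2 * (1 / r - 1) = r - r ^ 2 := by field_simp
      have h3 : r ^ 2 * (-Real.log r) ≤ r ^ 2 * (1 / r - 1) := by gcongr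
      nlinarith
    have : 0 ≤ 2 * s * d * t := by positivity
    linarith

section Cocycles
variable {G : Type*} [Group G] [MeasurableSpace G] [DiscreteMeasurableSpace G] [Countable G]
variable {p : G → ℝ≥0∞} {P : Measure (ℕ → G)}
variable {H : Type*} [Group H] [Countable H]

/-- `q` is the step distribution of the projected walk -/
def Step (P : Measure (ℕ → G)) (φ : G →* H) (q : H → ℝ≥0∞) : Prop :=
  ∀ b, P {ω | φ (ω 0) = b} = q b

variable {φ : G →* H} {q : H → ℝ≥0∞}

lemma measurable_fwalk {A : Type*} [MeasurableSpace A] (F : G → A) (n : ℕ) :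
    Measurable (fun ω : ℕ → G => F (walk ω n)) := by
  have : Measurable F := fun s _ => DiscreteMeasurableSpace.forall_measurableSet _
  exact this.comp (measurable_walk n)

lemma lint_walk (hP : IsRWMeasure p P) (hq : Step P φ q) (n : ℕ) (F : H → ℝ≥0∞) :
    ∫⁻ ω, F (φ (walk ω n)) ∂P = ∑' b, piN q n b * F b := by
  have := hP.1
  letI : MeasurableSpace H := ⊤
  have hm : Measurable (fun ω : ℕ → G => φ (walk ω n)) := measurable_fwalk _ n
  have h1 := lintegral_map (μ := P) (f := F) (g := fun ω => φ (walk ω n)) measurable_from_top hm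
  rw [← h1, lintegral_countable']
  congr 1
  funext b
  rw [Measure.map_apply hm (MeasurableSet.singleton b), mul_comm]
  congr 1
  exact P_walk hP φ hq n b

lemma int_walk (hP : IsRWMeasure p P) (hq : Step P φ q) (n : ℕ) (F : H → ℝ)
    (hF : Integrable (fun ω => F (φ (walk ω n))) P) :
    ∫ ω, F (φ (walk ω n)) ∂P = ∑' b, (piN q n b).toReal * F b := by
  have := hP.1
  letI : MeasurableSpace H := ⊤
  have hm : Measurable (fun ω : ℕ → G => φ (walk ω n)) := measurable_fwalk _ n
  have hFm : AEStronglyMeasurable F (P.map (fun ω => φ (walk ω n))) :=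
    (measurable_from_top (f := F)).aestronglyMeasurable
  have h1 := integral_map (μ := P) hm.aemeasurable hFm
  rw [← h1, integral_countable' ((integrable_map_measure hFm hm.aemeasurable).2 hF)]
  congr 1
  funext b
  rw [measureReal_def, Measure.map_apply hm (MeasurableSet.singleton b), smul_eq_mul]
  congr 2
  exact P_walk hP φ hq n b

lemma piN_le_one (hP : IsRWMeasure p P) (hq : Step P φ q) (n : ℕ) (b : H) : piN q n b ≤ 1 := by
  have := hP.1
  rw [← P_walk hP φ hq n b]; exact prob_le_one

lemma piN_one (hP : IsRWMeasure p P) (hq : Step P φ q) (b : H) : piN q 1 b = q b := by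
  rw [← P_walk hP φ hq 1 b, ← hq b]
  simp only [walk_one]

lemma piN_mul_le (hP : IsRWMeasure p P) (hq : Step P φ q) (n m : ℕ) (a b : H) :
    piN q n a * piN q m b ≤ piN q (n + m) (a * b) := by
  have := hP.1
  rw [← P_walk hP φ hq n a, ← P_walk hP φ hq m b, ← P_walk hP φ hq (n + m) (a * b)]
  have hpre : pre n ⁻¹' {γ | ∃ ω : ℕ → G, pre n ω = γ ∧ φ (walk ω n) = a} =
      {ω : ℕ → G | φ (walk ω n) = a} := by
    ext ω
    constructor
    · rintro ⟨ω', h1, h2⟩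
      show φ (walk ω n) = a
      rw [← walk_pre h1]; exact h2
    · intro h; exact ⟨ω, rfl, h⟩
  have hmeas : MeasurableSet {ω : ℕ → G | φ (walk ω m) = b} :=
    measurable_walk m (DiscreteMeasurableSpace.forall_measurableSet {x : G | φ x = b})
  rw [← hpre, ← prefix_mul hP n _ hmeas, hpre]
  apply measure_mono
  rintro ω ⟨h1, h2⟩
  show φ (walk ω (n + m)) = a * b
  have h1' : φ (walk ω n) = a := h1
  have h2' : φ (walk (Un n ω) m) = b := h2
  rw [walk_add, map_mul, h1', h2']

lemma piN_pos_ae (hP : IsRWMeasure p P) (hq : Step P φ q) :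
    ∀ᵐ ω ∂P, ∀ n, piN q n (φ (walk ω n)) ≠ 0 := by
  rw [ae_all_iff]
  intro n
  rw [ae_iff]
  have : {ω : ℕ → G | ¬ piN q n (φ (walk ω n)) ≠ 0} =
      ⋃ b : H, ⋃ (_ : piN q n b = 0), {ω | φ (walk ω n) = b} := by
    ext ω
    simp
  rw [this, measure_iUnion_null_iff]
  intro b
  rw [measure_iUnion_null_iff]
  intro hb
  rw [P_walk hP φ hq n b, hb]

/-- entropy functional -/
def fent (q : H → ℝ≥0∞) (φ : G →* H) (n : ℕ) (ω : ℕ → G) : ℝ :=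
  -Real.log (piN q n (φ (walk ω n))).toReal

lemma fwalk_pre {A : Type*} (F : G → A) (n : ℕ) :
    ∃ F' : (Fin n → G) → A, (fun ω : ℕ → G => F (walk ω n)) = F' ∘ pre n := by
  refine ⟨fun γ => F (walk (fun i => if h : i < n then γ ⟨i, h⟩ else 1) n), ?_⟩
  funext ω
  simp only [Function.comp]
  congr 1
  apply walk_pre
  funext i
  simp [pre]

lemma coc_ent (hP : IsRWMeasure p P) (hq : Step P φ q) [MetricSpace H] {C v : ℝ}
    (hg : Growth H C v) (hIntg : ∫⁻ ω, ENNReal.ofReal (dist 1 (φ (ω 0))) ∂P ≠ ∞) {h : ℝ}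
    (hh : HasEntropy q h) : Coc P (fent q φ) h := by
  have := hP.1
  have hle : ∀ n b, (piN q n b).toReal ≤ 1 := fun n b =>
    ENNReal.toReal_le_of_le_ofReal zero_le_one (by simpa using piN_le_one hP hq n b)
  have h0 : Coc0 P (fent q φ) := by
    refine ⟨fun n ω => ?_, fun ω => ?_, ?_, fun n => ?_, ?_⟩
    · have := Real.log_nonpos ENNReal.toReal_nonneg (hle n (φ (walk ω n)))
      simp only [fent]; linarith
    · simp [fent, walk_zero, piN]
    · have hpos := piN_pos_ae hP hq
      have hpos' : ∀ᵐ ω ∂P, ∀ n m, piN q m (φ (walk (Un n ω) m)) ≠ 0 := by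
        rw [ae_all_iff]
        intro n
        exact (map_Un hP n).quasiMeasurePreserving.ae hpos
      filter_upwards [hpos, hpos'] with ω h1 h2 n m
      simp only [fent]
      have ht : ∀ n b, piN q n b ≠ ∞ := fun n b => ne_top_of_le_ne_top ENNReal.one_ne_top (piN_le_one hP hq n b)
      have a1 := ENNReal.toReal_pos (h1 n) (ht _ _)
      have a2 := ENNReal.toReal_pos (h2 n m) (ht _ _)
      have a3 := piN_mul_le hP hq n m (φ (walk ω n)) (φ (walk (Un n ω) m))
      rw [← map_mul, ← walk_add] at a3
      have a4 := ENNReal.toReal_mono (ht _ _) a3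
      rw [ENNReal.toReal_mul] at a4
      have a5 := Real.log_le_log (mul_pos a1 a2) a4
      rw [Real.log_mul a1.ne' a2.ne'] at a5
      linarith
    · exact fwalk_pre (fun g => -Real.log (piN q n (φ g)).toReal) n
    · refine ⟨(measurable_fwalk (fun g => -Real.log (piN q 1 (φ g)).toReal) 1).aestronglyMeasurable, ?_⟩
      rw [hasFiniteIntegral_iff_ofReal]
      · show ∫⁻ ω, ENNReal.ofReal (-Real.log (piN q 1 (φ (walk ω 1))).toReal) ∂P < ∞
        rw [lint_walk hP hq 1 (fun b => ENNReal.ofReal (-Real.log (piN q 1 b).toReal))]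
        have hb : ∀ b, piN q 1 b * ENNReal.ofReal (-Real.log (piN q 1 b).toReal) ≤
            ENNReal.ofReal (2 * (v + 1)) * (piN q 1 b * ENNReal.ofReal (dist 1 b)) +
            2 * ENNReal.ofReal (Real.exp (-((v + 1) * dist 1 b))) := by
          intro b
          have hv := hg.2.1
          have ht : piN q 1 b = ENNReal.ofReal (piN q 1 b).toReal := by
            rw [ENNReal.ofReal_toReal]
            exact ne_top_of_le_ne_top ENNReal.one_ne_top (piN_le_one hP hq 1 b)
          have := neg_log_bound (t := (piN q 1 b).toReal) (d := dist 1 b) (s := v + 1)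
            ENNReal.toReal_nonneg (hle 1 b) dist_nonneg (by positivity)
          have h2 : (2:ℝ≥0∞) = ENNReal.ofReal 2 := by simp
          set t := (piN q 1 b).toReal
          have ht0 : 0 ≤ t := ENNReal.toReal_nonneg
          rw [ht, h2, ← ENNReal.ofReal_mul ht0, ← ENNReal.ofReal_mul ht0, ← ENNReal.ofReal_mul (by positivity),
            ← ENNReal.ofReal_mul (by positivity), ← ENNReal.ofReal_add (by positivity) (by positivity)]
          apply ENNReal.ofReal_le_ofReal
          linarith
        refine lt_of_le_of_lt (ENNReal.tsum_le_tsum hb) ?_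
        rw [ENNReal.tsum_add, ENNReal.tsum_mul_left, ENNReal.tsum_mul_left]
        have hm : ∑' b, piN q 1 b * ENNReal.ofReal (dist 1 b) ≠ ∞ := by
          rw [← lint_walk hP hq 1 (fun b => ENNReal.ofReal (dist 1 b))]
          simpa only [walk_one] using hIntg
        exact ENNReal.add_lt_top.2 ⟨ENNReal.mul_lt_top ENNReal.ofReal_lt_top hm.lt_top,
          ENNReal.mul_lt_top (by simp) (hg.sum 1).lt_top⟩
      · refine Eventually.of_forall fun ω => ?_
        have := Real.log_nonpos ENNReal.toReal_nonneg (hle 1 (φ (walk ω 1)))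
        show 0 ≤ fent q φ 1 ω
        simp only [fent]; linarith
  refine ⟨h0, ?_⟩
  refine hh.congr fun n => ?_
  congr 1
  have := int_walk hP hq n (fun b => -Real.log (piN q n b).toReal) (h0.integrable hP n)
  show _ = ∫ ω, -Real.log (piN q n (φ (walk ω n))).toReal ∂P
  rw [this, entropySeq]
  congr 1
  funext b
  simp [Real.negMulLog]

/-- drift functional -/
def fdr [MetricSpace H] (φ : G →* H) (n : ℕ) (ω : ℕ → G) : ℝ := dist 1 (φ (walk ω n))

lemma coc_dr (hP : IsRWMeasure p P) (hq : Step P φ q) [MetricSpace H] (hinv : LeftInvariantMetric H)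
    (hIntg : ∫⁻ ω, ENNReal.ofReal (dist 1 (φ (ω 0))) ∂P ≠ ∞) {l : ℝ}
    (hl : HasDrift q (fun x => dist 1 x) l) : Coc P (fdr φ) l := by
  have := hP.1
  have h0 : Coc0 P (fdr φ) := by
    refine ⟨fun n ω => dist_nonneg, fun ω => by simp [fdr, walk_zero], Eventually.of_forall fun ω n m => ?_,
      fun n => fwalk_pre (fun g => dist 1 (φ g)) n, ?_⟩
    · simp only [fdr]
      have e : dist (φ (walk ω n)) (φ (walk ω (n + m))) = dist 1 (φ (walk (Un n ω) m)) := by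
        rw [walk_add, map_mul]
        have := hinv (φ (walk ω n)) 1 (φ (walk (Un n ω) m))
        rwa [mul_one] at this
      rw [← e]
      exact dist_triangle _ _ _
    · refine ⟨(measurable_fwalk (fun g => dist 1 (φ g)) 1).aestronglyMeasurable, ?_⟩
      have hn : ∀ ω, 0 ≤ fdr φ 1 ω := fun ω => dist_nonneg
      rw [hasFiniteIntegral_iff_ofReal (Eventually.of_forall hn)]
      simp only [fdr, walk_one]
      exact hIntg.lt_top
  refine ⟨h0, ?_⟩
  refine hl.congr fun n => ?_
  congr 1
  have := int_walk hP hq n (fun b => dist 1 b) (h0.integrable hP n)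
  show _ = ∫ ω, dist 1 (φ (walk ω n)) ∂P
  rw [this, momentSeq]

end Cocycles

/-! ### Part 6: positivity of the drift -/

section DriftPos
variable {H : Type*} [Group H]

/-- squared l2 norm -/
def N2 (f : H → ℝ) : ℝ≥0∞ := ∑' x, ENNReal.ofReal (f x ^ 2)

/-- squared l2 norm of the difference with a translate -/
def D2 (f : H → ℝ) (g : H) : ℝ≥0∞ := ∑' x, ENNReal.ofReal ((f x - f (x * g)) ^ 2)

/-- lazy Markov operator -/
def lazyT (m : H → ℝ) (f : H → ℝ) (x : H) : ℝ := (f x + ∑' h, m h * f (x * h⁻¹)) / 2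

lemma D2_one (f : H → ℝ) : D2 f 1 = 0 := by simp [D2]

lemma D2_inv (f : H → ℝ) (g : H) : D2 f g⁻¹ = D2 f g := by
  unfold D2
  rw [← (Equiv.mulRight g).tsum_eq]
  congr 1; funext x
  simp only [Equiv.coe_mulRight, mul_inv_cancel_right]
  congr 1; ring

lemma D2_mul (f : H → ℝ) (g h : H) : D2 f (g * h) ≤ 2 * D2 f g + 2 * D2 f h := by
  have e : D2 f h = ∑' x, ENNReal.ofReal ((f (x * g) - f (x * g * h)) ^ 2) := by
    unfold D2
    rw [← (Equiv.mulRight g).tsum_eq]; rfl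
  rw [e]
  unfold D2
  rw [← ENNReal.tsum_mul_left, ← ENNReal.tsum_mul_left, ← ENNReal.tsum_add]
  refine ENNReal.tsum_le_tsum fun x => ?_
  rw [← mul_assoc]
  have h2 : (2:ℝ≥0∞) = ENNReal.ofReal 2 := by simp
  rw [h2, ← ENNReal.ofReal_mul (by norm_num), ← ENNReal.ofReal_mul (by norm_num),
    ← ENNReal.ofReal_add (by positivity) (by positivity)]
  apply ENNReal.ofReal_le_ofReal
  nlinarith [sq_nonneg ((f x - f (x * g)) - (f (x * g) - f (x * g * h)))]

lemma summable_mb {m : H → ℝ} (hm0 : ∀ h, 0 ≤ m h) (hm : Summable m) {u : H → ℝ} {B : ℝ}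
    (hu : ∀ h, |u h| ≤ B) : Summable fun h => m h * u h := by
  refine Summable.of_norm_bounded (hm.mul_right B) fun h => ?_
  rw [norm_mul, Real.norm_eq_abs, Real.norm_eq_abs, abs_of_nonneg (hm0 h)]
  exact mul_le_mul_of_nonneg_left (hu h) (hm0 h)

lemma lazy_point {m : H → ℝ} (hm0 : ∀ h, 0 ≤ m h) (hm : HasSum m 1) {u : H → ℝ}
    (hu : ∀ h, |u h| ≤ 1) {a : ℝ} (ha : |a| ≤ 1) (g : H) :
    ((a + ∑' h, m h * u h) / 2) ^ 2 + m g / 4 * (a - u g) ^ 2 ≤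
      (a ^ 2 + ∑' h, m h * u h ^ 2) / 2 := by
  have s1 := summable_mb hm0 hm.summable hu
  have s2 : Summable fun h => m h * u h ^ 2 := summable_mb hm0 hm.summable (B := 1) fun h => by
    rw [abs_pow]; exact pow_le_one₀ (abs_nonneg _) (hu h)
  set s := ∑' h, m h * u h with hs
  set Q := ∑' h, m h * u h ^ 2 with hQ
  have key : ∀ c : ℝ, HasSum (fun h => m h * (u h - c) ^ 2) (Q - 2 * c * s + c ^ 2) := by
    intro c
    have := (s2.hasSum.sub (s1.hasSum.mul_left (2 * c))).add (hm.mul_left (c ^ 2))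
    rw [mul_one] at this
    have e : (fun h => m h * (u h - c) ^ 2) =
        fun h => m h * u h ^ 2 - 2 * c * (m h * u h) + c ^ 2 * m h := by
      funext h; ring
    rw [e]; exact this
  have k1 : 0 ≤ Q - 2 * s * s + s ^ 2 :=
    (key s).nonneg fun h => mul_nonneg (hm0 h) (sq_nonneg _)
  have k2 : m g * (u g - a) ^ 2 ≤ Q - 2 * a * s + a ^ 2 :=
    le_hasSum (key a) g fun h _ => mul_nonneg (hm0 h) (sq_nonneg _)
  nlinarith

lemma gap_support {m : H → ℝ} (hm0 : ∀ h, 0 ≤ m h) (hm : HasSum m 1) {f : H → ℝ}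
    (hf : ∀ h, |f h| ≤ 1) (g : H) :
    N2 (lazyT m f) + ENNReal.ofReal (m g / 4) * D2 f g ≤ N2 f := by
  have e1 : N2 f = (N2 f + N2 f) / 2 := by
    rw [ENNReal.add_div, ENNReal.add_halves]
  have e2 : N2 f = ∑' x, ∑' h, ENNReal.ofReal (m h * f (x * h⁻¹) ^ 2) := by
    rw [ENNReal.tsum_comm]
    have : ∀ h, ∑' x, ENNReal.ofReal (m h * f (x * h⁻¹) ^ 2) = ENNReal.ofReal (m h) * N2 f := by
      intro h
      unfold N2
      rw [← (Equiv.mulRight h).tsum_eq, ← ENNReal.tsum_mul_left]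
      congr 1; funext x
      rw [ENNReal.ofReal_mul (hm0 h)]; simp
    simp_rw [this]
    rw [ENNReal.tsum_mul_right, ← ENNReal.ofReal_tsum_of_nonneg hm0 hm.summable, hm.tsum_eq]
    simp
  rw [← D2_inv f g]
  have : N2 (lazyT m f) + ENNReal.ofReal (m g / 4) * D2 f g⁻¹ ≤
      (N2 f + ∑' x, ∑' h, ENNReal.ofReal (m h * f (x * h⁻¹) ^ 2)) / 2 := by
    unfold N2 D2
    rw [← ENNReal.tsum_mul_left, ← ENNReal.tsum_add, ← ENNReal.tsum_add,
      ENNReal.div_eq_inv_mul, ← ENNReal.tsum_mul_left]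
    refine ENNReal.tsum_le_tsum fun x => ?_
    have hsu : Summable fun h => m h * f (x * h⁻¹) ^ 2 :=
      summable_mb hm0 hm.summable (B := 1) fun h => by
        rw [abs_pow]; exact pow_le_one₀ (abs_nonneg _) (hf _)
    have hnn : ∀ h, 0 ≤ m h * f (x * h⁻¹) ^ 2 := fun h => mul_nonneg (hm0 h) (sq_nonneg _)
    rw [← ENNReal.ofReal_tsum_of_nonneg hnn hsu,
      ← ENNReal.ofReal_mul (by have := hm0 g; positivity),
      ← ENNReal.ofReal_add (by positivity) (mul_nonneg (by have := hm0 g; positivity) (sq_nonneg _)),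
      ← ENNReal.ofReal_add (by positivity) (tsum_nonneg hnn)]
    have h2 : (2:ℝ≥0∞)⁻¹ = ENNReal.ofReal (1/2) := by
      rw [ENNReal.ofReal_div_of_pos (by norm_num)]; simp
    rw [h2, ← ENNReal.ofReal_mul (by norm_num)]
    apply ENNReal.ofReal_le_ofReal
    have := lazy_point hm0 hm (u := fun h => f (x * h⁻¹)) (fun h => hf _) (hf x) g
    unfold lazyT
    linarith
  rw [← e2] at this
  rwa [← e1] at this

/-- uniform spectral-gap type estimate for a group element -/
def GapAt (m : H → ℝ) (g : H) : Prop :=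
  ∃ K : NNReal, ∀ f : H → ℝ, (∀ h, |f h| ≤ 1) → N2 f ≠ ∞ → D2 f g ≤ K * (N2 f - N2 (lazyT m f))

lemma gapAt_closure {m : H → ℝ} (hm0 : ∀ h, 0 ≤ m h) (hm : HasSum m 1) {g : H}
    (hg : g ∈ Subgroup.closure {x | m x ≠ 0}) : GapAt m g := by
  induction hg using Subgroup.closure_induction with
  | mem x hx =>
    have hx0 : 0 < m x := lt_of_le_of_ne (hm0 x) (Ne.symm hx)
    refine ⟨Real.toNNReal (4 / m x), fun f hf hN => ?_⟩
    have h1 := gap_support hm0 hm hf x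
    have h2 : ENNReal.ofReal (m x / 4) * D2 f x ≤ N2 f - N2 (lazyT m f) := by
      apply ENNReal.le_sub_of_add_le_left _ h1
      exact ne_top_of_le_ne_top hN (le_trans (by simp) h1)
    calc D2 f x = ENNReal.ofReal (4 / m x) * (ENNReal.ofReal (m x / 4) * D2 f x) := by
          rw [← mul_assoc, ← ENNReal.ofReal_mul (by positivity)]
          have : 4 / m x * (m x / 4) = 1 := by field_simp
          rw [this]; simp
      _ ≤ _ := by
          gcongr; rfl
  | one => exact ⟨0, fun f _ _ => by simp [D2_one]⟩
  | mul x y _ _ hx hy =>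
    obtain ⟨K, hK⟩ := hx
    obtain ⟨K', hK'⟩ := hy
    refine ⟨2 * K + 2 * K', fun f hf hN => ?_⟩
    refine (D2_mul f x y).trans ?_
    push_cast
    rw [add_mul, mul_assoc, mul_assoc]
    gcongr
    · exact hK f hf hN
    · exact hK' f hf hN
  | inv x _ hx =>
    obtain ⟨K, hK⟩ := hx
    exact ⟨K, fun f hf hN => by rw [D2_inv]; exact hK f hf hN⟩

/-- mass of a set -/
def m2 (f : H → ℝ) (A : Set H) : ℝ≥0∞ := ∑' x : A, ENNReal.ofReal (f x ^ 2)

lemma m2_translate (f : H → ℝ) (A : Set H) (g : H) :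
    m2 f ((fun x => x * g) '' A) ≤ ENNReal.ofReal (3/2) * m2 f A + 3 * D2 f g := by
  have e : m2 f ((fun x => x * g) '' A) = ∑' x : A, ENNReal.ofReal (f (x * g) ^ 2) := by
    unfold m2
    exact tsum_image (fun x => ENNReal.ofReal (f x ^ 2)) (mul_left_injective g).injOn
  rw [e]
  have h1 : ∑' x : A, ENNReal.ofReal ((f x - f (x * g)) ^ 2) ≤ D2 f g :=
    ENNReal.tsum_comp_le_tsum_of_injective Subtype.val_injective
      (fun x => ENNReal.ofReal ((f x - f (x * g)) ^ 2))
  refine le_trans ?_ (add_le_add_right (mul_le_mul_right h1 _) _)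
  unfold m2
  rw [← ENNReal.tsum_mul_left, ← ENNReal.tsum_mul_left, ← ENNReal.tsum_add]
  refine ENNReal.tsum_le_tsum fun x => ?_
  have h3 : (3:ℝ≥0∞) = ENNReal.ofReal 3 := by simp
  rw [h3, ← ENNReal.ofReal_mul (by norm_num), ← ENNReal.ofReal_mul (by norm_num),
    ← ENNReal.ofReal_add (by positivity) (by positivity)]
  apply ENNReal.ofReal_le_ofReal
  nlinarith [sq_nonneg (f x + 2 * (f x - f (x * g)))]

lemma m2_union (f : H → ℝ) (A B : Set H) : m2 f (A ∪ B) ≤ m2 f A + m2 f B :=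
  ENNReal.tsum_union_le (fun x => ENNReal.ofReal (f x ^ 2)) A B

lemma m2_disj (f : H → ℝ) {A B : Set H} (h : Disjoint A B) : m2 f (A ∪ B) = m2 f A + m2 f B :=
  Summable.tsum_union_disjoint (f := fun x => ENNReal.ofReal (f x ^ 2)) h ENNReal.summable ENNReal.summable

lemma m2_le (f : H → ℝ) (A : Set H) : m2 f A ≤ N2 f :=
  ENNReal.tsum_comp_le_tsum_of_injective Subtype.val_injective
      (fun x => ENNReal.ofReal (f x ^ 2))

lemma exists_wd (φ : FreeGroup (Fin 2) →* H) (hφ : Function.Injective φ) :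
    ∃ wd : H → FreeGroup (Fin 2), ∀ x u, wd (x * φ u) = u⁻¹ * wd x := by
  have h : ∀ x : H, ∃ w, φ w = x⁻¹ * ((x : H ⧸ φ.range).out) := by
    intro x
    have : x⁻¹ * ((x : H ⧸ φ.range).out) ∈ φ.range := by
      rw [← QuotientGroup.eq]; simp
    exact this
  choose wd hwd using h
  refine ⟨wd, fun x u => hφ ?_⟩
  rw [map_mul, hwd, hwd, map_inv]
  have : ((x * φ u : H) : H ⧸ φ.range) = (x : H ⧸ φ.range) := by
    rw [eq_comm, QuotientGroup.eq]
    simp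
  rw [this]; group

lemma paradox (φ : FreeGroup (Fin 2) →* H) (hφ : Function.Injective φ) (f : H → ℝ)
    (hN : N2 f ≠ ∞) :
    N2 f ≤ 6 * (D2 f (φ (FreeGroup.mk [(0, true)])) + D2 f (φ (FreeGroup.mk [(1, true)]))) := by
  obtain ⟨wd, hwd⟩ := exists_wd φ hφ
  let A : Fin 2 × Bool → Set H := fun w => {x | wd x ∈ FreeGroup.startsWith w}
  have hd : ∀ w w', w ≠ w' → Disjoint (A w) (A w') := by
    intro w w' hw
    have := FreeGroup.startsWith.disjoint_iff_ne.2 hw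
    exact Disjoint.preimage wd this
  have hc : ∀ i : Fin 2, N2 f ≤ m2 f (A (i, false)) + (ENNReal.ofReal (3/2) * m2 f (A (i, true)) +
      3 * D2 f (φ (FreeGroup.mk [(i, true)]))) := by
    intro i
    refine le_trans ?_ (add_le_add_right (m2_translate f (A (i, true)) (φ (FreeGroup.mk [(i, true)]))) _)
    refine le_trans ?_ (m2_union f _ _)
    have : A (i, false) ∪ (fun x => x * φ (FreeGroup.mk [(i, true)])) '' A (i, true) = univ := by
      ext x
      simp only [mem_union, mem_univ, iff_true]
      by_cases hx : x ∈ A (i, false)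
      · exact Or.inl hx
      · right
        refine ⟨x * φ (FreeGroup.mk [(i, true)])⁻¹, ?_, by
          rw [map_inv]; simp only [inv_mul_cancel_right]⟩
        show wd _ ∈ FreeGroup.startsWith _
        rw [hwd, inv_inv]
        exact FreeGroup.startsWith_mk_mul (w := (i, true)) _ hx
    rw [this]
    unfold m2 N2
    rw [tsum_univ (fun x => ENNReal.ofReal (f x ^ 2))]
  have hs : (m2 f (A (0, false)) + m2 f (A (0, true))) + (m2 f (A (1, false)) + m2 f (A (1, true))) ≤ N2 f := by
    rw [← m2_disj f (hd _ _ (by simp)), ← m2_disj f (hd _ _ (by simp)), ← m2_disj]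
    · exact m2_le _ _
    · simp only [disjoint_union_left, disjoint_union_right]
      refine ⟨⟨hd _ _ (by simp), hd _ _ (by simp)⟩, hd _ _ (by simp), hd _ _ (by simp)⟩
  by_cases hD0 : D2 f (φ (FreeGroup.mk [(0, true)])) = ∞
  · simp [hD0]
  by_cases hD1 : D2 f (φ (FreeGroup.mk [(1, true)])) = ∞
  · simp [hD1]
  have f1 := ne_top_of_le_ne_top hN (m2_le f (A (0, false)))
  have f2 := ne_top_of_le_ne_top hN (m2_le f (A (0, true)))
  have f3 := ne_top_of_le_ne_top hN (m2_le f (A (1, false)))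
  have f4 := ne_top_of_le_ne_top hN (m2_le f (A (1, true)))
  have h0 := hc 0
  have h1 := hc 1
  lift N2 f to NNReal using hN with N
  lift D2 f (φ (FreeGroup.mk [(0, true)])) to NNReal using hD0 with D0
  lift D2 f (φ (FreeGroup.mk [(1, true)])) to NNReal using hD1 with D1
  lift m2 f (A (0, false)) to NNReal using f1 with a1
  lift m2 f (A (0, true)) to NNReal using f2 with a2
  lift m2 f (A (1, false)) to NNReal using f3 with a3
  lift m2 f (A (1, true)) to NNReal using f4 with a4
  have e : ENNReal.ofReal (3/2) = ((3/2 : NNReal) : ℝ≥0∞) := by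
    rw [ENNReal.ofReal]; congr 1
    apply NNReal.eq
    rw [Real.coe_toNNReal _ (by norm_num)]; norm_num
  rw [e] at h0 h1
  norm_cast at h0 h1 hs ⊢
  rw [← NNReal.coe_le_coe] at h0 h1 hs ⊢
  push_cast at h0 h1 hs ⊢
  have := a1.2; have := a3.2
  simp only [NNReal.val_eq_coe] at *
  linarith

lemma contraction {m : H → ℝ} (hm0 : ∀ h, 0 ≤ m h) (hm : HasSum m 1)
    (hne : IsNonElementarySubgroup (Subgroup.closure {x | m x ≠ 0})) :
    ∃ c : ℝ, 0 < c ∧ c < 1 ∧ ∀ f : H → ℝ, (∀ h, |f h| ≤ 1) → N2 f ≠ ∞ →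
      N2 (lazyT m f) ≤ ENNReal.ofReal c * N2 f := by
  obtain ⟨φ, hφ, hr⟩ := hne
  obtain ⟨K0, h0⟩ := gapAt_closure hm0 hm (hr ⟨FreeGroup.mk [(0, true)], rfl⟩)
  obtain ⟨K1, h1⟩ := gapAt_closure hm0 hm (hr ⟨FreeGroup.mk [(1, true)], rfl⟩)
  have hK : (0:ℝ) < 6 * (K0 + K1) + 2 := by positivity
  refine ⟨1 - 1 / (6 * (K0 + K1) + 2), ?_, ?_, fun f hf hN => ?_⟩
  · rw [sub_pos, div_lt_one hK]
    have : (0:ℝ) ≤ K0 + K1 := by positivity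
    linarith
  · have : 0 < 1 / (6 * ((K0:ℝ) + K1) + 2) := by positivity
    linarith
  have hT : N2 (lazyT m f) ≤ N2 f := le_trans (by simp) (gap_support hm0 hm hf 1)
  have hT' := ne_top_of_le_ne_top hN hT
  have key : N2 f ≤ 6 * (K0 * (N2 f - N2 (lazyT m f)) + K1 * (N2 f - N2 (lazyT m f))) := by
    refine (paradox φ hφ f hN).trans ?_
    gcongr
    · exact h0 f hf hN
    · exact h1 f hf hN
  lift N2 f to NNReal using hN with N
  lift N2 (lazyT m f) to NNReal using hT' with M
  rw [← ENNReal.coe_sub] at key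
  norm_cast at key hT
  rw [← NNReal.coe_le_coe] at key
  push_cast [NNReal.coe_sub hT] at key
  have : ENNReal.ofReal (1 - 1 / (6 * (K0 + K1) + 2)) * N =
      ENNReal.ofReal ((1 - 1 / (6 * (K0 + K1) + 2)) * N) := by
    rw [ENNReal.ofReal_mul']
    · simp
    · exact N.2
  rw [this]
  have e : (M : ℝ≥0∞) = ENNReal.ofReal (M:ℝ) := by simp
  rw [e]
  apply ENNReal.ofReal_le_ofReal
  have hMN : (M:ℝ) ≤ N := by exact_mod_cast hT
  have : (N:ℝ) / (6 * (K0 + K1) + 2) ≤ N - M := by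
    rw [div_le_iff₀ hK]; nlinarith
  have e2 : (1 - 1 / (6 * ((K0:ℝ) + K1) + 2)) * N = N - N / (6 * (K0 + K1) + 2) := by ring
  rw [e2]; linarith

variable {q : H → ℝ≥0∞}

lemma piN_sum (hq : ∑' x, q x = 1) (n : ℕ) : ∑' x, piN q n x = 1 := by
  induction n with
  | zero => simp [piN]
  | succ n ih =>
    simp only [piN, conv]
    rw [ENNReal.tsum_comm]
    have : ∀ y, ∑' x, piN q n y * q (y⁻¹ * x) = piN q n y := by
      intro y
      have e := (Equiv.mulLeft y⁻¹).tsum_eq (fun x => q x)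
      simp only [Equiv.coe_mulLeft] at e
      rw [ENNReal.tsum_mul_left, e, hq, mul_one]
    simp_rw [this, ih]

lemma piN_le1 (hq : ∑' x, q x = 1) (n : ℕ) (x : H) : piN q n x ≤ 1 :=
  (ENNReal.le_tsum x).trans (piN_sum hq n).le

lemma piN_step (hq : ∑' x, q x = 1) (k : ℕ) (x : H) :
    ∑' h, (q h).toReal * (piN q k (x * h⁻¹)).toReal = (piN q (k+1) x).toReal := by
  simp only [piN, conv]
  rw [← ((Equiv.inv H).trans (Equiv.mulLeft x)).tsum_eq (fun y => piN q k y * q (y⁻¹ * x)),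
    ENNReal.tsum_toReal_eq]
  · congr 1; funext h
    rw [ENNReal.toReal_mul, mul_comm]
    simp
  · intro h
    refine ENNReal.mul_ne_top ?_ ?_
    · exact ne_top_of_le_ne_top (by simp) (piN_le1 hq k _)
    · refine ne_top_of_le_ne_top (b := 1) (by simp) ?_
      rw [← hq]; exact ENNReal.le_tsum _

/-- laws of the lazy random walk -/
def fL (m : H → ℝ) : ℕ → H → ℝ
  | 0 => fun x => if x = 1 then 1 else 0
  | n + 1 => lazyT m (fL m n)

lemma fL_mix (hq : ∑' x, q x = 1) (n : ℕ) : ∃ b : ℕ → ℝ, (∀ k, 0 ≤ b k) ∧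
    ∑ k ∈ Finset.range (n+1), b k = 1 ∧
    ∀ x, fL (fun h => (q h).toReal) n x = ∑ k ∈ Finset.range (n+1), b k * (piN q k x).toReal := by
  induction n with
  | zero =>
    refine ⟨fun _ => 1, fun _ => zero_le_one, by simp, fun x => ?_⟩
    simp only [fL, piN, zero_add, Finset.range_one, Finset.sum_singleton, one_mul]
    split_ifs <;> simp
  | succ n ih =>
    obtain ⟨b, hb0, hb1, hb⟩ := ih
    let b1 : ℕ → ℝ := fun k => if k < n + 1 then b k else 0
    let b2 : ℕ → ℝ := fun k => if 0 < k then b (k - 1) else 0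
    have s1 : ∀ F : ℕ → ℝ, ∑ k ∈ Finset.range (n+1+1), b1 k * F k = ∑ k ∈ Finset.range (n+1), b k * F k := by
      intro F
      rw [Finset.sum_range_succ]
      have : b1 (n+1) = 0 := by simp [b1]
      rw [this, zero_mul, add_zero]
      refine Finset.sum_congr rfl fun k hk => ?_
      have := Finset.mem_range.1 hk
      simp only [b1, if_pos this]
    have s2 : ∀ F : ℕ → ℝ, ∑ k ∈ Finset.range (n+1+1), b2 k * F k = ∑ k ∈ Finset.range (n+1), b k * F (k+1) := by
      intro F
      rw [Finset.sum_range_succ']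
      simp [b2]
    refine ⟨fun k => (b1 k + b2 k) / 2, fun k => ?_, ?_, fun x => ?_⟩
    · have h1 : 0 ≤ b1 k := by simp only [b1]; split_ifs <;> simp [hb0]
      have h2 : 0 ≤ b2 k := by simp only [b2]; split_ifs <;> simp [hb0]
      positivity
    · have h1 := s1 fun _ => 1
      have h2 := s2 fun _ => 1
      simp only [mul_one, hb1] at h1 h2
      rw [← Finset.sum_div, Finset.sum_add_distrib, h1, h2]; norm_num
    · have e : ∑ k ∈ Finset.range (n+1+1), (b1 k + b2 k) / 2 * (piN q k x).toReal =
          (∑ k ∈ Finset.range (n+1+1), b1 k * (piN q k x).toReal +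
            ∑ k ∈ Finset.range (n+1+1), b2 k * (piN q k x).toReal) / 2 := by
        rw [← Finset.sum_add_distrib, Finset.sum_div]
        refine Finset.sum_congr rfl fun k _ => by ring
      rw [e, s1 fun k => (piN q k x).toReal, s2 fun k => (piN q k x).toReal]
      simp only [fL, lazyT, hb]
      congr 2
      have hsm : Summable fun h => (q h).toReal := ENNReal.summable_toReal (by rw [hq]; simp)
      have : ∀ h, (q h).toReal * ∑ k ∈ Finset.range (n+1), b k * (piN q k (x * h⁻¹)).toReal =
          ∑ k ∈ Finset.range (n+1), b k * ((q h).toReal * (piN q k (x * h⁻¹)).toReal) := by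
        intro h
        rw [Finset.mul_sum]
        refine Finset.sum_congr rfl fun k _ => by ring
      simp_rw [this]
      rw [Summable.tsum_finsetSum]
      · refine Finset.sum_congr rfl fun k _ => ?_
        rw [tsum_mul_left, piN_step hq]
      · intro k _
        refine Summable.mul_left _ ?_
        refine summable_mb (fun _ => ENNReal.toReal_nonneg) hsm (B := 1) fun h => ?_
        rw [abs_of_nonneg ENNReal.toReal_nonneg]
        exact ENNReal.toReal_le_of_le_ofReal zero_le_one (by simpa using piN_le1 hq k _)

theorem drift_pos [MetricSpace H] {C v : ℝ} (hg : Growth H C v) (hq : ∑' x, q x = 1)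
    (hne : IsNonElemMeasure q)
    (hM : ∀ k, ∑' x, piN q k x * ENNReal.ofReal (dist 1 x) =
      ENNReal.ofReal (momentSeq q (fun x => dist 1 x) k))
    {l : ℝ} (hl : HasDrift q (fun x => dist 1 x) l) : 0 < l := by
  by_contra hl0
  push Not at hl0
  obtain ⟨hC, hv, hgr⟩ := hg
  have hqt : ∀ h, q h ≠ ∞ := fun h =>
    ne_top_of_le_ne_top (b := 1) (by simp) (by rw [← hq]; exact ENNReal.le_tsum _)
  set m : H → ℝ := fun h => (q h).toReal with hmdef
  have hm0 : ∀ h, 0 ≤ m h := fun h => ENNReal.toReal_nonneg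
  have hm : HasSum m 1 := by
    have hsm : Summable m := ENNReal.summable_toReal (by rw [hq]; simp)
    have := hsm.hasSum
    rwa [hmdef, ← ENNReal.tsum_toReal_eq hqt, hq, ENNReal.toReal_one] at this
  have hne' : IsNonElementarySubgroup (Subgroup.closure {x | m x ≠ 0}) := by
    have : {x | m x ≠ 0} = {x | q x ≠ 0} := by
      ext x; simp [hmdef, ENNReal.toReal_eq_zero_iff, hqt]
    rw [this]; exact hne
  obtain ⟨c, hc0, hc1, hc⟩ := contraction hm0 hm hne'
  -- bounds on the lazy laws
  have hf0 : ∀ n x, 0 ≤ fL m n x := by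
    intro n x
    obtain ⟨b, hb0, hb1, hb⟩ := fL_mix hq n
    rw [hb]
    exact Finset.sum_nonneg fun k _ => mul_nonneg (hb0 k) ENNReal.toReal_nonneg
  have hf1 : ∀ n x, |fL m n x| ≤ 1 := by
    intro n x
    rw [abs_of_nonneg (hf0 n x)]
    obtain ⟨b, hb0, hb1, hb⟩ := fL_mix hq n
    rw [hb, ← hb1]
    refine Finset.sum_le_sum fun k _ => mul_le_of_le_one_right (hb0 k) ?_
    exact ENNReal.toReal_le_of_le_ofReal zero_le_one (by simpa using piN_le1 hq k _)
  have hN : ∀ n, N2 (fL m n) ≤ ENNReal.ofReal (c ^ n) := by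
    intro n
    induction n with
    | zero =>
      have : ∀ x : H, ENNReal.ofReal ((if x = 1 then (1:ℝ) else 0) ^ 2) = if x = 1 then 1 else 0 := by
        intro x; split_ifs <;> simp
      simp only [N2, fL, this]
      simp
    | succ n ih =>
      have := hc (fL m n) (hf1 n) (ne_top_of_le_ne_top ENNReal.ofReal_ne_top ih)
      refine this.trans ?_
      rw [pow_succ', ENNReal.ofReal_mul hc0.le]
      gcongr
  set ρ := -Real.log c with hρ
  have hρ0 : 0 < ρ := by rw [hρ]; have := Real.log_neg hc0 hc1; linarith
  have hsup : ∀ n x, fL m n x ≤ Real.exp (-(ρ * n / 2)) := by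
    intro n x
    have h1 : ENNReal.ofReal (fL m n x ^ 2) ≤ ENNReal.ofReal (c ^ n) := by
      refine le_trans ?_ (hN n)
      unfold N2
      exact ENNReal.le_tsum (f := fun x => ENNReal.ofReal (fL m n x ^ 2)) x
    rw [ENNReal.ofReal_le_ofReal_iff (by positivity)] at h1
    have h2 : c ^ n = Real.exp (-(ρ * n / 2)) ^ 2 := by
      rw [← Real.exp_nat_mul, ← Real.rpow_natCast, Real.rpow_def_of_pos hc0]
      congr 1; rw [hρ]; push_cast; ring
    rw [h2] at h1
    exact le_of_sq_le_sq h1 (Real.exp_pos _).le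
  -- moments
  obtain ⟨ε, hε0, hε⟩ : ∃ ε : ℝ, 0 < ε ∧ 2 * v * ε = ρ / 4 :=
    ⟨ρ / (8 * v), by positivity, by field_simp; ring⟩
  obtain ⟨B, hB0, hB⟩ : ∃ B : ℝ, 0 < B ∧ ∀ k, momentSeq q (fun x => dist 1 x) k ≤ ε * k + B := by
    have : ∀ᶠ k : ℕ in atTop, momentSeq q (fun x => dist 1 x) k / k < ε :=
      hl.eventually_lt_const (by linarith)
    obtain ⟨K, hK⟩ := eventually_atTop.1 (this.and (eventually_gt_atTop 0))
    refine ⟨∑ k ∈ Finset.range K, |momentSeq q (fun x => dist 1 x) k| + 1, by positivity, fun k => ?_⟩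
    by_cases hk : K ≤ k
    · obtain ⟨h1, h2⟩ := hK k hk
      have h2' : (0:ℝ) < k := by exact_mod_cast h2
      rw [div_lt_iff₀ h2'] at h1
      have : 0 ≤ ∑ k ∈ Finset.range K, |momentSeq q (fun x => dist 1 x) k| := by positivity
      linarith
    · have h1 : |momentSeq q (fun x => dist 1 x) k| ≤ ∑ k ∈ Finset.range K, |momentSeq q (fun x => dist 1 x) k| :=
        Finset.single_le_sum (f := fun k => |momentSeq q (fun x => dist 1 x) k|)
          (fun _ _ => abs_nonneg _) (Finset.mem_range.2 (not_le.1 hk))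
      have := le_abs_self (momentSeq q (fun x => dist 1 x) k)
      have : 0 ≤ ε * k := by positivity
      linarith
  have hexp : ∀ n (F : H → ℝ≥0∞) (T : ℝ), (∀ k ≤ n, ∑' x, piN q k x * F x ≤ ENNReal.ofReal T) →
      ∑' x, ENNReal.ofReal (fL m n x) * F x ≤ ENNReal.ofReal T := by
    intro n F T hT
    obtain ⟨b, hb0, hb1, hb⟩ := fL_mix hq n
    have e : ∀ x, ENNReal.ofReal (fL m n x) * F x =
        ∑ k ∈ Finset.range (n+1), ENNReal.ofReal (b k) * (piN q k x * F x) := by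
      intro x
      rw [hb, ENNReal.ofReal_sum_of_nonneg fun k _ => mul_nonneg (hb0 k) ENNReal.toReal_nonneg,
        Finset.sum_mul]
      refine Finset.sum_congr rfl fun k _ => ?_
      rw [ENNReal.ofReal_mul (hb0 k), ENNReal.ofReal_toReal, mul_assoc]
      exact ne_top_of_le_ne_top (by simp) (piN_le1 hq k _)
    simp_rw [e]
    rw [Summable.tsum_finsetSum fun _ _ => ENNReal.summable]
    calc _ ≤ ∑ k ∈ Finset.range (n+1), ENNReal.ofReal (b k) * ENNReal.ofReal T := by
          refine Finset.sum_le_sum fun k hk => ?_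
          rw [ENNReal.tsum_mul_left]
          gcongr
          exact hT k (by have := Finset.mem_range.1 hk; omega)
      _ = ENNReal.ofReal T := by
          rw [← Finset.sum_mul, ← ENNReal.ofReal_sum_of_nonneg fun k _ => hb0 k, hb1]; simp
  have hone : ∀ n, ∑' x, ENNReal.ofReal (fL m n x) = 1 := by
    intro n
    obtain ⟨b, hb0, hb1, hb⟩ := fL_mix hq n
    have e : ∀ x, ENNReal.ofReal (fL m n x) =
        ∑ k ∈ Finset.range (n+1), ENNReal.ofReal (b k) * piN q k x := by
      intro x
      rw [hb, ENNReal.ofReal_sum_of_nonneg fun k _ => mul_nonneg (hb0 k) ENNReal.toReal_nonneg]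
      refine Finset.sum_congr rfl fun k _ => ?_
      rw [ENNReal.ofReal_mul (hb0 k), ENNReal.ofReal_toReal]
      exact ne_top_of_le_ne_top (by simp) (piN_le1 hq k _)
    simp_rw [e]
    rw [Summable.tsum_finsetSum fun _ _ => ENNReal.summable]
    simp_rw [ENNReal.tsum_mul_left, piN_sum hq, mul_one]
    rw [← ENNReal.ofReal_sum_of_nonneg fun k _ => hb0 k, hb1]; simp
  have main : ∀ n : ℕ, 1 ≤ C * Real.exp (2 * v * (ε * n + B)) * Real.exp (-(ρ * n / 2)) + 1 / 2 := by
    intro n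
    set R := 2 * (ε * n + B) with hR
    have hR0 : 0 < R := by positivity
    obtain ⟨hfin, hcard⟩ := hgr 1 R hR0.le
    have hpt : ∀ x, ENNReal.ofReal (fL m n x) ≤
        Set.indicator {g | dist 1 g ≤ R} (fun _ => ENNReal.ofReal (Real.exp (-(ρ * n / 2)))) x +
        ENNReal.ofReal (1 / R) * (ENNReal.ofReal (fL m n x) * ENNReal.ofReal (dist 1 x)) := by
      intro x
      by_cases hx : dist 1 x ≤ R
      · rw [Set.indicator_of_mem (by exact hx)]
        exact le_add_right (ENNReal.ofReal_le_ofReal (hsup n x))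
      · push Not at hx
        refine le_add_left ?_
        rw [← ENNReal.ofReal_mul (hf0 n x), ← ENNReal.ofReal_mul (by positivity)]
        apply ENNReal.ofReal_le_ofReal
        have : 1 ≤ 1 / R * dist 1 x := by
          rw [one_div_mul_eq_div, one_le_div hR0]; exact hx.le
        have := mul_le_mul_of_nonneg_left this (hf0 n x)
        linarith
    have h1 := ENNReal.tsum_le_tsum hpt
    rw [hone, ENNReal.tsum_add, ENNReal.tsum_mul_left, ← tsum_subtype, ENNReal.tsum_set_const,
      hfin.encard_eq_coe_toFinset_card, ← Set.ncard_eq_toFinset_card _ hfin] at h1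
    have h2 := hexp n (fun x => ENNReal.ofReal (dist 1 x)) (ε * n + B) fun k hk => by
      rw [hM k]
      apply ENNReal.ofReal_le_ofReal
      refine (hB k).trans ?_
      have : (k:ℝ) ≤ n := by exact_mod_cast hk
      gcongr
    have h3 : (1:ℝ≥0∞) ≤ ENNReal.ofReal (C * Real.exp (2 * v * (ε * n + B)) * Real.exp (-(ρ * n / 2)) + 1 / 2) := by
      rw [ENNReal.ofReal_add (by positivity) (by positivity)]
      refine h1.trans (add_le_add ?_ ?_)
      · have : ((({x : H | dist 1 x ≤ R}.ncard : ℕ∞) : ℝ≥0∞)) = ENNReal.ofReal ({x : H | dist 1 x ≤ R}.ncard : ℝ) := by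
          simp
        rw [this, ← ENNReal.ofReal_mul (by positivity)]
        apply ENNReal.ofReal_le_ofReal
        refine mul_le_mul_of_nonneg_right (hcard.trans (le_of_eq ?_)) (by positivity)
        congr 2; rw [hR]; ring
      · calc _ ≤ ENNReal.ofReal (1 / R) * ENNReal.ofReal (ε * n + B) := by gcongr
          _ = _ := by
            rw [← ENNReal.ofReal_mul (by positivity)]
            congr 1; rw [hR]; field_simp
    rw [← ENNReal.ofReal_one, ENNReal.ofReal_le_ofReal_iff (by positivity)] at h3
    exact h3
  have hlim : Tendsto (fun n : ℕ => C * Real.exp (2 * v * B) * Real.exp (-(ρ / 4 * n))) atTop (𝓝 0) := by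
    have : Tendsto (fun n : ℕ => Real.exp (-(ρ / 4 * n))) atTop (𝓝 0) := by
      apply Real.tendsto_exp_neg_atTop_nhds_zero.comp
      exact tendsto_natCast_atTop_atTop.const_mul_atTop (by positivity)
    simpa using this.const_mul (C * Real.exp (2 * v * B))
  obtain ⟨n, hn⟩ := (hlim.eventually_lt_const (u := 1/2) (by norm_num)).exists
  have := main n
  have e : C * Real.exp (2 * v * (ε * n + B)) * Real.exp (-(ρ * n / 2)) =
      C * Real.exp (2 * v * B) * Real.exp (-(ρ / 4 * n)) := by
    rw [mul_assoc C, mul_assoc C, ← Real.exp_add, ← Real.exp_add]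
    congr 2
    have : 2 * v * (ε * n + B) = (2 * v * ε) * n + 2 * v * B := by ring
    rw [this, hε]; ring
  rw [e] at this
  linarith

end DriftPos

/-! ### Part 9: exact dimensionality implies existence of the Hausdorff dimension -/

section Dim
variable {A : Type*} {q : A → A → ℝ}

lemma qdiam_empty : qdiam q (∅ : Set A) = 0 := by simp [qdiam]

lemma qdiam_le {s : Set A} {r : ℝ} (h : ∀ x ∈ s, ∀ y ∈ s, q x y ≤ r) :
    qdiam q s ≤ ENNReal.ofReal r :=
  iSup₂_le fun x hx => iSup₂_le fun y hy => ENNReal.ofReal_le_ofReal (h x hx y hy)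

lemma qHContent_le {ι : Type*} [Countable ι] {α Δ : ℝ} (hα : 0 < α) {E : Set A} (c : ι → Set A)
    (hE : E ⊆ ⋃ i, c i) (hd : ∀ i, qdiam q (c i) ≤ ENNReal.ofReal Δ) :
    qHContent q α Δ E ≤ ∑' i, qdiam q (c i) ^ α := by
  obtain ⟨e, he⟩ := exists_injective_nat ι
  let c' : ℕ → Set A := Function.extend e c (fun _ => ∅)
  have hc' : ∀ i, c' (e i) = c i := fun i => he.extend_apply _ _ _
  have h1 : E ⊆ ⋃ i, c' i := by
    intro x hx
    obtain ⟨i, hi⟩ := mem_iUnion.1 (hE hx)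
    exact mem_iUnion.2 ⟨e i, by rwa [hc']⟩
  have h0 : ∀ n, n ∉ range e → c' n = ∅ := by
    intro n hn
    exact Function.extend_apply' _ _ _ (by simpa using hn)
  have h2 : ∀ i, qdiam q (c' i) ≤ ENNReal.ofReal Δ := by
    intro n
    by_cases hn : n ∈ range e
    · obtain ⟨i, rfl⟩ := hn; rw [hc']; exact hd i
    · rw [h0 n hn, qdiam_empty]; simp
  refine (iInf₂_le_of_le c' h1 (iInf_le_of_le h2 le_rfl)).trans (le_of_eq ?_)
  rw [← tsum_extend_zero he]
  congr 1; funext n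
  by_cases hn : n ∈ range e
  · obtain ⟨i, rfl⟩ := hn; rw [hc', he.extend_apply]
  · rw [h0 n hn, qdiam_empty, Function.extend_apply' _ _ _ (by simpa using hn),
      ENNReal.zero_rpow_of_pos hα]; rfl

lemma qHMeasure_eq_zero {α : ℝ} {E : Set A} (h : ∀ Δ > 0, qHContent q α Δ E = 0) :
    qHMeasure q α E = 0 := by
  simp only [qHMeasure]
  refine le_antisymm (iSup₂_le fun Δ hΔ => (h Δ hΔ).le) (zero_le)

lemma content_zero_iUnion {α : ℝ} (hα : 0 < α) {F : ℕ → Set A} {E : Set A} (hE : E ⊆ ⋃ k, F k)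
    {Δ : ℝ} (h : ∀ k, qHContent q α Δ (F k) = 0) : qHContent q α Δ E = 0 := by
  refine le_antisymm (ENNReal.le_of_forall_pos_le_add fun ε hε _ => ?_) zero_le
  rw [zero_add]
  obtain ⟨ε', hε', hs⟩ := ENNReal.exists_pos_sum_of_countable' (ι := ℕ) (ENNReal.coe_pos.2 hε).ne' 
  have hk : ∀ k, ∃ c : ℕ → Set A, F k ⊆ ⋃ i, c i ∧ (∀ i, qdiam q (c i) ≤ ENNReal.ofReal Δ) ∧
      ∑' i, qdiam q (c i) ^ α < ε' k := by
    intro k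
    have : qHContent q α Δ (F k) < ε' k := by rw [h k]; exact hε' k
    simp only [qHContent, iInf_lt_iff] at this
    obtain ⟨c, h1, h2, h3⟩ := this
    exact ⟨c, h1, h2, h3⟩
  choose c h1 h2 h3 using hk
  refine (qHContent_le hα (fun p : ℕ × ℕ => c p.1 p.2) ?_ fun p => h2 _ _).trans ?_
  · intro x hx
    obtain ⟨k, hk⟩ := mem_iUnion.1 (hE hx)
    obtain ⟨i, hi⟩ := mem_iUnion.1 (h1 k hk)
    exact mem_iUnion.2 ⟨(k, i), hi⟩
  · rw [ENNReal.tsum_prod' (f := fun p : ℕ × ℕ => qdiam q (c p.1 p.2) ^ α)]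
    exact (ENNReal.tsum_le_tsum fun k => (h3 k).le).trans hs.le

/-- finite covers with few small pieces give zero content -/
lemma content_zero_of_covers {α β b C : ℝ} (hα : 0 < α) (hb : 0 ≤ b) (hβ : β < α) {E : Set A} (hC : 0 ≤ C)
    (h : ∀ᶠ n : ℕ in atTop, ∃ F : Finset (Set A), (F.card : ℝ) ≤ C * Real.exp (β * n) ∧
      (∀ x ∈ E, ∃ s ∈ F, x ∈ s) ∧ ∀ s ∈ F, ∀ x ∈ s, ∀ y ∈ s, q x y ≤ b * Real.exp (-n))
    {Δ : ℝ} (hΔ : 0 < Δ) : qHContent q α Δ E = 0 := by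
  have hlim : Tendsto (fun n : ℕ => ENNReal.ofReal (C * b ^ α * Real.exp (-((α - β) * n)))) atTop (𝓝 0) := by
    rw [← ENNReal.ofReal_zero]
    apply ENNReal.tendsto_ofReal
    have : Tendsto (fun n : ℕ => Real.exp (-((α - β) * n))) atTop (𝓝 0) := by
      apply Real.tendsto_exp_neg_atTop_nhds_zero.comp
      exact tendsto_natCast_atTop_atTop.const_mul_atTop (by linarith)
    simpa using this.const_mul (C * b ^ α)
  have hlim2 : ∀ᶠ n : ℕ in atTop, b * Real.exp (-n) < Δ := by
    have : Tendsto (fun n : ℕ => b * Real.exp (-(n:ℝ))) atTop (𝓝 (b * 0)) := by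
      apply Tendsto.const_mul
      exact Real.tendsto_exp_neg_atTop_nhds_zero.comp tendsto_natCast_atTop_atTop
    rw [mul_zero] at this
    exact this.eventually_lt_const hΔ
  refine le_antisymm (ge_of_tendsto hlim ?_) zero_le
  filter_upwards [h, hlim2] with n ⟨F, hF, hcov, hd⟩ hn
  have hd' : ∀ i : F, qdiam q i.1 ≤ ENNReal.ofReal (b * Real.exp (-n)) := fun i =>
    qdiam_le (hd i.1 i.2)
  refine (qHContent_le hα (fun s : F => s.1) ?_ fun i =>
    (hd' i).trans (ENNReal.ofReal_le_ofReal hn.le)).trans ?_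
  · intro x hx
    obtain ⟨s, hs, hxs⟩ := hcov x hx
    exact mem_iUnion.2 ⟨⟨s, hs⟩, hxs⟩
  · rw [tsum_fintype]
    calc _ ≤ ∑ i : F, ENNReal.ofReal ((b * Real.exp (-n)) ^ α) := by
          refine Finset.sum_le_sum fun i _ => ?_
          rw [← ENNReal.ofReal_rpow_of_nonneg (by positivity) hα.le]
          exact ENNReal.rpow_le_rpow (hd' i) hα.le
      _ = ENNReal.ofReal (F.card * (b * Real.exp (-n)) ^ α) := by
          rw [Finset.sum_const, nsmul_eq_mul, ENNReal.ofReal_mul (by positivity)]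
          simp
      _ ≤ _ := by
          apply ENNReal.ofReal_le_ofReal
          rw [Real.mul_rpow hb (Real.exp_pos _).le, ← Real.exp_mul]
          calc (F.card : ℝ) * (b ^ α * Real.exp (-(n:ℝ) * α)) ≤
              (C * Real.exp (β * n)) * (b ^ α * Real.exp (-(n:ℝ) * α)) := by gcongr
            _ = C * b ^ α * (Real.exp (β * n) * Real.exp (-(n:ℝ) * α)) := by ring
            _ = _ := by rw [← Real.exp_add]; congr 2; ring

lemma CoverBdd.bddAbove (h : CoverBdd q) (E : Set A) :
    BddAbove {α : ℝ | 0 ≤ α ∧ 0 < qHMeasure q α E} := by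
  obtain ⟨k, hk, h⟩ := h
  have hk0 : (0:ℝ) < k := by exact_mod_cast hk
  refine ⟨Real.log k, fun α ⟨h0, h1⟩ => ?_⟩
  by_contra hα
  push Not at hα
  have hl : 0 ≤ Real.log k := Real.log_nonneg (by exact_mod_cast hk)
  refine h1.ne' (qHMeasure_eq_zero fun Δ hΔ => ?_)
  refine content_zero_of_covers (b := 1) (C := k) (hl.trans_lt hα) zero_le_one hα hk0.le
    (Eventually.of_forall fun n => ?_) hΔ
  obtain ⟨F, hF, hc, hd⟩ := h n
  refine ⟨F, ?_, fun x _ => hc x, by simpa using hd⟩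
  calc (F.card : ℝ) ≤ (k:ℝ) ^ (n + 1) := by exact_mod_cast hF
    _ = _ := by rw [mul_comm (Real.log k), Real.exp_nat_mul, Real.exp_log hk0, pow_succ']

lemma zero_mem_dim (E : Set A) : (0:ℝ) ∈ {α : ℝ | 0 ≤ α ∧ 0 < qHMeasure q α E} := by
  refine ⟨le_rfl, ?_⟩
  have : (⊤ : ℝ≥0∞) ≤ qHMeasure q 0 E := by
    refine le_iSup₂_of_le 1 one_pos ?_
    simp only [qHContent, ENNReal.rpow_zero, ENNReal.tsum_const]
    refine le_iInf fun c => le_iInf fun _ => le_iInf fun _ => ?_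
    simp
  exact lt_of_lt_of_le (by simp) this

variable [MeasurableSpace A] {ν : Measure A}

lemma small_ball_bounds {ξ : A} {D α : ℝ} 
    (h : Tendsto (fun r : ℝ => Real.log (ν (qball q ξ r)).toReal / Real.log r)
      (nhdsWithin 0 (Set.Ioi 0)) (nhds D)) (hα0 : 0 ≤ α) [IsProbabilityMeasure ν] (hα : α < D) :
    ∃ k : ℕ, ∀ r : ℝ, 0 < r → r < 1 / ((k:ℝ) + 1) → ν (qball q ξ r) ≤ ENNReal.ofReal (r ^ α) := by
  have h1 := h.eventually_const_lt hα
  rw [eventually_nhdsWithin_iff, Metric.eventually_nhds_iff] at h1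
  obtain ⟨ε, hε, h1⟩ := h1
  obtain ⟨k, hk⟩ := exists_nat_one_div_lt hε
  refine ⟨k, fun r hr0 hr => ?_⟩
  have hr1 : r < 1 := hr.trans_le (by
    rw [div_le_one (by positivity)]; have : (0:ℝ) ≤ k := by positivity
    linarith)
  have hl := Real.log_neg hr0 hr1
  have h2 := h1 (y := r) (by rw [Real.dist_eq, sub_zero, abs_of_pos hr0]; linarith) hr0
  rw [lt_div_iff_of_neg hl] at h2
  set t := (ν (qball q ξ r)).toReal with ht
  have ht0 : 0 < t := by
    by_contra hc
    have : t = 0 := le_antisymm (not_lt.1 hc) ENNReal.toReal_nonneg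
    rw [this, Real.log_zero] at h2
    nlinarith
  have : t ≤ r ^ α := by
    rw [← Real.log_le_log_iff ht0 (by positivity), Real.log_rpow hr0]
    exact h2.le
  rw [← ENNReal.ofReal_toReal (measure_ne_top ν (qball q ξ r))]
  exact ENNReal.ofReal_le_ofReal this

lemma large_ball_bounds {ξ : A} {D α : ℝ} 
    (h : Tendsto (fun r : ℝ => Real.log (ν (qball q ξ r)).toReal / Real.log r)
      (nhdsWithin 0 (Set.Ioi 0)) (nhds D)) [IsProbabilityMeasure ν]
      (hpos : ∀ r, 0 < r → 0 < ν (qball q ξ r)) (hα : D < α) :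
    ∃ k : ℕ, ∀ r : ℝ, 0 < r → r < 1 / ((k:ℝ) + 1) → ENNReal.ofReal (r ^ α) ≤ ν (qball q ξ r) := by
  have h1 := h.eventually_lt_const hα
  rw [eventually_nhdsWithin_iff, Metric.eventually_nhds_iff] at h1
  obtain ⟨ε, hε, h1⟩ := h1
  obtain ⟨k, hk⟩ := exists_nat_one_div_lt hε
  refine ⟨k, fun r hr0 hr => ?_⟩
  have hr1 : r < 1 := hr.trans_le (by
    rw [div_le_one (by positivity)]; have : (0:ℝ) ≤ k := by positivity
    linarith)
  have hl := Real.log_neg hr0 hr1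
  have h2 := h1 (y := r) (by rw [Real.dist_eq, sub_zero, abs_of_pos hr0]; linarith) hr0
  rw [div_lt_iff_of_neg hl] at h2
  set t := (ν (qball q ξ r)).toReal with ht
  have ht0 : 0 < t := ENNReal.toReal_pos (hpos r hr0).ne' (measure_ne_top _ _)
  have : r ^ α ≤ t := by
    rw [← Real.log_le_log_iff (by positivity) ht0, Real.log_rpow hr0]
    exact h2.le
  rw [← ENNReal.ofReal_toReal (measure_ne_top ν (qball q ξ r))]
  exact ENNReal.ofReal_le_ofReal this

lemma pos_balls (hc : CoverBdd q) : ∀ᵐ ξ ∂ν, ∀ r, 0 < r → 0 < ν (qball q ξ r) := by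
  obtain ⟨k, hk, h⟩ := hc
  have h1 : ∀ n : ℕ, ∀ᵐ ξ ∂ν, ν (qball q ξ (2 * Real.exp (-n))) ≠ 0 := by
    intro n
    obtain ⟨F, hF, hc, hd⟩ := h n
    rw [ae_iff]
    simp only [ne_eq, not_not]
    refine measure_mono_null (t := ⋃ s ∈ F, (s ∩ {a | ν (qball q a (2 * Real.exp (-n))) = 0})) ?_ ?_
    · intro x hx
      obtain ⟨s, hs, hxs⟩ := hc x
      simp only [mem_iUnion]
      exact ⟨s, hs, hxs, hx⟩
    · refine (measure_biUnion_null_iff F.countable_toSet).2 ?_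
      intro s hs
      rcases (s ∩ {a | ν (qball q a (2 * Real.exp (-n))) = 0}).eq_empty_or_nonempty with h0 | ⟨x, hx1, hx2⟩
      · rw [h0]; simp
      · refine measure_mono_null ?_ hx2
        rintro y ⟨hy, -⟩
        show q x y < _
        have := hd s hs x hx1 y hy
        have := Real.exp_pos (-(n:ℝ))
        linarith
  filter_upwards [ae_all_iff.2 h1] with ξ hξ r hr
  have : Tendsto (fun n : ℕ => 2 * Real.exp (-(n:ℝ))) atTop (𝓝 (2 * 0)) := by
    apply Tendsto.const_mul
    exact Real.tendsto_exp_neg_atTop_nhds_zero.comp tendsto_natCast_atTop_atTop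
  rw [mul_zero] at this
  obtain ⟨n, hn⟩ := (this.eventually_lt_const hr).exists
  refine (pos_iff_ne_zero.2 (hξ n)).trans_le (measure_mono fun y hy => ?_)
  exact lt_trans hy hn

lemma dim_lower [IsProbabilityMeasure ν] (hc : CoverBdd q) (hq0 : ∀ x y, 0 ≤ q x y) {D : ℝ} (hD : 0 ≤ D)
    (h : ExactDim q ν D) {E : Set A} (hE : 0 < ν E) : D ≤ qdimSet q E := by
  refine le_of_forall_lt fun α hα => ?_
  obtain ⟨β, hβ1, hβ2⟩ := exists_between hα
  rcases le_or_gt β 0 with h0 | h0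
  · exact hβ1.trans_le (h0.trans (le_csSup (hc.bddAbove E) (zero_mem_dim E)))
  refine hβ1.trans_le (le_csSup (hc.bddAbove E) ⟨h0.le, ?_⟩)
  let G : ℕ → Set A := fun k => {ξ | ξ ∈ E ∧ ∀ r, 0 < r → r < 1 / ((k:ℝ) + 1) → ν (qball q ξ r) ≤ ENNReal.ofReal (r ^ β)}
  obtain ⟨k, hk⟩ : ∃ k, 0 < ν (G k) := by
    by_contra hcon
    push Not at hcon
    have h1 : ν (⋃ k, G k) = 0 := measure_iUnion_null fun k => le_antisymm (hcon k) zero_le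
    have h2 : ∀ᵐ ξ ∂ν, ξ ∉ E := by
      filter_upwards [h, measure_eq_zero_iff_ae_notMem.1 h1] with ξ h3 h4 hξ
      obtain ⟨k, hk⟩ := small_ball_bounds h3 h0.le hβ2
      exact h4 (mem_iUnion.2 ⟨k, hξ, hk⟩)
    exact hE.ne' (measure_eq_zero_iff_ae_notMem.2 h2)
  set R : ℝ := 1 / ((k:ℝ) + 1) with hR
  have hR0 : 0 < R := by positivity
  refine lt_of_lt_of_le (b := ENNReal.ofReal (2 ^ (-β)) * ν (G k)) ?_ ?_
  · exact ENNReal.mul_pos (by simp; positivity) hk.ne'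
  refine le_iSup₂_of_le (R / 4) (by positivity) ?_
  refine le_iInf fun c => le_iInf fun hcov => le_iInf fun hd => ?_
  have hpiece : ∀ i, ν (c i ∩ G k) ≤ ENNReal.ofReal (2 ^ β) * qdiam q (c i) ^ β := by
    intro i
    rcases (c i ∩ G k).eq_empty_or_nonempty with h1 | ⟨x, hx, hxG⟩
    · rw [h1]; simp
    have hfin : qdiam q (c i) ≠ ∞ := ne_top_of_le_ne_top ENNReal.ofReal_ne_top (hd i)
    set d := (qdiam q (c i)).toReal with hdd
    have hd0 : 0 ≤ d := ENNReal.toReal_nonneg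
    have hdR : d ≤ R / 4 := ENNReal.toReal_le_of_le_ofReal (by positivity) (hd i)
    have hsub : ∀ r, d < r → c i ⊆ qball q x r := by
      intro r hr y hy
      refine lt_of_le_of_lt ?_ hr
      have : ENNReal.ofReal (q x y) ≤ qdiam q (c i) :=
        le_iSup₂_of_le x hx (le_iSup₂_of_le y hy le_rfl)
      exact (ENNReal.ofReal_le_iff_le_toReal hfin).1 this
    have e : ENNReal.ofReal (2 ^ β) * qdiam q (c i) ^ β = ENNReal.ofReal ((2 * d) ^ β) := by
      rw [← ENNReal.ofReal_toReal hfin, ENNReal.ofReal_rpow_of_nonneg hd0 h0.le,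
        ← ENNReal.ofReal_mul (by positivity), Real.mul_rpow (by norm_num) hd0]
    rw [e]
    rcases hd0.eq_or_lt with h1 | h1
    · rw [← h1, mul_zero, Real.zero_rpow h0.ne', ENNReal.ofReal_zero]
      have hlim : Tendsto (fun r : ℝ => ENNReal.ofReal (r ^ β)) (𝓝[>] 0) (𝓝 0) := by
        rw [← ENNReal.ofReal_zero]
        apply ENNReal.tendsto_ofReal
        have := (Real.continuousAt_rpow_const 0 β (Or.inr h0.le)).tendsto
        rw [Real.zero_rpow h0.ne'] at this
        exact this.mono_left nhdsWithin_le_nhds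
      refine ge_of_tendsto hlim ?_
      filter_upwards [Ioo_mem_nhdsGT hR0] with r hr
      refine le_trans (measure_mono ?_) (hxG.2 r hr.1 hr.2)
      exact inter_subset_left.trans (hsub r (by rw [← h1]; exact hr.1))
    · refine le_trans (measure_mono ?_) (hxG.2 (2 * d) (by linarith) (by linarith))
      exact inter_subset_left.trans (hsub _ (by linarith))
  calc ENNReal.ofReal (2 ^ (-β)) * ν (G k)
      ≤ ENNReal.ofReal (2 ^ (-β)) * ∑' i, ν (c i ∩ G k) := by
        gcongr
        refine le_trans (measure_mono ?_) (measure_iUnion_le _)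
        intro x hx
        obtain ⟨i, hi⟩ := mem_iUnion.1 (hcov hx.1)
        exact mem_iUnion.2 ⟨i, hi, hx⟩
    _ ≤ ENNReal.ofReal (2 ^ (-β)) * ∑' i, (ENNReal.ofReal (2 ^ β) * qdiam q (c i) ^ β) := by
        gcongr with i; exact hpiece i
    _ = _ := by
        rw [ENNReal.tsum_mul_left, ← mul_assoc, ← ENNReal.ofReal_mul (by positivity),
          ← Real.rpow_add (by norm_num)]
        simp

lemma pack_cover [IsProbabilityMeasure ν] {κ : ℝ} (hq : QM q κ)
    (hmeas : ∀ ξ r, MeasurableSet (qball q ξ r)) {F : Set A} {r t : ℝ} (hr : 0 < r) (ht : 0 < t)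
    (hF : ∀ ξ ∈ F, ENNReal.ofReal t ≤ ν (qball q ξ r)) :
    ∃ S : Finset (Set A), (S.card : ℝ) ≤ 1 / t ∧ (∀ x ∈ F, ∃ s ∈ S, x ∈ s) ∧
      ∀ s ∈ S, ∀ x ∈ s, ∀ y ∈ s, q x y ≤ 4 * κ ^ 4 * r := by
  have hκ := hq.one_le
  let good : Finset A → Prop := fun S => (∀ x ∈ S, x ∈ F) ∧
    (S : Set A).PairwiseDisjoint (fun x => qball q x r)
  have hcard : ∀ S, good S → (S.card : ℝ) ≤ 1 / t := by
    rintro S ⟨h1, h2⟩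
    rw [le_div_iff₀ ht]
    have h3 : ENNReal.ofReal (S.card * t) ≤ 1 := by
      calc ENNReal.ofReal (S.card * t) = ∑ x ∈ S, ENNReal.ofReal t := by
            rw [Finset.sum_const, nsmul_eq_mul, ENNReal.ofReal_mul (by positivity)]; simp
        _ ≤ ∑ x ∈ S, ν (qball q x r) := Finset.sum_le_sum fun x hx => hF x (h1 x hx)
        _ = ν (⋃ x ∈ S, qball q x r) := (measure_biUnion_finset h2 fun x _ => hmeas x r).symm
        _ ≤ 1 := prob_le_one
    rwa [ENNReal.ofReal_le_one] at h3
  have hex : ∃ n : ℕ, ∃ S, good S ∧ S.card = n := ⟨0, ∅, ⟨by simp, by simp⟩, rfl⟩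
  let B := ⌊1 / t⌋₊
  have hB : ∀ n, (∃ S, good S ∧ S.card = n) → n ≤ B := by
    rintro n ⟨S, hS, rfl⟩
    exact Nat.le_floor (hcard S hS)
  obtain ⟨S, hS, hmax⟩ : ∃ S, good S ∧ ∀ S', good S' → S'.card ≤ S.card := by
    have hs := Nat.findGreatest_spec (P := fun n => ∃ S, good S ∧ S.card = n) (Nat.zero_le B)
      ⟨∅, ⟨by simp, by simp⟩, rfl⟩
    obtain ⟨S, hS, hc⟩ := hs
    refine ⟨S, hS, fun S' hS' => ?_⟩
    rw [hc]
    exact Nat.le_findGreatest (hB _ ⟨S', hS', rfl⟩) ⟨S', hS', rfl⟩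
  refine ⟨S.image fun s => {x | q s x ≤ 2 * κ ^ 2 * r}, ?_, ?_, ?_⟩
  · exact le_trans (by exact_mod_cast Finset.card_image_le) (hcard S hS)
  · intro ξ hξ
    by_contra hcon
    simp only [Finset.mem_image, exists_exists_and_eq_and, not_exists, not_and] at hcon
    have hdis : ∀ s ∈ S, Disjoint (qball q ξ r) (qball q s r) := by
      intro s hs
      rw [Set.disjoint_left]
      intro z hz1 hz2
      apply hcon s hs
      have a1 : q z ξ ≤ κ * r := hq.symm _ _ _ hz1
      have a2 : q z ξ < 2 * κ * r := by nlinarith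
      have a3 : q s z < 2 * κ * r := lt_of_lt_of_le hz2 (by nlinarith)
      have := hq.tri _ _ _ _ a3 a2
      show q s ξ ≤ _
      nlinarith
    have hξS : ξ ∉ S := by
      intro hmem
      have := hdis ξ hmem
      rw [disjoint_self] at this
      have h2 : ξ ∈ qball q ξ r := by show q ξ ξ < r; rw [hq.self]; exact hr
      rw [this] at h2
      exact h2
    have hgood : good (insert ξ S) := by
      refine ⟨?_, ?_⟩
      · intro x hx
        rcases Finset.mem_insert.1 hx with rfl | hx
        · exact hξ
        · exact hS.1 x hx
      · rw [Finset.coe_insert]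
        exact hS.2.insert fun s hs _ => hdis s hs
    have := hmax _ hgood
    rw [Finset.card_insert_of_notMem hξS] at this
    omega
  · intro s hs x hx y hy
    obtain ⟨p, hp, rfl⟩ := Finset.mem_image.1 hs
    have hx : q p x ≤ 2 * κ ^ 2 * r := hx
    have hy : q p y ≤ 2 * κ ^ 2 * r := hy
    have hκ2 : 1 ≤ κ ^ 2 := one_le_pow₀ hκ
    have hκ3 : 0 < κ ^ 2 * r := by positivity
    have a1 : q p x < 3 * κ ^ 2 * r := by nlinarith
    have a2 : q x p ≤ κ * (3 * κ ^ 2 * r) := hq.symm _ _ _ a1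
    have hk3 : κ ^ 2 * r ≤ κ ^ 3 * r := by
      have : κ ^ 2 ≤ κ ^ 3 := pow_le_pow_right₀ hκ (by norm_num)
      gcongr
    have a3 : q x p < 4 * κ ^ 3 * r := by
      have : κ * (3 * κ ^ 2 * r) = 3 * (κ ^ 3 * r) := by ring
      linarith
    have a4 : q p y < 4 * κ ^ 3 * r := by nlinarith
    have := hq.tri _ _ _ _ a3 a4
    calc _ ≤ _ := this
      _ = _ := by ring

theorem ExactDim.hasDim [IsProbabilityMeasure ν] {κ : ℝ} (hq : QM q κ)
    (hmeas : ∀ ξ r, MeasurableSet (qball q ξ r)) (hc : CoverBdd q) {D : ℝ}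
    (h : ExactDim q ν D) : HasDim q ν D := by
  have hD : 0 ≤ D := by
    obtain ⟨ξ, hξ⟩ := h.exists
    refine ge_of_tendsto hξ ?_
    filter_upwards [Ioo_mem_nhdsGT (one_pos : (0:ℝ) < 1)] with r hr
    apply div_nonneg_of_nonpos
    · exact Real.log_nonpos ENNReal.toReal_nonneg (ENNReal.toReal_le_of_le_ofReal zero_le_one (by simpa using prob_le_one))
    · exact (Real.log_neg hr.1 hr.2).le
  have hae : ∀ᵐ ξ ∂ν, Tendsto (fun r : ℝ => Real.log (ν (qball q ξ r)).toReal / Real.log r)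
    (nhdsWithin 0 (Set.Ioi 0)) (nhds D) ∧ ∀ r, 0 < r → 0 < ν (qball q ξ r) :=
    h.and (pos_balls hc)
  let E : Set A := (toMeasurable ν {ξ | ¬ (Tendsto (fun r : ℝ => Real.log (ν (qball q ξ r)).toReal / Real.log r)
    (nhdsWithin 0 (Set.Ioi 0)) (nhds D) ∧ ∀ r, 0 < r → 0 < ν (qball q ξ r))})ᶜ
  have hEm : MeasurableSet E := (measurableSet_toMeasurable _ _).compl
  have hE0 : ν Eᶜ = 0 := by
    simp only [E, compl_compl]
    rw [measure_toMeasurable]; exact hae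
  have hE1 : 0 < ν E := by
    rw [pos_iff_ne_zero]
    intro h0
    have := measure_union_le (μ := ν) E Eᶜ
    rw [union_compl_self, h0, hE0, measure_univ] at this
    simp at this
  have hEg : ∀ ξ ∈ E, Tendsto (fun r : ℝ => Real.log (ν (qball q ξ r)).toReal / Real.log r)
    (nhdsWithin 0 (Set.Ioi 0)) (nhds D) ∧ ∀ r, 0 < r → 0 < ν (qball q ξ r) := by
    intro ξ hξ
    by_contra hcon
    exact hξ (subset_toMeasurable ν _ hcon)
  have hEdim : qdimSet q E ≤ D := by
    refine csSup_le ⟨0, zero_mem_dim E⟩ ?_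
    rintro α ⟨hα0, hα⟩
    by_contra hcon
    push Not at hcon
    refine hα.ne' (qHMeasure_eq_zero fun Δ hΔ => ?_)
    have hαp : 0 < α := hD.trans_lt hcon
    obtain ⟨β, hβ1, hβ2⟩ := exists_between hcon
    let G : ℕ → Set A := fun k => {ξ | ∀ r, 0 < r → r < 1 / ((k:ℝ) + 1) → ENNReal.ofReal (r ^ β) ≤ ν (qball q ξ r)}
    refine content_zero_iUnion hαp (F := G) ?_ fun k => ?_
    · intro ξ hξ
      obtain ⟨k, hk⟩ := large_ball_bounds (hEg ξ hξ).1 (hEg ξ hξ).2 hβ1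
      exact mem_iUnion.2 ⟨k, hk⟩
    · have hκ : 0 < κ := by linarith [hq.one_le]
      refine content_zero_of_covers (b := 4 * κ ^ 4) (C := 1) hαp (by positivity) hβ2 zero_le_one ?_ hΔ
      have hlim : Tendsto (fun n : ℕ => Real.exp (-(n:ℝ))) atTop (𝓝 0) := 
        Real.tendsto_exp_neg_atTop_nhds_zero.comp tendsto_natCast_atTop_atTop
      filter_upwards [hlim.eventually_lt_const (show (0:ℝ) < 1 / ((k:ℝ) + 1) by positivity)] with n hn
      obtain ⟨S, h1, h2, h3⟩ := pack_cover (ν := ν) hq hmeas (F := G k) (Real.exp_pos (-(n:ℝ)))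
        (Real.rpow_pos_of_pos (Real.exp_pos (-(n:ℝ))) β) fun ξ hξ => hξ _ (Real.exp_pos _) hn
      refine ⟨S, h1.trans (le_of_eq ?_), h2, h3⟩
      rw [← Real.exp_mul, one_div, ← Real.exp_neg, one_mul]
      congr 1; ring
  have hlb : ∀ E' : Set A, 0 < ν E' → D ≤ qdimSet q E' := fun E' hE' => dim_lower hc hq.nonneg hD h hE'
  have hEeq : qdimSet q E = D := le_antisymm hEdim (hlb E hE1)
  constructor
  · refine le_antisymm (csInf_le ⟨D, ?_⟩ ⟨E, hEm, hE0, hEeq.symm⟩) (le_csInf ⟨D, E, hEm, hE0, hEeq.symm⟩ ?_)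
    all_goals
      rintro d ⟨E', hE'm, hE', rfl⟩
      refine hlb E' ?_
      rw [pos_iff_ne_zero]
      intro h0
      have := measure_union_le (μ := ν) E' E'ᶜ
      rw [union_compl_self, h0, hE', measure_univ] at this
      simp at this
  · refine le_antisymm (csInf_le ⟨D, ?_⟩ ⟨E, hEm, hE1, hEeq.symm⟩) (le_csInf ⟨D, E, hEm, hE1, hEeq.symm⟩ ?_)
    all_goals
      rintro d ⟨E', hE'm, hE', rfl⟩
      exact hlb E' hE'

end Dim

/-! ### Part 7: disintegrations and the abstract counting lemmas -/

section Dis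
variable {B C : Type*} [MeasurableSpace B] [MeasurableSpace C] {ν : Measure B} {f : B → C}
  {Q : Measure C} {κ : C → Measure B}

lemma dis_aem [IsProbabilityMeasure ν] (hf : Measurable f) (hd : IsDisintegration ν f Q κ) {S : Set B}
    (hS : MeasurableSet S) : AEMeasurable (fun c => κ c S) Q := by
  obtain ⟨hQ, hpr, -, hIntg⟩ := hd
  obtain ⟨g, hg, hgle, hgi⟩ := exists_measurable_le_lintegral_eq Q (fun c => κ c S)
  obtain ⟨g', hg', hgle', hgi'⟩ := exists_measurable_le_lintegral_eq Q (fun c => κ c Sᶜ)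
  have hQp : IsProbabilityMeasure Q := by
    rw [hQ]; exact Measure.isProbabilityMeasure_map hf.aemeasurable
  have h1 : ∫⁻ c, (g c + g' c) ∂Q = 1 := by
    rw [lintegral_add_left hg, ← hgi, ← hgi', ← hIntg S hS, ← hIntg _ hS.compl,
      measure_add_measure_compl hS, measure_univ]
  have h2 : ∀ᵐ c ∂Q, g c + g' c ≤ 1 := by
    filter_upwards [hpr] with c hc
    calc g c + g' c ≤ κ c S + κ c Sᶜ := add_le_add (hgle c) (hgle' c)
      _ = 1 := by rw [measure_add_measure_compl hS, measure_univ]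
  have h3 : (fun c => g c + g' c) =ᵐ[Q] fun _ => 1 := by
    apply ae_eq_of_ae_le_of_lintegral_le h2 (by rw [h1]; simp) aemeasurable_const
    rw [h1]; simp
  refine ⟨g, hg, ?_⟩
  filter_upwards [h3, hpr] with c hc hp
  have e1 : κ c S + κ c Sᶜ = 1 := by rw [measure_add_measure_compl hS, measure_univ]
  apply le_antisymm _ (hgle c)
  by_contra hlt
  push Not at hlt
  have h4 : g c + g' c < κ c S + κ c Sᶜ :=
    ENNReal.add_lt_add_of_lt_of_le (ne_top_of_le_ne_top (measure_ne_top (κ c) Sᶜ) (hgle' c)) hlt (hgle' c)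
  rw [e1, hc] at h4
  exact lt_irrefl _ h4

lemma dis_set [IsProbabilityMeasure ν] (hf : Measurable f) (hsing : ∀ c : C, MeasurableSet ({c} : Set C))
    (hd : IsDisintegration ν f Q κ) {S : Set B}
    (hS : MeasurableSet S) {E : Set C} (hE : MeasurableSet E) :
    ν (S ∩ f ⁻¹' E) = ∫⁻ c in E, κ c S ∂Q := by
  obtain ⟨hQ, hpr, hfib, hIntg⟩ := hd
  rw [hIntg _ (hS.inter (hf hE)), ← lintegral_indicator hE]
  apply lintegral_congr_ae
  filter_upwards [hpr, hfib] with c hp hc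
  have h0 : κ c (f ⁻¹' {c})ᶜ = 0 := by
    rw [prob_compl_eq_zero_iff (hf (hsing c))]; exact hc
  by_cases hcE : c ∈ E
  · rw [Set.indicator_of_mem hcE]
    apply le_antisymm (measure_mono inter_subset_left)
    calc κ c S ≤ κ c ((S ∩ f ⁻¹' E) ∪ (f ⁻¹' {c})ᶜ) := by
          apply measure_mono
          intro x hx
          by_cases hfx : f x = c
          · left; exact ⟨hx, by rw [Set.mem_preimage, hfx]; exact hcE⟩
          · right; exact hfx
      _ ≤ _ := measure_union_le _ _
      _ = _ := by rw [h0, add_zero]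
  · rw [Set.indicator_of_notMem hcE]
    apply measure_mono_null _ h0
    intro x hx
    have h3 : f x ∈ E := hx.2
    intro hfx
    have h4 : f x = c := hfx
    rw [h4] at h3
    exact hcE h3

lemma dis_ae [IsProbabilityMeasure ν] (hf : Measurable f)
    (hd : IsDisintegration ν f Q κ) {p : B → Prop} (h : ∀ᵐ x ∂ν, p x) :
    ∀ᵐ c ∂Q, ∀ᵐ x ∂(κ c), p x := by
  set N := toMeasurable ν {x | ¬ p x}
  have hN : ν N = 0 := by rw [measure_toMeasurable]; exact h
  have hNm : MeasurableSet N := measurableSet_toMeasurable _ _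
  have h1 := hd.2.2.2 N hNm
  rw [hN, eq_comm, lintegral_eq_zero_iff' (dis_aem hf hd hNm)] at h1
  filter_upwards [h1] with c hc
  exact measure_mono_null (subset_toMeasurable _ _) hc

end Dis

section Counting
variable {Ω I B C : Type*} [MeasurableSpace Ω] [MeasurableSpace B] [MeasurableSpace C] [Countable I]
  {P : Measure Ω} {Q : Measure C} {Z : Ω → I} {c : Ω → C} {W k : I → C → ℝ≥0∞}

lemma mult_sum [IsProbabilityMeasure P] {b : Ω → B} (hb : Measurable b) {S : I → Set B} (hS : ∀ z, MeasurableSet (S z))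
    {N : ℝ≥0∞} (hN : ∀ β, ((({z | β ∈ S z} : Set I).encard : ℕ∞) : ℝ≥0∞) ≤ N) :
    ∑' z, P (b ⁻¹' S z) ≤ N := by
  have h1 : ∀ z, P (b ⁻¹' S z) = ∫⁻ ω, (b ⁻¹' S z).indicator 1 ω ∂P := fun z => by
    rw [lintegral_indicator_one (hb (hS z))]
  simp_rw [h1]
  rw [← lintegral_tsum fun z => (measurable_one.indicator (hb (hS z))).aemeasurable]
  calc _ ≤ ∫⁻ ω, N ∂P := by
        apply lintegral_mono
        intro ω
        refine le_trans (le_of_eq ?_) (hN (b ω))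
        have e : ∀ z, (b ⁻¹' S z).indicator (1 : Ω → ℝ≥0∞) ω = ({z | b ω ∈ S z} : Set I).indicator (fun _ => 1) z := by
          intro z
          simp [Set.indicator]
        simp_rw [e]
        rw [← tsum_subtype]
        simp [ENNReal.tsum_one]
    _ = N := by simp

lemma lemU (hc : Measurable c) (hWm : ∀ z, Measurable (W z)) (hkm : ∀ z, Measurable (k z))
    (hW : ∀ z E, MeasurableSet E → P ({ω | Z ω = z} ∩ c ⁻¹' E) = ∫⁻ x in E, W z x ∂Q)
    {N K L : ℝ≥0∞} (hN : ∑' z, ∫⁻ x, k z x ∂Q ≤ N) :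
    L * P {ω | L < k (Z ω) (c ω) ∧ W (Z ω) (c ω) ≤ K} ≤ K * N := by
  set E : I → Set C := fun z => {x | L < k z x ∧ W z x ≤ K}
  have hE : ∀ z, MeasurableSet (E z) := fun z =>
    (measurableSet_lt measurable_const (hkm z)).inter (measurableSet_le (hWm z) measurable_const)
  have h1 : {ω | L < k (Z ω) (c ω) ∧ W (Z ω) (c ω) ≤ K} ⊆ ⋃ z, ({ω | Z ω = z} ∩ c ⁻¹' E z) := by
    intro ω hω
    exact Set.mem_iUnion.2 ⟨Z ω, rfl, hω⟩
  calc _ ≤ L * ∑' z, P ({ω | Z ω = z} ∩ c ⁻¹' E z) := by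
        gcongr
        exact (measure_mono h1).trans (measure_iUnion_le _)
    _ = ∑' z, L * ∫⁻ x in E z, W z x ∂Q := by
        rw [ENNReal.tsum_mul_left]; congr 2; ext z; rw [hW z _ (hE z)]
    _ ≤ ∑' z, K * ∫⁻ x, k z x ∂Q := by
        apply ENNReal.tsum_le_tsum
        intro z
        rw [← lintegral_const_mul _ (hWm z), ← lintegral_const_mul _ (hkm z)]
        calc _ ≤ ∫⁻ x in E z, K * k z x ∂Q := by
              apply setLIntegral_mono ((hkm z).const_mul _)
              intro x hx
              rw [mul_comm]
              exact mul_le_mul' hx.2 hx.1.le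
          _ ≤ _ := setLIntegral_le_lintegral _ _
    _ ≤ _ := by
        rw [ENNReal.tsum_mul_left]; gcongr

lemma sum_W [IsProbabilityMeasure P] (hZ : ∀ z, MeasurableSet {ω | Z ω = z})
    (hW : ∀ z E, MeasurableSet E → P ({ω | Z ω = z} ∩ c ⁻¹' E) = ∫⁻ x in E, W z x ∂Q) :
    ∑' z, ∫⁻ x, W z x ∂Q = 1 := by
  have : ∀ z, ∫⁻ x, W z x ∂Q = P {ω | Z ω = z} := fun z => by
    have := hW z univ MeasurableSet.univ
    simpa using this.symm
  simp_rw [this]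
  rw [← measure_iUnion _ hZ]
  · have : ⋃ z, {ω | Z ω = z} = univ := by ext; simp
    rw [this, measure_univ]
  · intro z z' hzz
    rw [Function.onFun, Set.disjoint_left]
    intro ω h1 h2
    exact hzz (h1.symm.trans h2)

lemma lemL [IsProbabilityMeasure P] (hZ : ∀ z, MeasurableSet {ω | Z ω = z}) (hc : Measurable c)
    (hWm : ∀ z, Measurable (W z)) (hkm : ∀ z, Measurable (k z))
    (hW : ∀ z E, MeasurableSet E → P ({ω | Z ω = z} ∩ c ⁻¹' E) = ∫⁻ x in E, W z x ∂Q)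
    {b : Ω → B} {S : I → Set B} {A : Set Ω}
    (hk : ∀ z E, MeasurableSet E → P (b ⁻¹' S z ∩ c ⁻¹' E) = ∫⁻ x in E, k z x ∂Q)
    (hA : ∀ ω ∈ A, b ω ∈ S (Z ω)) (t : ℝ≥0∞) :
    P (A ∩ {ω | k (Z ω) (c ω) < t * W (Z ω) (c ω)}) ≤ t := by
  set E : I → Set C := fun z => {x | k z x < t * W z x}
  have hE : ∀ z, MeasurableSet (E z) := fun z =>
    measurableSet_lt (hkm z) ((hWm z).const_mul _)
  have h1 : A ∩ {ω | k (Z ω) (c ω) < t * W (Z ω) (c ω)} ⊆ ⋃ z, (b ⁻¹' S z ∩ c ⁻¹' E z) := by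
    intro ω hω
    exact Set.mem_iUnion.2 ⟨Z ω, hA ω hω.1, hω.2⟩
  calc _ ≤ ∑' z, P (b ⁻¹' S z ∩ c ⁻¹' E z) := (measure_mono h1).trans (measure_iUnion_le _)
    _ = ∑' z, ∫⁻ x in E z, k z x ∂Q := by
        congr 1; ext z; rw [hk z _ (hE z)]
    _ ≤ ∑' z, t * ∫⁻ x, W z x ∂Q := by
        apply ENNReal.tsum_le_tsum
        intro z
        rw [← lintegral_const_mul _ (hWm z)]
        calc _ ≤ ∫⁻ x in E z, t * W z x ∂Q := by
              apply setLIntegral_mono ((hWm z).const_mul _)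
              intro x hx
              exact hx.le
          _ ≤ _ := setLIntegral_le_lintegral _ _
    _ = t := by
        rw [ENNReal.tsum_mul_left, sum_W hZ hW, mul_one]

lemma lemM [IsProbabilityMeasure P] (hQ : Q = P.map c) (hc : Measurable c)
    (hWm : ∀ z, Measurable (W z))
    (hW : ∀ z E, MeasurableSet E → P ({ω | Z ω = z} ∩ c ⁻¹' E) = ∫⁻ x in E, W z x ∂Q)
    {S : I → Set C} (hS : ∀ z, MeasurableSet (S z)) {A : Set Ω}
    (hA : ∀ ω ∈ A, c ω ∈ S (Z ω)) {N : ℝ≥0∞} (hN : ∑' z, P (c ⁻¹' S z) ≤ N) (t : ℝ≥0∞) :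
    P (A ∩ {ω | W (Z ω) (c ω) < t}) ≤ t * N := by
  set E : I → Set C := fun z => S z ∩ {x | W z x < t}
  have hE : ∀ z, MeasurableSet (E z) := fun z => (hS z).inter
    (measurableSet_lt (hWm z) measurable_const)
  have h1 : A ∩ {ω | W (Z ω) (c ω) < t} ⊆ ⋃ z, ({ω | Z ω = z} ∩ c ⁻¹' E z) := by
    intro ω hω
    exact Set.mem_iUnion.2 ⟨Z ω, rfl, hA ω hω.1, hω.2⟩
  calc _ ≤ ∑' z, P ({ω | Z ω = z} ∩ c ⁻¹' E z) := (measure_mono h1).trans (measure_iUnion_le _)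
    _ = ∑' z, ∫⁻ x in E z, W z x ∂Q := by
        congr 1; ext z; rw [hW z _ (hE z)]
    _ ≤ ∑' z, t * P (c ⁻¹' S z) := by
        apply ENNReal.tsum_le_tsum
        intro z
        calc _ ≤ ∫⁻ x in E z, t ∂Q := by
              apply setLIntegral_mono measurable_const
              intro x hx
              exact hx.2.le
          _ = t * Q (E z) := by simp
          _ ≤ t * Q (S z) := by gcongr; exact inter_subset_left
          _ = _ := by rw [hQ, Measure.map_apply hc (hS z)]
    _ ≤ _ := by
        rw [ENNReal.tsum_mul_left]; gcongr

end Counting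

/-! ### Part 8: the master lemma on local dimensions -/

lemma interp {F : ℝ → ℝ≥0∞} (hF : Monotone F) (hF1 : ∀ r, F r ≤ 1) {s a V : ℝ} (hs : 0 < s) (hV : 0 < V)
    (hup : ∀ j : ℕ, ∀ᶠ n : ℕ in atTop, F (Real.exp (-(s * n))) ≤
      ENNReal.ofReal (Real.exp (-((a - V / (j + 1)) * n))))
    (hlo : ∀ j : ℕ, ∀ᶠ n : ℕ in atTop, ENNReal.ofReal (Real.exp (-((a + V / (j + 1)) * n))) ≤
      F (Real.exp (-((s - 3 / (j + 1)) * n)))) :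
    Tendsto (fun r : ℝ => Real.log (F r).toReal / Real.log r) (𝓝[>] 0) (𝓝 (a / s)) := by
  set g : ℝ → ℝ := fun x => -Real.log (F (Real.exp (-x))).toReal with hg
  have hfin : ∀ r, F r ≠ ∞ := fun r => ne_top_of_le_ne_top ENNReal.one_ne_top (hF1 r)
  have hpos : ∀ r, 0 < r → 0 < (F r).toReal := by
    intro r hr
    obtain ⟨j, hj⟩ : ∃ j : ℕ, 3 / ((j:ℝ) + 1) < s := by
      obtain ⟨j, hj⟩ := exists_nat_gt (3 / s)
      refine ⟨j, ?_⟩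
      rw [div_lt_iff₀ hs] at hj
      rw [div_lt_iff₀ (by positivity)]
      nlinarith
    have h1 : Tendsto (fun n : ℕ => Real.exp (-((s - 3 / ((j:ℝ) + 1)) * n))) atTop (𝓝 0) := by
      apply Real.tendsto_exp_neg_atTop_nhds_zero.comp
      exact tendsto_natCast_atTop_atTop.const_mul_atTop (by linarith)
    obtain ⟨n, h2, h3⟩ := ((hlo j).and (h1.eventually_lt_const hr)).exists
    apply ENNReal.toReal_pos _ (hfin r)
    have h4 := h2.trans (hF h3.le)
    intro h0
    rw [h0] at h4
    have : 0 < ENNReal.ofReal (Real.exp (-((a + V / ((j:ℝ) + 1)) * n))) := by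
      rw [ENNReal.ofReal_pos]; positivity
    exact absurd h4 (not_le.2 this)
  have hgm : Monotone g := by
    intro x y hxy
    simp only [hg]
    apply neg_le_neg
    apply Real.log_le_log (hpos _ (Real.exp_pos _))
    exact ENNReal.toReal_mono (hfin _) (hF (Real.exp_le_exp.2 (by linarith)))
  have hup' : ∀ j : ℕ, ∀ᶠ n : ℕ in atTop, (a - V / (j + 1)) * n ≤ g (s * n) := by
    intro j
    filter_upwards [hup j] with n hn
    simp only [hg]
    have := ENNReal.toReal_mono ENNReal.ofReal_ne_top hn
    rw [ENNReal.toReal_ofReal (Real.exp_pos _).le] at this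
    have h2 := Real.log_le_log (hpos _ (Real.exp_pos _)) this
    rw [Real.log_exp] at h2
    linarith
  have hlo' : ∀ j : ℕ, ∀ᶠ n : ℕ in atTop, g ((s - 3 / (j + 1)) * n) ≤ (a + V / (j + 1)) * n := by
    intro j
    filter_upwards [hlo j] with n hn
    simp only [hg]
    have := ENNReal.toReal_mono (hfin _) hn
    rw [ENNReal.toReal_ofReal (Real.exp_pos _).le] at this
    have h2 := Real.log_le_log (Real.exp_pos _) this
    rw [Real.log_exp] at h2
    linarith
  have hinv : Tendsto (fun j : ℕ => 1 / ((j:ℝ) + 1)) atTop (𝓝 0) := tendsto_one_div_add_atTop_nhds_zero_nat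
  have key : Tendsto (fun x : ℝ => g x / x) atTop (𝓝 (a / s)) := by
    rw [tendsto_order]
    constructor
    · intro y hy
      -- lower bound of g
      have h1 : Tendsto (fun j : ℕ => (a - V * (1 / ((j:ℝ) + 1))) / s) atTop (𝓝 ((a - V * 0) / s)) :=
        (((hinv.const_mul V).const_sub a).div_const s)
      rw [mul_zero, sub_zero] at h1
      obtain ⟨j, hj⟩ := (h1.eventually_const_lt hy).exists
      have hj' : y < (a - V / ((j:ℝ)+1)) / s := by
        have e : V * (1 / ((j:ℝ) + 1)) = V / ((j:ℝ)+1) := by ring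
        rwa [e] at hj
      set c := a - V / ((j:ℝ)+1)
      obtain ⟨N, hN⟩ := eventually_atTop.1 (hup' j)
      have hgap : 0 < c / s - y := by linarith
      filter_upwards [eventually_gt_atTop 0, eventually_ge_atTop (s * (N+1)), eventually_gt_atTop (|c| / (c / s - y))]
        with x hx0 hxN hxc
      set n := ⌊x / s⌋₊
      have hn1 : (n:ℝ) ≤ x / s := Nat.floor_le (by positivity)
      have hn2 : x / s < n + 1 := Nat.lt_floor_add_one _
      have hnN : N ≤ n := by
        apply Nat.le_floor
        rw [le_div_iff₀ hs]; nlinarith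
      have h3 := hN n hnN
      have h4 : g (s * n) ≤ g x := hgm (by rw [le_div_iff₀ hs] at hn1; linarith)
      rw [lt_div_iff₀ hx0]
      have h5 : c * (x / s) - |c| ≤ c * n := by
        have : c * (x / s - n) ≤ |c| := by
          calc c * (x / s - n) ≤ |c| * (x / s - n) := mul_le_mul_of_nonneg_right (le_abs_self c) (by linarith)
            _ ≤ |c| * 1 := by gcongr; linarith
            _ = |c| := mul_one _
        linarith
      have h6 : |c| < x * (c / s - y) := by rwa [div_lt_iff₀ hgap] at hxc
      have e : c * (x / s) = x * (c / s) := by ring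
      linarith
    · intro y hy
      have h1 : Tendsto (fun j : ℕ => (a + V * (1 / ((j:ℝ) + 1))) / (s - 3 * (1 / ((j:ℝ) + 1)))) atTop
          (𝓝 ((a + V * 0) / (s - 3 * 0))) :=
        (((hinv.const_mul V).const_add a).div ((hinv.const_mul 3).const_sub s) (by simp; exact hs.ne'))
      rw [mul_zero, mul_zero, sub_zero, add_zero] at h1
      have h2 : Tendsto (fun j : ℕ => s - 3 * (1 / ((j:ℝ) + 1))) atTop (𝓝 (s - 3 * 0)) :=
        (hinv.const_mul 3).const_sub s
      rw [mul_zero, sub_zero] at h2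
      obtain ⟨j, hj, hj2⟩ := ((h1.eventually_lt_const hy).and (h2.eventually_const_lt hs)).exists
      have e1 : V * (1 / ((j:ℝ) + 1)) = V / ((j:ℝ)+1) := by ring
      have e2 : 3 * (1 / ((j:ℝ) + 1)) = 3 / ((j:ℝ)+1) := by ring
      rw [e1, e2] at hj
      rw [e2] at hj2
      set c := a + V / ((j:ℝ)+1)
      set s' := s - 3 / ((j:ℝ)+1)
      obtain ⟨N, hN⟩ := eventually_atTop.1 (hlo' j)
      have hgap : 0 < y - c / s' := by linarith
      filter_upwards [eventually_gt_atTop 0, eventually_ge_atTop (s' * (N+1)), eventually_gt_atTop (|c| / (y - c / s'))]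
        with x hx0 hxN hxc
      set n := ⌈x / s'⌉₊
      have hn1 : x / s' ≤ n := Nat.le_ceil _
      have hn2 : (n:ℝ) < x / s' + 1 := Nat.ceil_lt_add_one (by positivity)
      have hnN : N ≤ n := by
        have : (N:ℝ) ≤ n := by
          refine le_trans ?_ hn1
          rw [le_div_iff₀ hj2]; nlinarith
        exact_mod_cast this
      have h3 := hN n hnN
      have h4 : g x ≤ g (s' * n) := hgm (by rw [div_le_iff₀ hj2] at hn1; linarith)
      rw [div_lt_iff₀ hx0]
      have h5 : c * n ≤ c * (x / s') + |c| := by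
        have : c * (n - x / s') ≤ |c| := by
          calc c * (n - x / s') ≤ |c| * (n - x / s') := mul_le_mul_of_nonneg_right (le_abs_self c) (by linarith)
            _ ≤ |c| * 1 := by gcongr; linarith
            _ = |c| := mul_one _
        linarith
      have h6 : |c| < x * (y - c / s') := by rwa [div_lt_iff₀ hgap] at hxc
      have e : c * (x / s') = x * (c / s') := by ring
      linarith
  have hlog : Tendsto (fun r : ℝ => -Real.log r) (𝓝[>] 0) atTop := tendsto_neg_atBot_atTop.comp Real.tendsto_log_nhdsGT_zero
  refine (key.comp hlog).congr' ?_
  filter_upwards [self_mem_nhdsWithin] with r hr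
  simp only [Function.comp, hg, neg_neg, Real.exp_log hr]
  rw [neg_div_neg_eq]

section Rep
variable {Ω I B : Type*} [MeasurableSpace B] {q : B → B → ℝ} {K0 : ℝ}

lemma rep_sets (hq : QM q K0) (hmeas : ∀ ξ r, MeasurableSet (qball q ξ r)) {Z : Ω → I} {b : Ω → B} {A : Set Ω}
    {r R : ℝ} (hr : 0 < r) (hR : 4 * K0 ^ 3 * r < R)
    (h1 : ∀ ω ∈ A, ∀ ω' ∈ A, Z ω = Z ω' → q (b ω) (b ω') < r) {N : ℝ≥0∞}
    (h2 : ∀ ω ∈ A, (((Z '' {ω' | ω' ∈ A ∧ q (b ω) (b ω') < R}).encard : ℕ∞) : ℝ≥0∞) ≤ N) :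
    ∃ S : I → Set B, (∀ z, MeasurableSet (S z)) ∧ (∀ ω ∈ A, b ω ∈ S (Z ω)) ∧
      (∀ ω ∈ A, qball q (b ω) r ⊆ S (Z ω)) ∧ (∀ ω ∈ A, S (Z ω) ⊆ qball q (b ω) R) ∧
      ∀ β, ((({z | β ∈ S z} : Set I).encard : ℕ∞) : ℝ≥0∞) ≤ N := by
  have hK := hq.one_le
  have hK2 : K0 ≤ K0 ^ 2 := by nlinarith
  have hK3 : K0 ^ 2 ≤ K0 ^ 3 := by nlinarith [sq_nonneg K0]
  set S : I → Set B := fun z => if h : ∃ ω ∈ A, Z ω = z then qball q (b h.choose) (2 * K0 * r) else ∅ with hS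
  have hrep : ∀ ω ∈ A, ∃ ω' ∈ A, Z ω' = Z ω ∧ S (Z ω) = qball q (b ω') (2 * K0 * r) := by
    intro ω hω
    have h : ∃ ω' ∈ A, Z ω' = Z ω := ⟨ω, hω, rfl⟩
    refine ⟨h.choose, h.choose_spec.1, h.choose_spec.2, ?_⟩
    simp only [hS]
    rw [dif_pos h]
  have hmem : ∀ z β, β ∈ S z → ∃ ω ∈ A, Z ω = z := by
    intro z β hβ
    by_contra h
    simp only [hS] at hβ
    rw [dif_neg h] at hβ
    exact hβ
  have hsub : ∀ ω ∈ A, qball q (b ω) r ⊆ S (Z ω) := by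
    intro ω hω x hx
    obtain ⟨ω', hω', hz, he⟩ := hrep ω hω
    rw [he]
    have := hq.tri _ _ _ _ (h1 ω' hω' ω hω hz) hx
    show q _ _ < _
    nlinarith
  refine ⟨S, fun z => ?_, fun ω hω => ?_, hsub, ?_, ?_⟩
  · simp only [hS]
    split_ifs
    · exact hmeas _ _
    · exact MeasurableSet.empty
  · apply hsub ω hω
    show q _ _ < _
    rw [hq.self]; exact hr
  · intro ω hω x hx
    obtain ⟨ω', hω', hz, he⟩ := hrep ω hω
    rw [he] at hx
    have h3 : q (b ω) (b ω') < 2 * K0 * r := (h1 ω hω ω' hω' hz.symm).trans_le (by nlinarith)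
    have := hq.tri _ _ _ _ h3 hx
    show q _ _ < _
    nlinarith
  · intro β
    by_cases hne : ∃ z, β ∈ S z
    · obtain ⟨z, hz⟩ := hne
      obtain ⟨ω, hω, rfl⟩ := hmem z β hz
      obtain ⟨ω0, hω0, hz0, he0⟩ := hrep ω hω
      refine le_trans ?_ (h2 ω0 hω0)
      have : {z | β ∈ S z} ⊆ Z '' {ω' | ω' ∈ A ∧ q (b ω0) (b ω') < R} := by
        intro z' hz'
        obtain ⟨ω', hω', rfl⟩ := hmem z' β hz'
        obtain ⟨ω1, hω1, hz1, he1⟩ := hrep ω' hω'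
        refine ⟨ω1, ⟨hω1, ?_⟩, hz1⟩
        rw [he0] at hz
        have hz'' : β ∈ qball q (b ω1) (2 * K0 * r) := by rw [← he1]; exact hz'
        have h3 := hq.symm _ _ _ hz''
        have h4 : q β (b ω1) < 4 * K0 ^ 2 * r := by
          have : 0 < K0 ^ 2 * r := by positivity
          nlinarith
        have h5 : q (b ω0) β < 4 * K0 ^ 2 * r := by
          have h6 : q (b ω0) β < 2 * K0 * r := hz
          nlinarith
        have := hq.tri _ _ _ _ h5 h4
        calc _ ≤ _ := this
          _ = 4 * K0 ^ 3 * r := by ring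
          _ < R := hR
      exact_mod_cast Set.encard_le_encard this
    · have : {z | β ∈ S z} = (∅ : Set I) := by
        ext z; simp only [Set.mem_ofPred_eq, Set.mem_empty_iff_false, iff_false]
        exact fun h => hne ⟨z, h⟩
      rw [this]; simp

end Rep
section Master
variable {Ω I B C : Type*} [MeasurableSpace Ω] [MeasurableSpace B] [MeasurableSpace C] [Countable I]
  {P : Measure Ω} {Q : Measure C} {ν : Measure B} {q : B → B → ℝ} {K0 : ℝ} {f : B → C} {κ : C → Measure B}
  {b : Ω → B}

lemma discr [IsProbabilityMeasure ν] (hq : QM q K0) (hmeas : ∀ ξ r, MeasurableSet (qball q ξ r))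
    (hcov : CoverBdd q) (hf : Measurable f) (hd : IsDisintegration ν f Q κ) {r : ℝ} (hr : 0 < r) :
    ∃ M : B → ℝ≥0∞, AEMeasurable M ν ∧ ∀ β, κ (f β) (qball q β r) ≤ M β ∧
      M β ≤ κ (f β) (qball q β (4 * K0 ^ 2 * r)) := by
  have hK := hq.one_le
  have hK2 : K0 ≤ K0 ^ 2 := by nlinarith
  obtain ⟨kk, -, hkk⟩ := hcov
  obtain ⟨n, hn⟩ : ∃ n : ℕ, Real.exp (-n) < r := by
    have h1 : Tendsto (fun n : ℕ => Real.exp (-(n:ℝ))) atTop (𝓝 0) :=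
      Real.tendsto_exp_neg_atTop_nhds_zero.comp tendsto_natCast_atTop_atTop
    exact (h1.eventually_lt_const hr).exists
  obtain ⟨F, -, hF1, hF2⟩ := hkk n
  have hB : Nonempty B := nonempty_of_isProbabilityMeasure ν
  set cen : Set B → B := fun s => if h : s.Nonempty then h.some else Classical.arbitrary B with hcen
  have hcen' : ∀ β, ∃ s ∈ F, q (cen s) β < r := by
    intro β
    obtain ⟨s, hs, hβ⟩ := hF1 β
    refine ⟨s, hs, ?_⟩
    have hne : s.Nonempty := ⟨β, hβ⟩
    simp only [hcen]
    rw [dif_pos hne]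
    exact (hF2 s hs _ hne.some_mem β hβ).trans_lt hn
  refine ⟨fun β => ⨆ s : F, (qball q (cen s) r).indicator (fun β => κ (f β) (qball q (cen s) (2 * K0 * r))) β,
    ?_, fun β => ⟨?_, ?_⟩⟩
  · apply AEMeasurable.iSup
    intro s
    apply AEMeasurable.indicator _ (hmeas _ _)
    have h1 := dis_aem hf hd (hmeas (cen s) (2 * K0 * r))
    rw [hd.1] at h1
    exact h1.comp_measurable hf
  · obtain ⟨s, hs, hβ⟩ := hcen' β
    refine le_trans ?_ (le_iSup (fun s : F => (qball q (cen s) r).indicator (fun β => κ (f β) (qball q (cen s) (2 * K0 * r))) β) ⟨s, hs⟩)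
    rw [Set.indicator_of_mem (show β ∈ qball q (cen s) r from hβ)]
    apply measure_mono
    intro x hx
    have := hq.tri _ _ _ _ hβ hx
    show q _ _ < _
    nlinarith
  · apply iSup_le
    intro s
    by_cases hβ : β ∈ qball q (cen s) r
    · rw [Set.indicator_of_mem hβ]
      apply measure_mono
      intro x hx
      have h1 := hq.symm _ _ _ hβ
      have h2 : q β (cen s) < 2 * K0 * r := by nlinarith
      have := hq.tri _ _ _ _ h2 hx
      show q _ _ < _
      have : 0 < K0 ^ 2 * r := by positivity
      nlinarith
    · rw [Set.indicator_of_notMem hβ]; exact zero_le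

/-- the input of the master lemma -/
def Model (P : Measure Ω) (b : Ω → B) (c : Ω → C) (q : B → B → ℝ) (Z : ℕ → Ω → I) (W : ℕ → I → C → ℝ≥0∞)
    (s a V : ℝ) : Prop :=
  ∀ ε : ℝ, 0 < ε → ∃ A : ℕ → Set Ω, (∀ᵐ ω ∂P, ∀ᶠ n in atTop, ω ∈ A n) ∧ ∀ᶠ n : ℕ in atTop,
    (∀ ω ∈ A n, ∀ ω' ∈ A n, Z n ω = Z n ω' → q (b ω) (b ω') < Real.exp (-((s - ε) * n))) ∧
    (∀ ω ∈ A n, (((Z n '' {ω' | ω' ∈ A n ∧ q (b ω) (b ω') < Real.exp (-((s - 2 * ε) * n))}).encard : ℕ∞) : ℝ≥0∞)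
      ≤ ENNReal.ofReal (Real.exp (V * ε * n))) ∧
    (∀ ω ∈ A n, ENNReal.ofReal (Real.exp (-((a + ε) * n))) ≤ W n (Z n ω) (c ω) ∧
      W n (Z n ω) (c ω) ≤ ENNReal.ofReal (Real.exp (-((a - ε) * n))))

lemma master1 [IsProbabilityMeasure P] [IsProbabilityMeasure ν] (hq : QM q K0)
    (hmeas : ∀ ξ r, MeasurableSet (qball q ξ r)) (hb : Measurable b) (hf : Measurable f)
    (hsing : ∀ c : C, MeasurableSet ({c} : Set C)) (hν : ν = P.map b) (hd : IsDisintegration ν f Q κ)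
    {Z : ℕ → Ω → I} (hZ : ∀ n z, MeasurableSet {ω | Z n ω = z}) {W : ℕ → I → C → ℝ≥0∞}
    (hWm : ∀ n z, Measurable (W n z))
    (hW : ∀ n z E, MeasurableSet E → P ({ω | Z n ω = z} ∩ (f ∘ b) ⁻¹' E) = ∫⁻ x in E, W n z x ∂Q)
    {s a V : ℝ} (hs : 0 < s) (hV : 0 < V) (hmod : Model P b (f ∘ b) q Z W s a V) {ε : ℝ} (hε : 0 < ε) :
    ∀ᵐ ω ∂P, ∀ᶠ n : ℕ in atTop,
      κ (f (b ω)) (qball q (b ω) (Real.exp (-((s - ε) * n)))) ≤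
        ENNReal.ofReal (Real.exp (-((a - (V + 2) * ε) * n))) ∧
      ENNReal.ofReal (Real.exp (-((a + (V + 2) * ε) * n))) ≤
        κ (f (b ω)) (qball q (b ω) (Real.exp (-((s - 2 * ε) * n)))) := by
  have hK := hq.one_le
  have hc : Measurable (f ∘ b) := hf.comp hb
  have hQ : Q = P.map (f ∘ b) := by rw [hd.1, hν, Measure.map_map hf hb]
  obtain ⟨A, hA, hev⟩ := hmod ε hε
  have hexp : ∀ᶠ n : ℕ in atTop, 4 * K0 ^ 3 < Real.exp (ε * n) := by
    have : Tendsto (fun n : ℕ => Real.exp (ε * n)) atTop atTop :=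
      Real.tendsto_exp_atTop.comp (tendsto_natCast_atTop_atTop.const_mul_atTop hε)
    exact this.eventually_gt_atTop _
  obtain ⟨N0, hN0⟩ := eventually_atTop.1 (hev.and hexp)
  have hstep : ∀ n : ℕ, ∃ Bad : Set Ω, P Bad ≤ ENNReal.ofReal (2 * Real.exp (-(ε * n))) ∧
      (N0 ≤ n → ∀ᵐ ω ∂P, ω ∉ Bad → ω ∈ A n →
        κ (f (b ω)) (qball q (b ω) (Real.exp (-((s - ε) * n)))) ≤
          ENNReal.ofReal (Real.exp (-((a - (V + 2) * ε) * n))) ∧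
        ENNReal.ofReal (Real.exp (-((a + (V + 2) * ε) * n))) ≤
        κ (f (b ω)) (qball q (b ω) (Real.exp (-((s - 2 * ε) * n))))) := by
    intro n
    by_cases hn : N0 ≤ n
    swap
    · exact ⟨∅, by simp, fun h => absurd h hn⟩
    obtain ⟨⟨h1, h2, h3⟩, h4⟩ := hN0 n hn
    have hR : 4 * K0 ^ 3 * Real.exp (-((s - ε) * n)) < Real.exp (-((s - 2 * ε) * n)) := by
      have e : Real.exp (-((s - 2 * ε) * n)) = Real.exp (ε * n) * Real.exp (-((s - ε) * n)) := by
        rw [← Real.exp_add]; congr 1; ring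
      rw [e]
      exact mul_lt_mul_of_pos_right h4 (Real.exp_pos _)
    obtain ⟨S, hSm, hS1, hS2, hS3, hS4⟩ := rep_sets hq hmeas (Real.exp_pos _) hR h1 h2
    have hkae : ∀ z, AEMeasurable (fun c => κ c (S z)) Q := fun z => dis_aem hf hd (hSm z)
    set k : I → C → ℝ≥0∞ := fun z => (hkae z).mk _ with hk
    have hkm : ∀ z, Measurable (k z) := fun z => (hkae z).measurable_mk
    have hkeq : ∀ z, (fun c => κ c (S z)) =ᵐ[Q] k z := fun z => (hkae z).ae_eq_mk
    have hkint : ∀ z E, MeasurableSet E → P (b ⁻¹' S z ∩ (f ∘ b) ⁻¹' E) = ∫⁻ x in E, k z x ∂Q := by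
      intro z E hE
      rw [← lintegral_congr_ae (ae_restrict_of_ae (hkeq z)), ← dis_set hf hsing hd (hSm z) hE, hν,
        Measure.map_apply hb ((hSm z).inter (hf hE))]
      rfl
    have hksum : ∑' z, ∫⁻ x, k z x ∂Q ≤ ENNReal.ofReal (Real.exp (V * ε * n)) := by
      have e : ∀ z, ∫⁻ x, k z x ∂Q = P (b ⁻¹' S z) := by
        intro z
        have := hkint z univ MeasurableSet.univ
        simpa using this.symm
      simp_rw [e]
      exact mult_sum hb hSm hS4
    have hU := lemU (L := ENNReal.ofReal (Real.exp (-((a - (V + 2) * ε) * n))))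
      (K := ENNReal.ofReal (Real.exp (-((a - ε) * n)))) hc (hWm n) hkm (hW n) hksum
    have hL := lemL (hZ n) hc (hWm n) hkm (hW n) hkint hS1 (ENNReal.ofReal (Real.exp (-(ε * n))))
    refine ⟨{ω | ENNReal.ofReal (Real.exp (-((a - (V + 2) * ε) * n))) < k (Z n ω) ((f ∘ b) ω) ∧
        W n (Z n ω) ((f ∘ b) ω) ≤ ENNReal.ofReal (Real.exp (-((a - ε) * n)))} ∪
      (A n ∩ {ω | k (Z n ω) ((f ∘ b) ω) < ENNReal.ofReal (Real.exp (-(ε * n))) * W n (Z n ω) ((f ∘ b) ω)}),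
      (measure_union_le _ _).trans ?_, fun _ => ?_⟩
    · rw [two_mul, ENNReal.ofReal_add (Real.exp_pos _).le (Real.exp_pos _).le]
      refine add_le_add ?_ hL
      have hpos : ENNReal.ofReal (Real.exp (-((a - (V + 2) * ε) * n))) ≠ 0 := by
        rw [Ne, ENNReal.ofReal_eq_zero, not_le]; positivity
      refine (ENNReal.mul_le_mul_iff_right hpos ENNReal.ofReal_ne_top).1 (hU.trans (le_of_eq ?_))
      rw [← ENNReal.ofReal_mul (Real.exp_pos _).le, ← ENNReal.ofReal_mul (Real.exp_pos _).le, ← Real.exp_add,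
        ← Real.exp_add]
      congr 2; ring
    · have hall : ∀ᵐ ω ∂P, ∀ z, κ (f (b ω)) (S z) = k z (f (b ω)) := by
        rw [ae_all_iff]
        intro z
        have h5 := hkeq z
        rw [hQ] at h5
        exact ae_of_ae_map hc.aemeasurable h5
      filter_upwards [hall] with ω hω hbad hωA
      have hb1 : ¬ (ENNReal.ofReal (Real.exp (-((a - (V + 2) * ε) * n))) < k (Z n ω) ((f ∘ b) ω) ∧
        W n (Z n ω) ((f ∘ b) ω) ≤ ENNReal.ofReal (Real.exp (-((a - ε) * n)))) := fun h => hbad (Or.inl h)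
      have hb2 : ¬ (k (Z n ω) ((f ∘ b) ω) < ENNReal.ofReal (Real.exp (-(ε * n))) * W n (Z n ω) ((f ∘ b) ω)) :=
        fun h => hbad (Or.inr ⟨hωA, h⟩)
      obtain ⟨hw1, hw2⟩ := h3 ω hωA
      constructor
      · calc _ ≤ κ (f (b ω)) (S (Z n ω)) := measure_mono (hS2 ω hωA)
          _ = k (Z n ω) ((f ∘ b) ω) := hω _
          _ ≤ _ := by
            by_contra h; push Not at h; exact hb1 ⟨h, hw2⟩
      · calc _ ≤ ENNReal.ofReal (Real.exp (-(ε * n))) * ENNReal.ofReal (Real.exp (-((a + ε) * n))) := by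
              rw [← ENNReal.ofReal_mul (Real.exp_pos _).le, ← Real.exp_add]
              apply ENNReal.ofReal_le_ofReal
              apply Real.exp_le_exp.2
              have : 0 ≤ V * ε * n := by positivity
              nlinarith
          _ ≤ ENNReal.ofReal (Real.exp (-(ε * n))) * W n (Z n ω) ((f ∘ b) ω) := by gcongr
          _ ≤ k (Z n ω) ((f ∘ b) ω) := not_lt.1 hb2
          _ = κ (f (b ω)) (S (Z n ω)) := (hω _).symm
          _ ≤ _ := measure_mono (hS3 ω hωA)
  choose Bad hBad1 hBad2 using hstep
  have hsum : ∑' n, P (Bad n) ≠ ∞ := by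
    refine ne_top_of_le_ne_top ?_ (ENNReal.tsum_le_tsum hBad1)
    have hsm : Summable fun n : ℕ => 2 * Real.exp (-(ε * n)) := by
      apply Summable.mul_left
      have := Real.summable_exp_nat_mul_iff.2 (show -ε < 0 by linarith)
      refine this.congr fun n => ?_
      congr 1; ring
    exact hsm.tsum_ofReal_ne_top
  have hbc := ae_eventually_notMem hsum
  have hall : ∀ᵐ ω ∂P, ∀ n : ℕ, N0 ≤ n → ω ∉ Bad n → ω ∈ A n →
        κ (f (b ω)) (qball q (b ω) (Real.exp (-((s - ε) * n)))) ≤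
          ENNReal.ofReal (Real.exp (-((a - (V + 2) * ε) * n))) ∧
        ENNReal.ofReal (Real.exp (-((a + (V + 2) * ε) * n))) ≤
        κ (f (b ω)) (qball q (b ω) (Real.exp (-((s - 2 * ε) * n)))) := by
    rw [ae_all_iff]
    intro n
    by_cases hn : N0 ≤ n
    · filter_upwards [hBad2 n hn] with ω hω _
      exact hω
    · exact Eventually.of_forall fun ω h => absurd h hn
  filter_upwards [hall, hbc, hA] with ω h1 h2 h3
  filter_upwards [h2, h3, eventually_ge_atTop N0] with n h4 h5 h6
  exact h1 n h6 h4 h5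

lemma ae_transfer [IsProbabilityMeasure P] (hb : Measurable b) (hν : ν = P.map b)
    {M : ℕ → B → ℝ≥0∞} (hM : ∀ n, AEMeasurable (M n) ν) (S : ℕ → Set ℝ≥0∞) (hS : ∀ n, MeasurableSet (S n))
    (h : ∀ᵐ ω ∂P, ∀ᶠ n in atTop, M n (b ω) ∈ S n) : ∀ᵐ β ∂ν, ∀ᶠ n in atTop, M n β ∈ S n := by
  set g : ℕ → B → ℝ≥0∞ := fun n => (hM n).mk _
  have hg : ∀ n, Measurable (g n) := fun n => (hM n).measurable_mk
  have he : ∀ᵐ β ∂ν, ∀ n, M n β = g n β := ae_all_iff.2 fun n => (hM n).ae_eq_mk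
  have he' : ∀ᵐ ω ∂P, ∀ n, M n (b ω) = g n (b ω) := by
    rw [hν] at he
    exact ae_of_ae_map hb.aemeasurable he
  have hms : MeasurableSet {β | ∀ᶠ n in atTop, g n β ∈ S n} := by
    have : {β | ∀ᶠ n in atTop, g n β ∈ S n} = ⋃ N : ℕ, ⋂ n : ℕ, ⋂ (_ : N ≤ n), g n ⁻¹' S n := by
      ext β; simp [eventually_atTop]
    rw [this]
    exact MeasurableSet.iUnion fun N => MeasurableSet.iInter fun n => MeasurableSet.iInter fun _ => hg n (hS n)
  have h2 : ∀ᵐ β ∂ν, ∀ᶠ n in atTop, g n β ∈ S n := by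
    rw [hν, ae_map_iff hb.aemeasurable hms]
    filter_upwards [h, he'] with ω h1 h2
    filter_upwards [h1] with n hn
    rw [← h2 n]; exact hn
  filter_upwards [h2, he] with β h1 h2
  filter_upwards [h1] with n hn
  rw [h2 n]; exact hn

theorem master [IsProbabilityMeasure P] [IsProbabilityMeasure ν] (hq : QM q K0)
    (hmeas : ∀ ξ r, MeasurableSet (qball q ξ r)) (hcov : CoverBdd q) (hb : Measurable b) (hf : Measurable f)
    (hsing : ∀ c : C, MeasurableSet ({c} : Set C)) (hν : ν = P.map b) (hd : IsDisintegration ν f Q κ)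
    {Z : ℕ → Ω → I} (hZ : ∀ n z, MeasurableSet {ω | Z n ω = z}) {W : ℕ → I → C → ℝ≥0∞}
    (hWm : ∀ n z, Measurable (W n z))
    (hW : ∀ n z E, MeasurableSet E → P ({ω | Z n ω = z} ∩ (f ∘ b) ⁻¹' E) = ∫⁻ x in E, W n z x ∂Q)
    {s a V : ℝ} (hs : 0 < s) (hV : 0 < V) (hmod : Model P b (f ∘ b) q Z W s a V) :
    ∀ᵐ β ∂ν, Tendsto (fun r : ℝ => Real.log (κ (f β) (qball q β r)).toReal / Real.log r)
      (𝓝[>] 0) (𝓝 (a / s)) := by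
  have hK := hq.one_le
  have h1 : ∀ᵐ β ∂ν, ∀ j : ℕ, ∀ᶠ n : ℕ in atTop,
      κ (f β) (qball q β (Real.exp (-(s * n)))) ≤ ENNReal.ofReal (Real.exp (-((a - (V + 2) / (j + 1)) * n))) := by
    rw [ae_all_iff]
    intro j
    have hε : 0 < 1 / ((j:ℝ) + 1) := by positivity
    set ε := 1 / ((j:ℝ) + 1) with hεd
    have e1 : (V + 2) / ((j:ℝ) + 1) = (V + 2) * ε := by rw [hεd]; ring
    rw [e1]
    have hr : ∀ n : ℕ, 0 < Real.exp (-((s - ε) * n)) / (4 * K0 ^ 2) := fun n => by positivity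
    choose M hMm hM using fun n : ℕ => discr hq hmeas hcov hf hd (hr n)
    have := ae_transfer hb hν hMm (fun n => Set.Iic (ENNReal.ofReal (Real.exp (-((a - (V + 2) * ε) * n)))))
      (fun n => measurableSet_Iic) (by
        filter_upwards [master1 hq hmeas hb hf hsing hν hd hZ hWm hW hs hV hmod hε] with ω hω
        filter_upwards [hω] with n hn
        refine le_trans (hM n (b ω)).2 ?_
        rw [mul_div_cancel₀ _ (by positivity)]
        exact hn.1)
    have hexp : ∀ᶠ n : ℕ in atTop, 4 * K0 ^ 2 < Real.exp (ε * n) := by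
      have : Tendsto (fun n : ℕ => Real.exp (ε * n)) atTop atTop :=
        Real.tendsto_exp_atTop.comp (tendsto_natCast_atTop_atTop.const_mul_atTop hε)
      exact this.eventually_gt_atTop _
    filter_upwards [this] with β hβ
    filter_upwards [hβ, hexp] with n h2 h3
    refine le_trans (le_trans (measure_mono ?_) (hM n β).1) h2
    intro x hx
    have hx' : q β x < _ := hx
    refine lt_of_lt_of_le hx' ?_
    rw [le_div_iff₀ (by positivity)]
    have e : Real.exp (-((s - ε) * n)) = Real.exp (-(s * n)) * Real.exp (ε * n) := by
      rw [← Real.exp_add]; congr 1; ring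
    rw [e]
    gcongr
  have h2 : ∀ᵐ β ∂ν, ∀ j : ℕ, ∀ᶠ n : ℕ in atTop,
      ENNReal.ofReal (Real.exp (-((a + (V + 2) / (j + 1)) * n))) ≤
        κ (f β) (qball q β (Real.exp (-((s - 3 / (j + 1)) * n)))) := by
    rw [ae_all_iff]
    intro j
    have hε : 0 < 1 / ((j:ℝ) + 1) := by positivity
    set ε := 1 / ((j:ℝ) + 1) with hεd
    have e1 : (V + 2) / ((j:ℝ) + 1) = (V + 2) * ε := by rw [hεd]; ring
    have e2 : 3 / ((j:ℝ) + 1) = 3 * ε := by rw [hεd]; ring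
    rw [e1, e2]
    have hr : ∀ n : ℕ, 0 < Real.exp (-((s - 2 * ε) * n)) := fun n => by positivity
    choose M hMm hM using fun n : ℕ => discr hq hmeas hcov hf hd (hr n)
    have := ae_transfer hb hν hMm (fun n => Set.Ici (ENNReal.ofReal (Real.exp (-((a + (V + 2) * ε) * n)))))
      (fun n => measurableSet_Ici) (by
        filter_upwards [master1 hq hmeas hb hf hsing hν hd hZ hWm hW hs hV hmod hε] with ω hω
        filter_upwards [hω] with n hn
        exact le_trans hn.2 (hM n (b ω)).1)
    have hexp : ∀ᶠ n : ℕ in atTop, 4 * K0 ^ 2 < Real.exp (ε * n) := by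
      have : Tendsto (fun n : ℕ => Real.exp (ε * n)) atTop atTop :=
        Real.tendsto_exp_atTop.comp (tendsto_natCast_atTop_atTop.const_mul_atTop hε)
      exact this.eventually_gt_atTop _
    filter_upwards [this] with β hβ
    filter_upwards [hβ, hexp] with n h2 h3
    refine le_trans h2 (le_trans (hM n β).2 (measure_mono ?_))
    intro x hx
    have hx' : q β x < _ := hx
    refine lt_of_lt_of_le hx' ?_
    have e : Real.exp (-((s - 3 * ε) * n)) = Real.exp (ε * n) * Real.exp (-((s - 2 * ε) * n)) := by
      rw [← Real.exp_add]; congr 1; ring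
    rw [e]
    gcongr
  have h3 : ∀ᵐ β ∂ν, IsProbabilityMeasure (κ (f β)) := by
    have := hd.2.1
    rw [hd.1] at this
    exact ae_of_ae_map hf.aemeasurable this
  filter_upwards [h1, h2, h3] with β hu hl hp
  exact interp (F := fun r => κ (f β) (qball q β r)) (V := V + 2)
    (fun r r' hrr => measure_mono fun x hx => lt_of_lt_of_le hx hrr) (fun r => prob_le_one) hs (by linarith) hu hl

end Master

/-! ### Part 10: tools for applying the master theorem -/

lemma boundary_singleton {X : Type*} [MetricSpace X] (o : X) (ξ : Boundary X o) :
    MeasurableSet ({ξ} : Set (Boundary X o)) := by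
  have e : ({ξ} : Set (Boundary X o)) = ⋂ n : ℕ, qball (qB o) ξ (1 / ((n : ℝ) + 1)) := by
    ext η
    simp only [Set.mem_singleton_iff, Set.mem_iInter]
    constructor
    · rintro rfl n
      change qB o η η < _
      simp only [qB, if_true]; positivity
    · intro h
      by_contra hne
      have hpos : 0 < qB o ξ η := by
        have : ξ ≠ η := fun h => hne h.symm
        simp only [qB, this, if_false]; positivity
      obtain ⟨n, hn⟩ := exists_nat_one_div_lt hpos
      have h1 : qB o ξ η < _ := h n
      linarith
  rw [e]
  exact MeasurableSet.iInter fun n => measurableSet_qball _ _ _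

lemma growth_encard {I : Type*} [MetricSpace I] {C v : ℝ} (hg : Growth I C v) (x : I) {R : ℝ} (hR : 0 ≤ R) :
    ((({g | dist x g ≤ R} : Set I).encard : ℕ∞) : ℝ≥0∞) ≤ ENNReal.ofReal (C * Real.exp (v * R)) := by
  obtain ⟨hf, hc⟩ := hg.2.2 x R hR
  rw [← hf.cast_ncard_eq]
  simp only [ENat.toENNReal_coe]
  rw [← ENNReal.ofReal_natCast]
  exact ENNReal.ofReal_le_ofReal hc

lemma mkModel {Ω I B C : Type*} [MeasurableSpace Ω] [MetricSpace I] {P : Measure Ω} {b : Ω → B} {c : Ω → C}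
    {q : B → B → ℝ} {Z : ℕ → Ω → I} {W : ℕ → I → C → ℝ≥0∞} {s a C0 v : ℝ} (hg : Growth I C0 v)
    (h : ∀ ε : ℝ, 0 < ε → ∃ A : ℕ → Set Ω, (∀ᵐ ω ∂P, ∀ᶠ n in atTop, ω ∈ A n) ∧ ∀ᶠ n : ℕ in atTop,
      (∀ ω ∈ A n, ∀ ω' ∈ A n, Z n ω = Z n ω' → q (b ω) (b ω') < Real.exp (-((s - ε) * n))) ∧
      (∀ ω ∈ A n, ∀ ω' ∈ A n, q (b ω) (b ω') < Real.exp (-((s - 2 * ε) * n)) → dist (Z n ω) (Z n ω') ≤ 6 * ε * n) ∧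
      (∀ ω ∈ A n, ENNReal.ofReal (Real.exp (-((a + ε) * n))) ≤ W n (Z n ω) (c ω) ∧
        W n (Z n ω) (c ω) ≤ ENNReal.ofReal (Real.exp (-((a - ε) * n))))) :
    Model P b c q Z W s a (6 * v + 1) := by
  intro ε hε
  obtain ⟨A, hA, hev⟩ := h ε hε
  refine ⟨A, hA, ?_⟩
  have hlim : Tendsto (fun n : ℕ => ε * (n : ℝ)) atTop atTop :=
    tendsto_natCast_atTop_atTop.const_mul_atTop hε
  filter_upwards [hev, hlim.eventually_ge_atTop (Real.log C0)] with n hn hC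
  obtain ⟨h1, h2, h3⟩ := hn
  refine ⟨h1, fun ω hω => ?_, h3⟩
  have hsub : Z n '' {ω' | ω' ∈ A n ∧ q (b ω) (b ω') < Real.exp (-((s - 2 * ε) * n))} ⊆
      {g | dist (Z n ω) g ≤ 6 * ε * n} := by
    rintro _ ⟨ω', ⟨hω', hq⟩, rfl⟩
    exact h2 ω hω ω' hω' hq
  have h4 : 0 ≤ 6 * ε * n := by positivity
  refine (ENat.toENNReal_mono (Set.encard_le_encard hsub)).trans ((growth_encard hg _ h4).trans ?_)
  refine ENNReal.ofReal_le_ofReal ?_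
  have h5 : C0 ≤ Real.exp (ε * n) := by
    rw [← Real.log_le_iff_le_exp hg.1]; exact hC
  calc C0 * Real.exp (v * (6 * ε * n)) ≤ Real.exp (ε * n) * Real.exp (v * (6 * ε * n)) :=
        mul_le_mul_of_nonneg_right h5 (Real.exp_pos _).le
    _ = _ := by rw [← Real.exp_add]; congr 1; ring

theorem master0 {Ω I B : Type*} [MeasurableSpace Ω] [MeasurableSpace B] [Countable I] {P : Measure Ω}
    {ν : Measure B} {q : B → B → ℝ} {K0 : ℝ} {b : Ω → B} [IsProbabilityMeasure P] (hq : QM q K0)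
    (hmeas : ∀ ξ r, MeasurableSet (qball q ξ r)) (hcov : CoverBdd q) (hb : Measurable b)
    (hν : ν = P.map b)
    {Z : ℕ → Ω → I} (hZ : ∀ n z, MeasurableSet {ω | Z n ω = z}) {W : ℕ → I → ℝ≥0∞}
    (hW : ∀ n z, P {ω | Z n ω = z} = W n z)
    {s a V : ℝ} (hs : 0 < s) (hV : 0 < V)
    (hmod : Model P b (fun _ => ()) q Z (fun n z _ => W n z) s a V) :
    ExactDim q ν (a / s) := by
  have hνp : IsProbabilityMeasure ν := by
    rw [hν]; exact Measure.isProbabilityMeasure_map hb.aemeasurable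
  set f : B → Unit := fun _ => ()
  have hf : Measurable f := measurable_const
  have hQ : IsProbabilityMeasure (ν.map f) := Measure.isProbabilityMeasure_map hf.aemeasurable
  have hd : IsDisintegration ν f (ν.map f) (fun _ => ν) := by
    refine ⟨rfl, Eventually.of_forall fun _ => hνp, Eventually.of_forall fun c => ?_, fun s hs => ?_⟩
    · have : f ⁻¹' {c} = univ := by ext x; simp [f]
      rw [this, measure_univ]
    · simp
  refine master (κ := fun _ => ν) (f := f) (Q := ν.map f) hq hmeas hcov hb hf (fun c => MeasurableSet.of_discrete) hν hd hZ
    (W := fun n z _ => W n z) (fun n z => measurable_const) ?_ hs hV hmod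
  intro n z E hE
  by_cases h : () ∈ E
  · have : E = univ := by ext x; simp [h]
    subst this
    simp [hW]
  · have : E = ∅ := by ext x; simp [h]
    subst this
    simp

/-! powers of quasi-metrics -/

/-- the power `q ^ α` of a quasi-metric -/
def qpow {A : Type*} (q : A → A → ℝ) (α : ℝ) : A → A → ℝ := fun x y => q x y ^ α

lemma qpow_lt {A : Type*} {q : A → A → ℝ} {κ : ℝ} (h : QM q κ) {α : ℝ} (hα : 0 < α) {x y : A} {r : ℝ} :
    qpow q α x y < r ↔ 0 < r ∧ q x y < r ^ α⁻¹ := by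
  constructor
  · intro hr
    have hr' : q x y ^ α < r := hr
    have hr0 : 0 < r := (Real.rpow_nonneg (h.nonneg x y) α).trans_lt hr'
    exact ⟨hr0, (Real.lt_rpow_inv_iff_of_pos (h.nonneg x y) hr0.le hα).2 hr'⟩
  · rintro ⟨hr0, hr⟩
    exact (Real.lt_rpow_inv_iff_of_pos (h.nonneg x y) hr0.le hα).1 hr

lemma QM.qpow {A : Type*} {q : A → A → ℝ} {κ : ℝ} (h : QM q κ) {α : ℝ} (hα : 0 < α) :
    QM (qpow q α) (κ ^ α) := by
  have h0 : (0:ℝ) ≤ κ := zero_le_one.trans h.one_le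
  have key : ∀ x z r, 0 < r → q x z ≤ κ * r ^ α⁻¹ → q x z ^ α ≤ κ ^ α * r := by
    intro x z r hr hq
    calc q x z ^ α ≤ (κ * r ^ α⁻¹) ^ α := Real.rpow_le_rpow (h.nonneg _ _) hq hα.le
      _ = κ ^ α * r := by
        rw [Real.mul_rpow h0 (Real.rpow_nonneg hr.le _), ← Real.rpow_mul hr.le, inv_mul_cancel₀ hα.ne',
          Real.rpow_one]
  refine ⟨Real.one_le_rpow h.one_le hα.le, fun x y => Real.rpow_nonneg (h.nonneg x y) _, fun x => ?_, ?_, ?_⟩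
  · simp [HMDim.qpow, h.self, Real.zero_rpow hα.ne']
  · intro x y r hr
    obtain ⟨hr0, hr1⟩ := (qpow_lt h hα).1 hr
    exact key _ _ _ hr0 (h.symm _ _ _ hr1)
  · intro x y z r hr hr'
    obtain ⟨hr0, hr1⟩ := (qpow_lt h hα).1 hr
    exact key _ _ _ hr0 (h.tri _ _ _ _ hr1 ((qpow_lt h hα).1 hr').2)

lemma CoverBdd.qpow {A : Type*} {q : A → A → ℝ} (hc : CoverBdd q) {κ : ℝ} (h : QM q κ) {α : ℝ} (hα : 1 ≤ α) :
    CoverBdd (qpow q α) := by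
  obtain ⟨k, hk, hn⟩ := hc
  refine ⟨k, hk, fun n => ?_⟩
  obtain ⟨F, h1, h2, h3⟩ := hn n
  refine ⟨F, h1, h2, fun s hs x hx y hy => ?_⟩
  have h4 := h3 s hs x hx y hy
  calc q x y ^ α ≤ (Real.exp (-n)) ^ α := Real.rpow_le_rpow (h.nonneg _ _) h4 (by linarith)
    _ = Real.exp (-n * α) := by rw [← Real.exp_mul]
    _ ≤ Real.exp (-n) := by
      rw [Real.exp_le_exp]
      have : (0:ℝ) ≤ n := Nat.cast_nonneg n
      nlinarith

lemma qball_qpow {A : Type*} {q : A → A → ℝ} {κ : ℝ} (h : QM q κ) {α : ℝ} (hα : 0 < α) (x : A) {r : ℝ} (hr : 0 < r) :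
    qball (qpow q α) x r = qball q x (r ^ α⁻¹) := by
  ext y
  change HMDim.qpow q α x y < r ↔ q x y < _
  rw [qpow_lt h hα]
  simp [hr]

lemma qball_qpow_meas {A : Type*} [MeasurableSpace A] {q : A → A → ℝ} {κ : ℝ} (h : QM q κ) {α : ℝ} (hα : 0 < α)
    (hm : ∀ x r, MeasurableSet (qball q x r)) (x : A) (r : ℝ) : MeasurableSet (qball (qpow q α) x r) := by
  by_cases hr : 0 < r
  · rw [qball_qpow h hα x hr]; exact hm _ _
  · have : qball (qpow q α) x r = ∅ := by
      ext y
      change HMDim.qpow q α x y < r ↔ False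
      rw [qpow_lt h hα]; simp [hr]
    rw [this]; exact MeasurableSet.empty

/-- skew product quasi-metric `max q (q' ^ α)` -/
def qsk {A B : Type*} (q : A → A → ℝ) (q' : B → B → ℝ) (α : ℝ) (x y : A × B) : ℝ :=
  max (q x.1 y.1) (qpow q' α x.2 y.2)

lemma qball_qsk {A B : Type*} (q : A → A → ℝ) (q' : B → B → ℝ) (α : ℝ) (x : A × B) (r : ℝ) :
    qball (qsk q q' α) x r = qball q x.1 r ×ˢ qball (qpow q' α) x.2 r := by
  ext ⟨y, z⟩
  simp [qball, qsk]

section Walk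
variable {G : Type*} [Group G] [MeasurableSpace G] [DiscreteMeasurableSpace G] [Countable G]
variable {p : G → ℝ≥0∞} {P : Measure (ℕ → G)}
variable {H : Type*} [Group H] [Countable H]
variable {φ : G →* H} {q : H → ℝ≥0∞}

lemma fdr_Un [MetricSpace H] (hinv : LeftInvariantMetric H) (ω : ℕ → G) (n i : ℕ) :
    fdr φ i (Un n ω) = dist (φ (walk ω n)) (φ (walk ω (n + i))) := by
  rw [fdr, walk_add, map_mul]
  have := hinv (φ (walk ω n)) 1 (φ (walk (Un n ω) i))
  rw [mul_one] at this
  exact this.symm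

lemma track_ae [MetricSpace H] (hP : IsRWMeasure p P) (hinv : LeftInvariantMetric H) {δ : ℝ}
    (hδ : IsHyperbolicWith H δ) (hδ0 : 0 ≤ δ) {l : ℝ} (hl : 0 < l) (hc : Coc P (fdr φ) l) {ε : ℝ} (hε : 0 < ε) :
    ∀ᵐ ω ∂P, ∀ᶠ n : ℕ in atTop, Track 1 (fun k => φ (walk ω k)) n (l * n) (ε * n) := by
  wlog hεl : ε ≤ l with Hw
  · have := Hw (p := p) hP hinv hδ hδ0 hl hc hl le_rfl
    filter_upwards [this] with ω hω
    filter_upwards [hω] with n hn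
    exact hn.mono (mul_le_mul_of_nonneg_right (not_le.1 hεl).le (Nat.cast_nonneg n))
  set η := ε / 8 with hη
  have hη0 : 0 < η := by positivity
  have ha : 0 < l - 2 * η := by linarith
  obtain ⟨K, hK⟩ : ∃ K : ℕ, δ / (l - 2 * η) ≤ K := exists_nat_ge _
  filter_upwards [hc.upper hP hη0, hc.lower hP hη0] with ω hu hlo
  obtain ⟨N, hN⟩ := eventually_atTop.1 (hu.and hlo)
  have hlim : Tendsto (fun n : ℕ => η * (n : ℝ)) atTop atTop :=
    tendsto_natCast_atTop_atTop.const_mul_atTop hη0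
  filter_upwards [eventually_ge_atTop N, hlim.eventually_ge_atTop ((l + η) * (K + 1) + δ)] with n hn hn2
  have hlow : ∀ k, N ≤ k → (l - η) * k ≤ dist 1 (φ (walk ω k)) := fun k hk => (hN k hk).2
  have hup : dist 1 (φ (walk ω n)) ≤ l * n + η * n := by
    have := (hN n hn).1 0 (Nat.zero_le n)
    simpa [Un_zero, fdr] using this
  have hn0 : (0:ℝ) ≤ n := Nat.cast_nonneg n
  constructor
  · have := hlow n hn
    rw [abs_le]; constructor <;> nlinarith
  · intro m hm
    obtain ⟨k, rfl⟩ := Nat.exists_eq_add_of_le hm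
    have hch := chain_lemma (o := (1:H)) (a := l - 2 * η) (b := (l + η) * (K + 1)) (K := K + 1) (N := N) (L := n + k)
      hδ hδ0 (Nat.le_add_left 1 K) (by
        rw [div_le_iff₀ ha] at hK
        push_cast; nlinarith) (u := fun k => φ (walk ω k)) (by
        intro j hj i hi _
        have h1 := gp_ge (1:H) (φ (walk ω j)) (φ (walk ω (j + i)))
        have h2 := (hN (j + i) (by omega)).1 j (by omega)
        rw [Nat.add_sub_cancel_left, fdr_Un hinv] at h2
        have h3 := hlow j hj
        have h4 : (i:ℝ) ≤ K + 1 := by exact_mod_cast hi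
        push_cast at h2
        refine le_trans ?_ h1
        nlinarith) n hn k le_rfl
    refine le_trans ?_ hch
    nlinarith

lemma floor_ev {θ : ℝ} (hθ : 0 < θ) : Tendsto (fun n : ℕ => ⌊θ * n⌋₊) atTop atTop :=
  tendsto_nat_floor_atTop.comp (tendsto_natCast_atTop_atTop.const_mul_atTop hθ)

lemma floor_bd {θ : ℝ} (hθ : 0 < θ) (n : ℕ) : (⌊θ * n⌋₊ : ℝ) ≤ θ * n ∧ θ * n - 1 ≤ ⌊θ * n⌋₊ :=
  ⟨Nat.floor_le (by positivity), by linarith [Nat.lt_floor_add_one (θ * n)]⟩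

lemma track_floor [MetricSpace H] (hP : IsRWMeasure p P) (hinv : LeftInvariantMetric H) {δ : ℝ}
    (hδ : IsHyperbolicWith H δ) (hδ0 : 0 ≤ δ) {l : ℝ} (hl : 0 < l) (hc : Coc P (fdr φ) l) {ε : ℝ} (hε : 0 < ε)
    {θ : ℝ} (hθ : 0 < θ) (hθ1 : θ ≤ 1) :
    ∀ᵐ ω ∂P, ∀ᶠ n : ℕ in atTop, Track 1 (fun k => φ (walk ω k)) ⌊θ * n⌋₊ (l * θ * n) (ε * n) := by
  have hε2 : 0 < ε / 2 := by positivity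
  filter_upwards [track_ae hP hinv hδ hδ0 hl hc hε2] with ω hω
  have hlim : Tendsto (fun n : ℕ => ε / 2 * (n : ℝ)) atTop atTop :=
    tendsto_natCast_atTop_atTop.const_mul_atTop hε2
  filter_upwards [(floor_ev hθ).eventually hω, hlim.eventually_ge_atTop l] with n hn hn2
  obtain ⟨h1, h2⟩ := floor_bd hθ n
  have hn0 : (0:ℝ) ≤ n := Nat.cast_nonneg n
  have h3 : (⌊θ * n⌋₊ : ℝ) ≤ n := h1.trans (by nlinarith)
  refine hn.shift ?_
  have h4 : |l * (⌊θ * n⌋₊ : ℝ) - l * θ * n| ≤ l := by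
    rw [abs_le]; constructor <;> nlinarith
  nlinarith

end Walk

/-! ### Part 11: the setting, and exact dimensionality of `ν*` and `ν` -/

lemma le_of_nlog {t : ℝ≥0∞} (ht : t ≠ ∞) {c : ℝ} (h : c ≤ -Real.log t.toReal) :
    t ≤ ENNReal.ofReal (Real.exp (-c)) := by
  by_cases h0 : t = 0
  · rw [h0]; exact zero_le
  have hp : 0 < t.toReal := ENNReal.toReal_pos h0 ht
  rw [← ENNReal.ofReal_toReal ht]
  refine ENNReal.ofReal_le_ofReal ?_
  rw [← Real.log_le_iff_le_exp hp]; linarith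

lemma ge_of_nlog {t : ℝ≥0∞} (ht : t ≠ ∞) (h0 : t ≠ 0) {c : ℝ} (h : -Real.log t.toReal ≤ c) :
    ENNReal.ofReal (Real.exp (-c)) ≤ t := by
  have hp : 0 < t.toReal := ENNReal.toReal_pos h0 ht
  rw [← ENNReal.ofReal_toReal ht]
  refine ENNReal.ofReal_le_ofReal ?_
  rw [← Real.le_log_iff_exp_le hp]; linarith

section Ent
variable {G : Type*} [Group G] [MeasurableSpace G] [DiscreteMeasurableSpace G] [Countable G]
variable {p : G → ℝ≥0∞} {P : Measure (ℕ → G)}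
variable {H : Type*} [Group H] [Countable H]
variable {φ : G →* H} {q : H → ℝ≥0∞}

lemma Coc.upper0 {f : ℕ → (ℕ → G) → ℝ} {a : ℝ} (hP : IsRWMeasure p P) (hf : Coc P f a) {ε : ℝ} (hε : 0 < ε) :
    ∀ᵐ ω ∂P, ∀ᶠ n : ℕ in atTop, f n ω ≤ (a + ε) * n := by
  filter_upwards [hf.upper hP hε] with ω hω
  filter_upwards [hω] with n hn
  have := hn 0 (Nat.zero_le n)
  simp only [Nat.sub_zero, Un_zero] at this
  linarith

lemma ent_bounds (hP : IsRWMeasure p P) (hq : Step P φ q) {h : ℝ} (hc : Coc P (fent q φ) h) {ε : ℝ} (hε : 0 < ε) :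
    ∀ᵐ ω ∂P, ∀ᶠ n : ℕ in atTop, ENNReal.ofReal (Real.exp (-((h + ε) * n))) ≤ piN q n (φ (walk ω n)) ∧
      piN q n (φ (walk ω n)) ≤ ENNReal.ofReal (Real.exp (-((h - ε) * n))) := by
  filter_upwards [hc.upper0 hP hε, hc.lower hP hε, piN_pos_ae hP hq] with ω h1 h2 h3
  filter_upwards [h1, h2] with n h4 h5
  have ht : piN q n (φ (walk ω n)) ≠ ∞ := ne_top_of_le_ne_top ENNReal.one_ne_top (piN_le_one hP hq _ _)
  exact ⟨ge_of_nlog ht (h3 n) h4, le_of_nlog ht h5⟩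

/-- entropy of a window `[θ n, n]` of the walk -/
lemma window_bounds {f : ℕ → (ℕ → G) → ℝ} {a : ℝ} (hP : IsRWMeasure p P) (hf : Coc P f a) {ε : ℝ} (hε : 0 < ε)
    {θ : ℝ} (hθ : 0 < θ) (hθ1 : θ ≤ 1) :
    ∀ᵐ ω ∂P, ∀ᶠ n : ℕ in atTop, |f (n - ⌊θ * n⌋₊) (Un ⌊θ * n⌋₊ ω) - a * (1 - θ) * n| ≤ ε * n := by
  have ha := hf.a_nonneg
  have hε4 : 0 < ε / 4 := by positivity
  filter_upwards [hf.upper hP hε4, hf.upper0 hP hε4, hf.lower hP hε4, hf.sub] with ω h1 h2 h3 h4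
  have hlim : Tendsto (fun n : ℕ => ε / 4 * (n : ℝ)) atTop atTop :=
    tendsto_natCast_atTop_atTop.const_mul_atTop hε4
  filter_upwards [h1, h3, (floor_ev hθ).eventually h2, hlim.eventually_ge_atTop a] with n k1 k3 k2 hn
  obtain ⟨b1, b2⟩ := floor_bd hθ n
  have hn0 : (0:ℝ) ≤ n := Nat.cast_nonneg n
  have b3 : (⌊θ * n⌋₊ : ℝ) ≤ n := b1.trans (by nlinarith)
  have b4 : ⌊θ * n⌋₊ ≤ n := by exact_mod_cast b3
  have k4 := h4 ⌊θ * n⌋₊ (n - ⌊θ * n⌋₊)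
  rw [Nat.add_sub_cancel' b4] at k4
  have k1 := k1 _ b4
  rw [Nat.cast_sub b4] at k1
  rw [abs_le]
  constructor
  · nlinarith [mul_le_mul_of_nonneg_left b1 ha]
  · nlinarith [mul_le_mul_of_nonneg_left b2 ha]

/-- entropy of the initial window -/
lemma init_bounds {f : ℕ → (ℕ → G) → ℝ} {a : ℝ} (hP : IsRWMeasure p P) (hf : Coc P f a) {ε : ℝ} (hε : 0 < ε)
    {θ : ℝ} (hθ : 0 < θ) (hθ1 : θ ≤ 1) :
    ∀ᵐ ω ∂P, ∀ᶠ n : ℕ in atTop, |f ⌊θ * n⌋₊ ω - a * θ * n| ≤ ε * n := by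
  have ha := hf.a_nonneg
  have hε4 : 0 < ε / 4 := by positivity
  filter_upwards [hf.upper0 hP hε4, hf.lower hP hε4] with ω h2 h3
  have hlim : Tendsto (fun n : ℕ => ε / 4 * (n : ℝ)) atTop atTop :=
    tendsto_natCast_atTop_atTop.const_mul_atTop hε4
  filter_upwards [(floor_ev hθ).eventually h3, (floor_ev hθ).eventually h2, hlim.eventually_ge_atTop a] with n k3 k2 hn
  obtain ⟨b1, b2⟩ := floor_bd hθ n
  have hn0 : (0:ℝ) ≤ n := Nat.cast_nonneg n
  have b3 : (⌊θ * n⌋₊ : ℝ) ≤ n := b1.trans (by nlinarith)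
  rw [abs_le]
  constructor
  · nlinarith [mul_le_mul_of_nonneg_left b2 ha]
  · nlinarith [mul_le_mul_of_nonneg_left b1 ha]

/-- joint law of `(φ z_m, ψ z_n)` -/
lemma P_two {K : Type*} [Group K] [Countable K] {ψ : G →* K} {r : K → ℝ≥0∞} (hP : IsRWMeasure p P)
    (hq : Step P φ q) (hr : Step P ψ r) (m n : ℕ) (hmn : m ≤ n) (χ : H → K) (hχ : ∀ g, ψ g = χ (φ g)) (z : H) (y : K) :
    P {ω | φ (walk ω m) = z ∧ ψ (walk ω n) = y} = piN q m z * piN r (n - m) ((χ z)⁻¹ * y) := by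
  obtain ⟨F, hF⟩ := fwalk_pre (G := G) (fun g => φ g) m
  have hF' : ∀ ω : ℕ → G, φ (walk ω m) = F (pre m ω) := fun ω => congrFun hF ω
  have hA : MeasurableSet {ω : ℕ → G | ψ (walk ω (n - m)) = (χ z)⁻¹ * y} :=
    (measurable_walk (n - m)) (DiscreteMeasurableSpace.forall_measurableSet {g | ψ g = (χ z)⁻¹ * y})
  have e : {ω : ℕ → G | φ (walk ω m) = z ∧ ψ (walk ω n) = y} =
      pre m ⁻¹' (F ⁻¹' {z}) ∩ Un m ⁻¹' {ω : ℕ → G | ψ (walk ω (n - m)) = (χ z)⁻¹ * y} := by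
    ext ω
    simp only [Set.mem_ofPred_eq, Set.mem_inter_iff, Set.mem_preimage, Set.mem_singleton_iff, ← hF']
    refine and_congr_right fun h => ?_
    have : walk ω n = walk ω m * walk (Un m ω) (n - m) := by
      rw [← walk_add, Nat.add_sub_cancel' hmn]
    rw [this, map_mul, hχ (walk ω m), h, eq_inv_mul_iff_mul_eq]
  rw [e, prefix_mul hP m _ hA, P_walk hP ψ hr, ← P_walk hP φ hq m z]
  congr 2
  ext ω
  simp [hF']

end Ent

section Ctx
variable {Γ Γs : Type*} [Group Γ] [Group Γs] [MetricSpace Γ] [MetricSpace Γs]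
    [Countable Γ] [Countable Γs] [MeasurableSpace Γ] [DiscreteMeasurableSpace Γ]
    [MeasurableSpace Γs] [DiscreteMeasurableSpace Γs]

/-- the boundary map at `ω` is the limit of the walk -/
def Good (bnd : (ℕ → Γ × Γs) → Boundary Γ (1:Γ) × Boundary Γs (1:Γs)) (ω : ℕ → Γ × Γs) : Prop :=
  ∃ (h1 : IsDivergent (1:Γ) (fun n => (walk ω n).1)) (h2 : IsDivergent (1:Γs) (fun n => (walk ω n).2)),
      bnd ω = (mkB (1:Γ) ⟨fun n => (walk ω n).1, h1⟩, mkB (1:Γs) ⟨fun n => (walk ω n).2, h2⟩)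

/-- all the standing data -/
structure Ctx (p : Γ × Γs → ℝ≥0∞) (μs : Γs → ℝ≥0∞) (P : Measure (ℕ → Γ × Γs))
    (bnd : (ℕ → Γ × Γs) → Boundary Γ (1:Γ) × Boundary Γs (1:Γs)) (hπ hs l ls δ δs : ℝ) : Prop where
  hP : IsRWMeasure p P
  hyp : IsHypGroupMetric Γ
  hyps : IsHypGroupMetric Γs
  hδ : IsHyperbolicWith Γ δ
  hδs : IsHyperbolicWith Γs δs
  hδ0 : 0 ≤ δ
  hδs0 : 0 ≤ δs
  l0 : 0 < l
  ls0 : 0 < ls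
  hll : ls ≤ l
  st : Step P (MonoidHom.id (Γ × Γs)) p
  sts : Step P (MonoidHom.snd Γ Γs) μs
  ce : Coc P (fent p (MonoidHom.id (Γ × Γs))) hπ
  ces : Coc P (fent μs (MonoidHom.snd Γ Γs)) hs
  cd : Coc P (fdr (MonoidHom.fst Γ Γs)) l
  cds : Coc P (fdr (MonoidHom.snd Γ Γs)) ls
  bm : Measurable bnd
  good : ∀ᵐ ω ∂P, Good bnd ω

variable {p : Γ × Γs → ℝ≥0∞} {μs : Γs → ℝ≥0∞} {P : Measure (ℕ → Γ × Γs)}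
    {bnd : (ℕ → Γ × Γs) → Boundary Γ (1:Γ) × Boundary Γs (1:Γs)} {hπ hs l ls δ δs : ℝ}

lemma Ctx.close1 (h : Ctx p μs P bnd hπ hs l ls δ δs) {ω ω' : ℕ → Γ × Γs} (hg : Good bnd ω) (hg' : Good bnd ω')
    {t : ℕ} {R e : ℝ} (ht : Track 1 (fun k => (walk ω k).1) t R e) (ht' : Track 1 (fun k => (walk ω' k).1) t R e)
    (he : (walk ω t).1 = (walk ω' t).1) :
    qB 1 (bnd ω).1 (bnd ω').1 ≤ Real.exp (-(R - e - 3 * δ)) := by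
  obtain ⟨h1, h2, e1⟩ := hg
  obtain ⟨h1', h2', e1'⟩ := hg'
  rw [e1, e1']
  exact track_close h.hδ h.hδ0 ⟨_, h1⟩ ⟨_, h1'⟩ ht ht' he

lemma Ctx.close2 (h : Ctx p μs P bnd hπ hs l ls δ δs) {ω ω' : ℕ → Γ × Γs} (hg : Good bnd ω) (hg' : Good bnd ω')
    {t : ℕ} {R e : ℝ} (ht : Track 1 (fun k => (walk ω k).2) t R e) (ht' : Track 1 (fun k => (walk ω' k).2) t R e)
    (he : (walk ω t).2 = (walk ω' t).2) :
    qB 1 (bnd ω).2 (bnd ω').2 ≤ Real.exp (-(R - e - 3 * δs)) := by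
  obtain ⟨h1, h2, e1⟩ := hg
  obtain ⟨h1', h2', e1'⟩ := hg'
  rw [e1, e1']
  exact track_close h.hδs h.hδs0 ⟨_, h2⟩ ⟨_, h2'⟩ ht ht' he

lemma Ctx.near1 (h : Ctx p μs P bnd hπ hs l ls δ δs) {ω ω' : ℕ → Γ × Γs} (hg : Good bnd ω) (hg' : Good bnd ω')
    {t : ℕ} {R e S : ℝ} (ht : Track 1 (fun k => (walk ω k).1) t R e) (ht' : Track 1 (fun k => (walk ω' k).1) t R e)
    (hS : S ≤ R - e) (hq : qB 1 (bnd ω).1 (bnd ω').1 < Real.exp (-S)) :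
    dist (walk ω t).1 (walk ω' t).1 ≤ 2 * (R - S) + 2 * e + 4 * δ := by
  obtain ⟨h1, h2, e1⟩ := hg
  obtain ⟨h1', h2', e1'⟩ := hg'
  rw [e1, e1'] at hq
  exact track_near h.hδ h.hδ0 ⟨_, h1⟩ ⟨_, h1'⟩ ht ht' hS hq

lemma Ctx.near2 (h : Ctx p μs P bnd hπ hs l ls δ δs) {ω ω' : ℕ → Γ × Γs} (hg : Good bnd ω) (hg' : Good bnd ω')
    {t : ℕ} {R e S : ℝ} (ht : Track 1 (fun k => (walk ω k).2) t R e) (ht' : Track 1 (fun k => (walk ω' k).2) t R e)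
    (hS : S ≤ R - e) (hq : qB 1 (bnd ω).2 (bnd ω').2 < Real.exp (-S)) :
    dist (walk ω t).2 (walk ω' t).2 ≤ 2 * (R - S) + 2 * e + 4 * δs := by
  obtain ⟨h1, h2, e1⟩ := hg
  obtain ⟨h1', h2', e1'⟩ := hg'
  rw [e1, e1'] at hq
  exact track_near h.hδs h.hδs0 ⟨_, h2⟩ ⟨_, h2'⟩ ht ht' hS hq

lemma lin_ev {ε : ℝ} (hε : 0 < ε) (c : ℝ) : ∀ᶠ n : ℕ in atTop, c ≤ ε * (n:ℝ) :=
  (tendsto_natCast_atTop_atTop.const_mul_atTop hε).eventually_ge_atTop c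

lemma Ctx.model1 (h : Ctx p μs P bnd hπ hs l ls δ δs) :
    ∃ V : ℝ, 0 < V ∧ Model P (fun ω => (bnd ω).2) (fun _ => ()) (qB (1:Γs)) (fun n ω => (walk ω n).2)
      (fun n z _ => piN μs n z) ls hs V := by
  obtain ⟨C0, v, hg⟩ := growth_of_hyp h.hyps
  refine ⟨6 * v + 1, by have := hg.2.1; positivity, mkModel hg fun ε hε => ?_⟩
  have hε4 : 0 < ε / 4 := by positivity
  refine ⟨fun n => {ω | Good bnd ω ∧ Track 1 (fun k => (walk ω k).2) n (ls * n) (ε / 4 * n) ∧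
    (ENNReal.ofReal (Real.exp (-((hs + ε) * n))) ≤ piN μs n (walk ω n).2 ∧
      piN μs n (walk ω n).2 ≤ ENNReal.ofReal (Real.exp (-((hs - ε) * n))))}, ?_, ?_⟩
  · filter_upwards [h.good, track_ae h.hP h.hyps.1 h.hδs h.hδs0 h.ls0 h.cds hε4, ent_bounds h.hP h.sts h.ces hε]
      with ω h1 h2 h3
    filter_upwards [h2, h3] with n h4 h5
    exact ⟨h1, h4, h5⟩
  · filter_upwards [lin_ev hε4 (4 * δs + 1)] with n hn
    have hδ := h.hδs0
    refine ⟨?_, ?_, fun ω hω => hω.2.2⟩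
    · intro ω hω ω' hω' he
      refine (h.close2 hω.1 hω'.1 hω.2.1 hω'.2.1 he).trans_lt (Real.exp_lt_exp.2 ?_)
      nlinarith
    · intro ω hω ω' hω' hq
      refine (h.near2 hω.1 hω'.1 hω.2.1 hω'.2.1 (S := (ls - 2 * ε) * n) (by nlinarith) hq).trans ?_
      nlinarith

lemma Ctx.dim1 (h : Ctx p μs P bnd hπ hs l ls δ δs) : ExactDim (qB (1:Γs)) (P.map fun ω => (bnd ω).2) (hs / ls) := by
  have := h.hP.1
  obtain ⟨V, hV, hm⟩ := h.model1
  refine master0 (qm_qB h.hδs h.hδs0) (measurableSet_qball _) (coverBdd_qB h.hyps) (measurable_snd.comp h.bm) rfl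
    (fun n z => ?_) (fun n z => P_walk h.hP (MonoidHom.snd Γ Γs) h.sts n z) h.ls0 hV hm
  exact (measurable_walk n) (DiscreteMeasurableSpace.forall_measurableSet {g : Γ × Γs | g.2 = z})

lemma Ctx.model2 (h : Ctx p μs P bnd hπ hs l ls δ δs) :
    ∃ V : ℝ, 0 < V ∧ Model P bnd (fun _ => ()) (qbb (1:Γ) (1:Γs))
      (fun n ω => ((walk ω ⌊ls / l * n⌋₊, (walk ω n).2) : (Γ × Γs) × Γs))
      (fun n z _ => piN p ⌊ls / l * n⌋₊ z.1 * piN μs (n - ⌊ls / l * n⌋₊) (z.1.2⁻¹ * z.2)) ls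
      (hπ * (ls / l) + hs * (1 - ls / l)) V := by
  obtain ⟨C0, v, hg⟩ := growth_of_hyp h.hyps
  obtain ⟨C1, v1, hg1⟩ := growth_of_hyp h.hyp
  have hgg := (hg1.prod hg).prod hg
  set θ := ls / l with hθd
  have hθ : 0 < θ := div_pos h.ls0 h.l0
  have hθ1 : θ ≤ 1 := (div_le_one h.l0).2 h.hll
  have hlθ : l * θ = ls := by rw [hθd]; field_simp [h.l0.ne']
  refine ⟨6 * (v1 + v + v) + 1, by have := hgg.2.1; positivity, mkModel hgg fun ε hε => ?_⟩
  have hε4 : 0 < ε / 4 := by positivity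
  have hε2 : 0 < ε / 2 := by positivity
  refine ⟨fun n => {ω | Good bnd ω ∧ Track 1 (fun k => (walk ω k).2) n (ls * n) (ε / 4 * n) ∧
    Track 1 (fun k => (walk ω k).1) ⌊θ * n⌋₊ (l * θ * n) (ε / 4 * n) ∧
    Track 1 (fun k => (walk ω k).2) ⌊θ * n⌋₊ (ls * θ * n) (ε / 4 * n) ∧
    (∀ n, piN p n (walk ω n) ≠ 0) ∧ (∀ m n, piN μs n (walk (Un m ω) n).2 ≠ 0) ∧
    |fent p (MonoidHom.id (Γ × Γs)) ⌊θ * n⌋₊ ω - hπ * θ * n| ≤ ε / 2 * n ∧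
    |fent μs (MonoidHom.snd Γ Γs) (n - ⌊θ * n⌋₊) (Un ⌊θ * n⌋₊ ω) - hs * (1 - θ) * n| ≤ ε / 2 * n}, ?_, ?_⟩
  · have hpos : ∀ᵐ ω ∂P, ∀ m n, piN μs n (walk (Un m ω) n).2 ≠ 0 := by
      rw [ae_all_iff]
      intro m
      exact (map_Un h.hP m).quasiMeasurePreserving.ae (piN_pos_ae h.hP h.sts)
    filter_upwards [h.good, track_ae h.hP h.hyps.1 h.hδs h.hδs0 h.ls0 h.cds hε4,
      track_floor h.hP h.hyp.1 h.hδ h.hδ0 h.l0 h.cd hε4 hθ hθ1,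
      track_floor h.hP h.hyps.1 h.hδs h.hδs0 h.ls0 h.cds hε4 hθ hθ1,
      piN_pos_ae h.hP h.st, hpos, init_bounds h.hP h.ce hε2 hθ hθ1, window_bounds h.hP h.ces hε2 hθ hθ1]
      with ω h1 h2 h3 h4 h5 h6 h7 h8
    filter_upwards [h2, h3, h4, h7, h8] with n k2 k3 k4 k7 k8
    exact ⟨h1, k2, k3, k4, h5, h6, k7, k8⟩
  · filter_upwards [lin_ev hε4 (4 * δs + 4 * δ + 1)] with n hn
    have hδ := h.hδs0
    have hδ' := h.hδ0
    have hn0 : (0:ℝ) ≤ n := Nat.cast_nonneg n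
    obtain ⟨b1, b2⟩ := floor_bd hθ n
    have b3 : (⌊θ * n⌋₊ : ℝ) ≤ n := b1.trans (by nlinarith)
    have b4 : ⌊θ * n⌋₊ ≤ n := by exact_mod_cast b3
    have hls := h.ls0
    refine ⟨?_, ?_, ?_⟩
    · rintro ω ⟨g1, g2, g3, g4, -⟩ ω' ⟨g1', g2', g3', g4', -⟩ he
      rw [Prod.mk.injEq] at he
      refine max_lt ?_ ?_
      · refine (h.close1 g1 g1' g3 g3' (by rw [he.1])).trans_lt (Real.exp_lt_exp.2 ?_)
        rw [hlθ]; nlinarith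
      · refine (h.close2 g1 g1' g2 g2' he.2).trans_lt (Real.exp_lt_exp.2 ?_)
        nlinarith
    · rintro ω ⟨g1, g2, g3, g4, -⟩ ω' ⟨g1', g2', g3', g4', -⟩ hq
      have hq1 : qB 1 (bnd ω).1 (bnd ω').1 < _ := (le_max_left _ _).trans_lt hq
      have hq2 : qB 1 (bnd ω).2 (bnd ω').2 < _ := (le_max_right _ _).trans_lt hq
      rw [Prod.dist_eq, Prod.dist_eq]
      refine max_le (max_le ?_ ?_) ?_
      · rw [hlθ] at g3 g3'
        refine (h.near1 g1 g1' g3 g3' (S := (ls - 2 * ε) * n) (by nlinarith) hq1).trans ?_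
        nlinarith
      · have hθn : ls * θ * n ≤ ls * n := by
          have := mul_le_mul_of_nonneg_left hθ1 hls.le
          nlinarith
        refine (h.near2 g1 g1' g4 g4' (S := (ls * θ - 2 * ε) * n) (by nlinarith)
          (hq2.trans_le (Real.exp_le_exp.2 (by nlinarith)))).trans ?_
        nlinarith
      · refine (h.near2 g1 g1' g2 g2' (S := (ls - 2 * ε) * n) (by nlinarith) hq2).trans ?_
        nlinarith
    · rintro ω ⟨g1, g2, g3, g4, g5, g6, g7, g8⟩
      have e : (walk ω ⌊θ * n⌋₊).2⁻¹ * (walk ω n).2 = (walk (Un ⌊θ * n⌋₊ ω) (n - ⌊θ * n⌋₊)).2 := by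
        have : walk ω n = walk ω ⌊θ * n⌋₊ * walk (Un ⌊θ * n⌋₊ ω) (n - ⌊θ * n⌋₊) := by
          rw [← walk_add, Nat.add_sub_cancel' b4]
        rw [this, Prod.snd_mul, inv_mul_cancel_left]
      simp only [e]
      set X := piN p ⌊θ * n⌋₊ (walk ω ⌊θ * n⌋₊) with hX
      set Y := piN μs (n - ⌊θ * n⌋₊) (walk (Un ⌊θ * n⌋₊ ω) (n - ⌊θ * n⌋₊)).2 with hY
      have g7' : |(-Real.log X.toReal) - hπ * θ * n| ≤ ε / 2 * n := g7
      have g8' : |(-Real.log Y.toReal) - hs * (1 - θ) * n| ≤ ε / 2 * n := g8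
      have hX1 : X ≠ ∞ := ne_top_of_le_ne_top ENNReal.one_ne_top (piN_le_one h.hP h.st _ _)
      have hY1 : Y ≠ ∞ := ne_top_of_le_ne_top ENNReal.one_ne_top (piN_le_one h.hP h.sts _ _)
      have hX0 : X ≠ 0 := g5 _
      have hY0 : Y ≠ 0 := g6 _ _
      have hXY : X * Y ≠ ∞ := ENNReal.mul_ne_top hX1 hY1
      have hlog : -Real.log (X * Y).toReal = -Real.log X.toReal + -Real.log Y.toReal := by
        rw [ENNReal.toReal_mul, Real.log_mul (ENNReal.toReal_pos hX0 hX1).ne' (ENNReal.toReal_pos hY0 hY1).ne']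
        ring
      rw [abs_le] at g7' g8'
      constructor
      · refine ge_of_nlog hXY (mul_ne_zero hX0 hY0) ?_
        rw [hlog]; nlinarith
      · refine le_of_nlog hXY ?_
        rw [hlog]; nlinarith

lemma Ctx.dim2 (h : Ctx p μs P bnd hπ hs l ls δ δs) :
    ExactDim (qbb (1:Γ) (1:Γs)) (P.map bnd) ((hπ - hs) / l + hs / ls) := by
  have := h.hP.1
  obtain ⟨V, hV, hm⟩ := h.model2
  have e : (hπ - hs) / l + hs / ls = (hπ * (ls / l) + hs * (1 - ls / l)) / ls := by
    have := h.l0.ne'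
    have := h.ls0.ne'
    field_simp
    ring
  rw [e]
  have hθ : 0 < ls / l := div_pos h.ls0 h.l0
  have hθ1 : ls / l ≤ 1 := (div_le_one h.l0).2 h.hll
  refine master0 (qm_qbb h.hδ h.hδ0 h.hδs h.hδs0) (measurableSet_qball_qbb _ _)
    ((coverBdd_qB h.hyp).prod (coverBdd_qB h.hyps)) h.bm rfl
    (fun n z => ?_) (fun n z => ?_) h.ls0 hV hm
  · have e : {ω : ℕ → Γ × Γs | (walk ω ⌊ls / l * n⌋₊, (walk ω n).2) = z} =
        (fun ω => walk ω ⌊ls / l * n⌋₊) ⁻¹' {z.1} ∩ (fun ω => walk ω n) ⁻¹' {g | g.2 = z.2} := by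
      ext ω; simp [Prod.ext_iff]
    rw [e]
    exact ((measurable_walk _) (DiscreteMeasurableSpace.forall_measurableSet _)).inter
      ((measurable_walk n) (DiscreteMeasurableSpace.forall_measurableSet _))
  · have b3 : (⌊ls / l * n⌋₊ : ℝ) ≤ n := (floor_bd hθ n).1.trans (by
      have hn0 : (0:ℝ) ≤ n := Nat.cast_nonneg n
      nlinarith)
    have b4 : ⌊ls / l * n⌋₊ ≤ n := by exact_mod_cast b3
    rw [← P_two h.hP h.st h.sts ⌊ls / l * n⌋₊ n b4 Prod.snd (fun g => rfl) z.1 z.2]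
    congr 1
    ext ω
    rw [Set.mem_ofPred_eq, Set.mem_ofPred_eq, Prod.ext_iff]
    rfl

end Ctx

/-! ### Part 12: the conditional measures -/

/-- concatenation of a finite word and a path -/
def tau {G : Type*} {n : ℕ} (γ : Fin n → G) (ω : ℕ → G) : ℕ → G :=
  fun i => if h : i < n then γ ⟨i, h⟩ else ω (i - n)

lemma Un_tau {G : Type*} {n : ℕ} (γ : Fin n → G) (ω : ℕ → G) : Un n (tau γ ω) = ω := by
  funext i
  simp [Un, tau]

lemma pre_tau {G : Type*} {n : ℕ} (γ : Fin n → G) (ω : ℕ → G) : pre n (tau γ ω) = γ := by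
  funext i
  simp [pre, tau]

lemma tau_pre {G : Type*} (n : ℕ) (ω : ℕ → G) : tau (pre n ω) (Un n ω) = ω := by
  funext i
  by_cases h : i < n
  · simp [tau, pre, h]
  · simp [tau, Un, h, Nat.add_sub_cancel' (not_lt.1 h)]

lemma measurable_tau {G : Type*} [MeasurableSpace G] {n : ℕ} (γ : Fin n → G) :
    Measurable (tau γ : (ℕ → G) → ℕ → G) := by
  refine measurable_pi_lambda _ fun i => ?_
  by_cases h : i < n
  · simp only [tau, h, dif_pos]; exact measurable_const
  · simp only [tau, h, dif_neg, not_false_eq_true]; exact measurable_pi_apply _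

section Ctx
variable {Γ Γs : Type*} [Group Γ] [Group Γs] [MetricSpace Γ] [MetricSpace Γs]
    [Countable Γ] [Countable Γs] [MeasurableSpace Γ] [DiscreteMeasurableSpace Γ]
    [MeasurableSpace Γs] [DiscreteMeasurableSpace Γs]
variable {p : Γ × Γs → ℝ≥0∞} {μs : Γs → ℝ≥0∞} {P : Measure (ℕ → Γ × Γs)}
    {bnd : (ℕ → Γ × Γs) → Boundary Γ (1:Γ) × Boundary Γs (1:Γs)} {hπ hs l ls δ δs : ℝ}

lemma mkB_congr_tail {X : Type*} [MetricSpace X] {o : X} {d : ℝ} (hd : IsHyperbolicWith X d) {u v : ℕ → X}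
    (hu : IsDivergent o u) (hv : IsDivergent o v) (n : ℕ) (huv : ∀ k, v (n + k) = u (n + k)) :
    mkB o ⟨u, hu⟩ = mkB o ⟨v, hv⟩ := by
  refine (mkB_eq_iff hd ⟨u, hu⟩ ⟨v, hv⟩).2 ?_
  intro R
  obtain ⟨N, hN⟩ := (tendsto_iff_ev o u u).1 hu R
  refine ⟨max N n, fun i hi j hj => ?_⟩
  obtain ⟨k, rfl⟩ := Nat.exists_eq_add_of_le ((le_max_right N n).trans hj)
  have := hN i ((le_max_left N n).trans hi) (n + k) ((le_max_left N n).trans hj)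
  rw [← huv] at this
  exact this


lemma Ctx.c0 (h : Ctx p μs P bnd hπ hs l ls δ δs) (n : ℕ) (y : Γs) (hy : piN μs n y ≠ 0) :
    ∃ c0 : (ℕ → Γ × Γs) → Boundary Γs (1:Γs), Measurable c0 ∧
      ∀ᵐ ω ∂P, (walk ω n).2 = y → (bnd ω).2 = c0 (Un n ω) := by
  have hPr := h.hP.1
  have hpos : ∀ᵐ ω ∂P, P (pre n ⁻¹' {pre n ω}) ≠ 0 := by
    rw [ae_iff]
    have : {ω : ℕ → Γ × Γs | ¬ P (pre n ⁻¹' {pre n ω}) ≠ 0} ⊆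
        ⋃ γ : {γ : Fin n → Γ × Γs // P (pre n ⁻¹' {γ}) = 0}, pre n ⁻¹' {γ.1} := by
      intro ω hω
      have hω' : P (pre n ⁻¹' {pre n ω}) = 0 := by
        simpa using hω
      exact Set.mem_iUnion.2 ⟨⟨pre n ω, hω'⟩, rfl⟩
    exact measure_mono_null this (measure_iUnion_null fun γ => γ.2)
  have hfr : ∃ᵐ ω ∂P, (walk ω n).2 = y := by
    rw [frequently_ae_iff]
    have := P_walk h.hP (MonoidHom.snd Γ Γs) h.sts n y
    intro h0
    apply hy
    rw [← this]
    exact h0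
  obtain ⟨ω0, hy0, hp0⟩ := (hfr.and_eventually hpos).exists
  set γ := pre n ω0 with hγ
  refine ⟨fun ω => (bnd (tau γ ω)).2, measurable_snd.comp (h.bm.comp (measurable_tau γ)), ?_⟩
  have hg : ∀ᵐ ω ∂P, Good bnd (tau γ ω) := by
    set B := toMeasurable P {ω | ¬ Good bnd ω}
    have hB : P B = 0 := by rw [measure_toMeasurable]; exact h.good
    have hBm : MeasurableSet B := measurableSet_toMeasurable _ _
    have h1 := prefix_mul h.hP n {γ} (measurable_tau γ hBm)
    have h2 : P (pre n ⁻¹' {γ} ∩ Un n ⁻¹' (tau γ ⁻¹' B)) = 0 := by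
      refine measure_mono_null ?_ hB
      rintro ω ⟨ha, hb⟩
      have ha' : pre n ω = γ := ha
      have hb' : tau γ (Un n ω) ∈ B := hb
      rwa [← ha', tau_pre] at hb'
    rw [h2] at h1
    rcases mul_eq_zero.1 h1.symm with h3 | h3
    · exact absurd h3 hp0
    · refine measure_mono_null ?_ h3
      intro ω hω
      exact subset_toMeasurable P _ hω
  have hg' : ∀ᵐ ω ∂P, Good bnd (tau γ (Un n ω)) := (map_Un h.hP n).quasiMeasurePreserving.ae hg
  filter_upwards [h.good, hg'] with ω g1 g2 hω
  obtain ⟨h1, h2, e⟩ := g1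
  obtain ⟨h1', h2', e'⟩ := g2
  rw [e]
  simp only [e']
  refine mkB_congr_tail h.hδs h2 h2' n fun k => ?_
  rw [walk_add, walk_add, Un_tau, Prod.snd_mul, Prod.snd_mul, hω,
    walk_pre (ω' := ω0) (pre_tau γ (Un n ω)), hy0]

/-- the key conditional-independence identity -/
lemma Ctx.cond_id (h : Ctx p μs P bnd hπ hs l ls δ δs) (n : ℕ) (z : Γ × Γs) {E : Set (Boundary Γs (1:Γs))}
    (hE : MeasurableSet E) :
    P ({ω | walk ω n = z} ∩ (fun ω => (bnd ω).2) ⁻¹' E) =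
      piN p n z / piN μs n z.2 * P ({ω | (walk ω n).2 = z.2} ∩ (fun ω => (bnd ω).2) ⁻¹' E) := by
  have hPr := h.hP.1
  have hw : ∀ z, P {ω | walk ω n = z} = piN p n z := fun z => P_walk h.hP (MonoidHom.id (Γ × Γs)) h.st n z
  have hws : ∀ y, P {ω | (walk ω n).2 = y} = piN μs n y := fun y => P_walk h.hP (MonoidHom.snd Γ Γs) h.sts n y
  by_cases hy : piN μs n z.2 = 0
  · have h1 : P {ω | (walk ω n).2 = z.2} = 0 := by rw [hws, hy]
    rw [measure_mono_null Set.inter_subset_left h1, mul_zero]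
    refine measure_mono_null ?_ h1
    rintro ω ⟨ha, -⟩
    have ha' : walk ω n = z := ha
    change (walk ω n).2 = z.2
    rw [ha']
  obtain ⟨c0, hc0, hae⟩ := h.c0 n z.2 hy
  have key : ∀ T : Set (Γ × Γs), (∀ g ∈ T, g.2 = z.2) →
      P ({ω | walk ω n ∈ T} ∩ (fun ω => (bnd ω).2) ⁻¹' E) = P {ω | walk ω n ∈ T} * P (c0 ⁻¹' E) := by
    intro T hT
    obtain ⟨F, hF⟩ := fwalk_pre (G := Γ × Γs) (fun g => g) n
    have hF' : ∀ ω : ℕ → Γ × Γs, walk ω n = F (pre n ω) := fun ω => congrFun hF ω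
    have e1 : {ω : ℕ → Γ × Γs | walk ω n ∈ T} = pre n ⁻¹' (F ⁻¹' T) := by
      ext ω; simp [hF']
    have e2 : P ({ω | walk ω n ∈ T} ∩ (fun ω => (bnd ω).2) ⁻¹' E) =
        P ({ω | walk ω n ∈ T} ∩ Un n ⁻¹' (c0 ⁻¹' E)) := by
      refine measure_congr ?_
      filter_upwards [hae] with ω hω
      apply propext
      change (walk ω n ∈ T ∧ (bnd ω).2 ∈ E) ↔ (walk ω n ∈ T ∧ c0 (Un n ω) ∈ E)
      refine and_congr_right fun hT' => ?_
      rw [hω (hT _ hT')]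
    rw [e2, e1, prefix_mul h.hP n _ (hc0 hE)]
  have k1 := key {z} (by rintro g rfl; rfl)
  have k2 := key {g | g.2 = z.2} (fun g hg => hg)
  have k1' : P ({ω | walk ω n = z} ∩ (fun ω => (bnd ω).2) ⁻¹' E) = piN p n z * P (c0 ⁻¹' E) := by
    rw [← hw z]; exact k1
  have k2' : P ({ω | (walk ω n).2 = z.2} ∩ (fun ω => (bnd ω).2) ⁻¹' E) = piN μs n z.2 * P (c0 ⁻¹' E) := by
    rw [← hws z.2]; exact k2
  have hyt : piN μs n z.2 ≠ ∞ := ne_top_of_le_ne_top ENNReal.one_ne_top (piN_le_one h.hP h.sts _ _)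
  rw [k1', k2', ← mul_assoc, ENNReal.div_mul_cancel hy hyt]

/-- density of the law of `c` on `{y_n = y}` -/
def Wd (P : Measure (ℕ → Γ × Γs)) (bnd : (ℕ → Γ × Γs) → Boundary Γ (1:Γ) × Boundary Γs (1:Γs)) (n : ℕ) (y : Γs) :
    Boundary Γs (1:Γs) → ℝ≥0∞ :=
  ((P.restrict {ω | (walk ω n).2 = y}).map fun ω => (bnd ω).2).rnDeriv (P.map fun ω => (bnd ω).2)

lemma Ctx.Wd_le (h : Ctx p μs P bnd hπ hs l ls δ δs) (n : ℕ) (y : Γs) :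
    (P.restrict {ω | (walk ω n).2 = y}).map (fun ω => (bnd ω).2) ≤ P.map (fun ω => (bnd ω).2) :=
  Measure.map_mono Measure.restrict_le_self (measurable_snd.comp h.bm)

lemma Ctx.Wd_int (h : Ctx p μs P bnd hπ hs l ls δ δs) (n : ℕ) (y : Γs) {E : Set (Boundary Γs (1:Γs))}
    (hE : MeasurableSet E) :
    P ({ω | (walk ω n).2 = y} ∩ (fun ω => (bnd ω).2) ⁻¹' E) = ∫⁻ x in E, Wd P bnd n y x ∂(P.map fun ω => (bnd ω).2) := by
  have hPr := h.hP.1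
  have hc : Measurable (fun ω => (bnd ω).2) := measurable_snd.comp h.bm
  have := Measure.isProbabilityMeasure_map (μ := P) hc.aemeasurable
  have hm : MeasurableSet {ω : ℕ → Γ × Γs | (walk ω n).2 = y} :=
    (measurable_walk n) (DiscreteMeasurableSpace.forall_measurableSet {g : Γ × Γs | g.2 = y})
  unfold Wd
  rw [Measure.setLIntegral_rnDeriv (Measure.absolutelyContinuous_of_le (h.Wd_le n y)),
    Measure.map_apply hc hE, Measure.restrict_apply (hc hE), Set.inter_comm]

lemma Ctx.Wd_upper (h : Ctx p μs P bnd hπ hs l ls δ δs) :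
    ∀ᵐ ω ∂P, ∀ n y, Wd P bnd n y (bnd ω).2 ≤ 1 := by
  have hPr := h.hP.1
  have hc : Measurable (fun ω => (bnd ω).2) := measurable_snd.comp h.bm
  have := Measure.isProbabilityMeasure_map (μ := P) hc.aemeasurable
  rw [ae_all_iff]; intro n
  rw [ae_all_iff]; intro y
  exact ae_of_ae_map hc.aemeasurable (Measure.rnDeriv_le_one_of_le (h.Wd_le n y))

lemma Ctx.Wd_lower (h : Ctx p μs P bnd hπ hs l ls δ δs) {ε : ℝ} (hε : 0 < ε) :
    ∀ᵐ ω ∂P, ∀ᶠ n : ℕ in atTop, ENNReal.ofReal (Real.exp (-(ε * n))) ≤ Wd P bnd n (walk ω n).2 (bnd ω).2 := by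
  have hPr := h.hP.1
  have hc : Measurable (fun ω => (bnd ω).2) := measurable_snd.comp h.bm
  obtain ⟨V, hV, hm⟩ := h.model1
  set η := ε / (V + 1) with hη
  have hη0 : 0 < η := by positivity
  have hηε : η * (V + 1) = ε := by rw [hη]; field_simp
  obtain ⟨A, hA, hev⟩ := hm η hη0
  have hq := qm_qB (o := (1:Γs)) h.hδs h.hδs0
  set K0 := Real.exp (3 * δs)
  obtain ⟨N0, hN0⟩ := eventually_atTop.1 (hev.and (lin_ev hη0 (Real.log (4 * K0 ^ 3) + 1)))
  set Bad : ℕ → Set (ℕ → Γ × Γs) := fun n => if N0 ≤ n then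
    A n ∩ {ω | Wd P bnd n (walk ω n).2 (bnd ω).2 < ENNReal.ofReal (Real.exp (-(ε * n)))} else ∅ with hBad
  have hb : ∀ n, P (Bad n) ≤ ENNReal.ofReal (Real.exp (-(η * n))) := by
    intro n
    by_cases hn : N0 ≤ n
    · obtain ⟨⟨h1, h2, -⟩, h4⟩ := hN0 n hn
      have hKp : 0 < 4 * K0 ^ 3 := by have := Real.exp_pos (3 * δs); positivity
      have hR : 4 * K0 ^ 3 * Real.exp (-((ls - η) * n)) < Real.exp (-((ls - 2 * η) * n)) := by
        have h5 : 4 * K0 ^ 3 < Real.exp (η * n) := by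
          rw [← Real.log_lt_iff_lt_exp hKp]; linarith
        have e : Real.exp (-((ls - 2 * η) * n)) = Real.exp (η * n) * Real.exp (-((ls - η) * n)) := by
          rw [← Real.exp_add]; congr 1; ring
        rw [e]
        exact mul_lt_mul_of_pos_right h5 (Real.exp_pos _)
      obtain ⟨S, hSm, hS1, hS2, hS3, hS4⟩ := rep_sets hq (measurableSet_qball _) (Real.exp_pos _) hR h1 h2
      have hM := lemM (P := P) (Q := P.map fun ω => (bnd ω).2) (c := fun ω => (bnd ω).2)
        (Z := fun ω : ℕ → Γ × Γs => (walk ω n).2) (W := Wd P bnd n) rfl hc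
        (fun z => Measure.measurable_rnDeriv _ _) (fun z E hE => h.Wd_int n z hE) hSm (A := A n) hS1
        (mult_sum hc hSm hS4) (ENNReal.ofReal (Real.exp (-(ε * n))))
      simp only [hBad, hn, if_true]
      refine hM.trans (le_of_eq ?_)
      rw [← ENNReal.ofReal_mul (Real.exp_pos _).le, ← Real.exp_add, ← hηε]
      congr 2; ring
    · simp [hBad, hn]
  have hsum : ∑' n, P (Bad n) ≠ ∞ := by
    refine ne_top_of_le_ne_top ?_ (ENNReal.tsum_le_tsum hb)
    have hsm : Summable fun n : ℕ => Real.exp (-(η * n)) := by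
      have := Real.summable_exp_nat_mul_iff.2 (show -η < 0 by linarith)
      refine this.congr fun n => ?_
      congr 1; ring
    exact hsm.tsum_ofReal_ne_top
  filter_upwards [ae_eventually_notMem hsum, hA] with ω h1 h2
  filter_upwards [h1, h2, eventually_ge_atTop N0] with n h3 h4 h5
  by_contra hlt
  push Not at hlt
  refine h3 ?_
  simp only [hBad, h5, if_true]
  exact ⟨h4, hlt⟩

lemma Ctx.model3 (h : Ctx p μs P bnd hπ hs l ls δ δs) :
    ∃ V : ℝ, 0 < V ∧ Model P bnd (Prod.snd ∘ bnd) (qsk (qB (1:Γ)) (qB (1:Γs)) (l / ls)) (fun n ω => walk ω n)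
      (fun n z x => piN p n z / piN μs n z.2 * Wd P bnd n z.2 x) l (hπ - hs) V := by
  obtain ⟨C0, v, hg⟩ := growth_of_hyp h.hyps
  obtain ⟨C1, v1, hg1⟩ := growth_of_hyp h.hyp
  have hgg := hg1.prod hg
  have hl0 := h.l0
  have hls := h.ls0
  set α := l / ls with hα
  have hα0 : 0 < α := div_pos h.l0 h.ls0
  have hα1 : 1 ≤ α := (one_le_div h.ls0).2 h.hll
  have hαi : α⁻¹ ≤ 1 := inv_le_one_of_one_le₀ hα1
  have hαi0 : 0 < α⁻¹ := by positivity
  have hlα : l * α⁻¹ = ls := by rw [hα]; field_simp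
  refine ⟨6 * (v1 + v) + 1, by have := hgg.2.1; positivity, mkModel hgg fun ε hε => ?_⟩
  have hε4 : 0 < ε / 4 := by positivity
  set ε' := ε * α⁻¹ / 4 with hε'
  have hε'0 : 0 < ε' := by positivity
  have hε'4 : ε' ≤ ε / 4 := by nlinarith
  have hq2 := qm_qB (o := (1:Γs)) h.hδs h.hδs0
  refine ⟨fun n => {ω | Good bnd ω ∧ Track 1 (fun k => (walk ω k).1) n (l * n) (ε / 4 * n) ∧
    Track 1 (fun k => (walk ω k).2) n (ls * n) (ε' * n) ∧
    (ENNReal.ofReal (Real.exp (-((hπ + ε / 4) * n))) ≤ piN p n (walk ω n) ∧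
      piN p n (walk ω n) ≤ ENNReal.ofReal (Real.exp (-((hπ - ε / 4) * n)))) ∧
    (ENNReal.ofReal (Real.exp (-((hs + ε / 4) * n))) ≤ piN μs n (walk ω n).2 ∧
      piN μs n (walk ω n).2 ≤ ENNReal.ofReal (Real.exp (-((hs - ε / 4) * n)))) ∧
    ENNReal.ofReal (Real.exp (-(ε / 4 * n))) ≤ Wd P bnd n (walk ω n).2 (bnd ω).2 ∧
    Wd P bnd n (walk ω n).2 (bnd ω).2 ≤ 1}, ?_, ?_⟩
  · filter_upwards [h.good, track_ae h.hP h.hyp.1 h.hδ h.hδ0 h.l0 h.cd hε4,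
      track_ae h.hP h.hyps.1 h.hδs h.hδs0 h.ls0 h.cds hε'0,
      ent_bounds h.hP h.st h.ce hε4, ent_bounds h.hP h.sts h.ces hε4, h.Wd_lower hε4, h.Wd_upper]
      with ω h1 h2 h3 h4 h5 h6 h7
    filter_upwards [h2, h3, h4, h5, h6] with n k2 k3 k4 k5 k6
    exact ⟨h1, k2, k3, k4, k5, k6, h7 _ _⟩
  · filter_upwards [lin_ev hε4 (4 * δs + 4 * δ + 1), lin_ev hε'0 (4 * δs + 1)] with n hn hn'
    have hδ := h.hδs0
    have hδ' := h.hδ0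
    have hn0 : (0:ℝ) ≤ n := Nat.cast_nonneg n
    have hε'n : ε' * n ≤ ε / 4 * n := mul_le_mul_of_nonneg_right hε'4 hn0
    have hexp : ∀ x : ℝ, Real.exp x ^ α⁻¹ = Real.exp (x * α⁻¹) := fun x => (Real.exp_mul _ _).symm
    refine ⟨?_, ?_, ?_⟩
    · rintro ω ⟨g1, g2, g3, -⟩ ω' ⟨g1', g2', g3', -⟩ he
      refine max_lt ?_ ?_
      · refine (h.close1 g1 g1' g2 g2' (by rw [he])).trans_lt (Real.exp_lt_exp.2 ?_)
        nlinarith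
      · rw [qpow_lt hq2 hα0]
        refine ⟨Real.exp_pos _, (h.close2 g1 g1' g3 g3' (by rw [he])).trans_lt ?_⟩
        rw [hexp]
        refine Real.exp_lt_exp.2 ?_
        have e1 : -((l - ε) * n) * α⁻¹ = -((ls - 4 * ε') * n) := by
          rw [← hlα, hε']; ring
        rw [e1]
        nlinarith
    · rintro ω ⟨g1, g2, g3, -⟩ ω' ⟨g1', g2', g3', -⟩ hq
      have hqa : qB 1 (bnd ω).1 (bnd ω').1 < _ := (le_max_left _ _).trans_lt hq
      have hqb : qpow (qB 1) α (bnd ω).2 (bnd ω').2 < _ := (le_max_right _ _).trans_lt hq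
      rw [qpow_lt hq2 hα0, hexp] at hqb
      have e1 : -((l - 2 * ε) * n) * α⁻¹ = -((ls - 8 * ε') * n) := by
        rw [← hlα, hε']; ring
      rw [e1] at hqb
      rw [Prod.dist_eq]
      refine max_le ?_ ?_
      · refine (h.near1 g1 g1' g2 g2' (S := (l - 2 * ε) * n) (by nlinarith) hqa).trans ?_
        nlinarith
      · refine (h.near2 g1 g1' g3 g3' (S := (ls - 8 * ε') * n) (by nlinarith) hqb.2).trans ?_
        nlinarith
    · rintro ω ⟨g1, g2, g3, ⟨a1, a2⟩, ⟨b1, b2⟩, c1, c2⟩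
      have hd : ∀ x : ℝ, ENNReal.ofReal (Real.exp x) ≠ 0 := fun x => by
        rw [Ne, ENNReal.ofReal_eq_zero, not_le]; positivity
      have hinv : ∀ x : ℝ, (ENNReal.ofReal (Real.exp x))⁻¹ = ENNReal.ofReal (Real.exp (-x)) := fun x => by
        rw [← ENNReal.ofReal_inv_of_pos (Real.exp_pos _), Real.exp_neg]
      have hmul : ∀ x y : ℝ, ENNReal.ofReal (Real.exp x) * ENNReal.ofReal (Real.exp y) =
          ENNReal.ofReal (Real.exp (x + y)) := fun x y => by
        rw [← ENNReal.ofReal_mul (Real.exp_pos _).le, ← Real.exp_add]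
      constructor
      · have k1 : ENNReal.ofReal (Real.exp ((hs - ε / 4) * n)) ≤ (piN μs n (walk ω n).2)⁻¹ := by
          have := ENNReal.inv_le_inv.2 b2
          rwa [hinv, neg_neg] at this
        calc ENNReal.ofReal (Real.exp (-((hπ - hs + ε) * n)))
            ≤ ENNReal.ofReal (Real.exp (-((hπ + ε / 4) * n))) * ENNReal.ofReal (Real.exp ((hs - ε / 4) * n)) *
              ENNReal.ofReal (Real.exp (-(ε / 4 * n))) := by
              rw [hmul, hmul]
              refine ENNReal.ofReal_le_ofReal (Real.exp_le_exp.2 ?_)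
              nlinarith
          _ ≤ _ := by
              rw [div_eq_mul_inv]
              exact mul_le_mul' (mul_le_mul' a1 k1) c1
      · have k1 : (piN μs n (walk ω n).2)⁻¹ ≤ ENNReal.ofReal (Real.exp ((hs + ε / 4) * n)) := by
          have := ENNReal.inv_le_inv.2 b1
          rwa [hinv, neg_neg] at this
        calc _ ≤ ENNReal.ofReal (Real.exp (-((hπ - ε / 4) * n))) * ENNReal.ofReal (Real.exp ((hs + ε / 4) * n)) * 1 := by
              rw [div_eq_mul_inv]
              exact mul_le_mul' (mul_le_mul' a2 k1) c2
          _ ≤ _ := by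
              rw [mul_one, hmul]
              refine ENNReal.ofReal_le_ofReal (Real.exp_le_exp.2 ?_)
              nlinarith

lemma Ctx.dim3 (h : Ctx p μs P bnd hπ hs l ls δ δs)
    {condν : Boundary Γs (1 : Γs) → Measure (Boundary Γ (1 : Γ) × Boundary Γs (1 : Γs))}
    {νs : Measure (Boundary Γs (1 : Γs))}
    (hdis : IsDisintegration (P.map bnd) Prod.snd νs condν) :
    ∀ᵐ η ∂νs, ExactDim (qbb (1 : Γ) (1 : Γs)) (condν η) ((hπ - hs) / l) := by
  have hPr := h.hP.1
  have hνp : IsProbabilityMeasure (P.map bnd) := Measure.isProbabilityMeasure_map h.bm.aemeasurable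
  obtain ⟨V, hV, hm⟩ := h.model3
  have hα0 : 0 < l / ls := div_pos h.l0 h.ls0
  have hα1 : 1 ≤ l / ls := (one_le_div h.ls0).2 h.hll
  have hq1 := qm_qB (o := (1:Γ)) h.hδ h.hδ0
  have hq2 := qm_qB (o := (1:Γs)) h.hδs h.hδs0
  have hνs : νs = P.map (fun ω => (bnd ω).2) := by
    rw [hdis.1, Measure.map_map measurable_snd h.bm]; rfl
  have hmas := master (P := P) (ν := P.map bnd) (Q := νs) (κ := condν) (f := Prod.snd) (b := bnd)
    (q := qsk (qB (1:Γ)) (qB (1:Γs)) (l / ls)) (hq1.prod (hq2.qpow hα0))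
    (fun ξ r => by
      rw [qball_qsk]
      exact (measurableSet_qball _ _ _).prod (qball_qpow_meas hq2 hα0 (measurableSet_qball _) _ _))
    ((coverBdd_qB h.hyp).prod ((coverBdd_qB h.hyps).qpow hq2 hα1)) h.bm measurable_snd
    (boundary_singleton _) rfl hdis (Z := fun n ω => walk ω n)
    (fun n z => (measurable_walk n) (DiscreteMeasurableSpace.forall_measurableSet {z}))
    (W := fun n z x => piN p n z / piN μs n z.2 * Wd P bnd n z.2 x)
    (fun n z => (Measure.measurable_rnDeriv _ _).const_mul _)
    (fun n z E hE => by
      have := h.cond_id n z hE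
      rw [h.Wd_int n z.2 hE] at this
      rw [hνs, lintegral_const_mul _ (show Measurable (Wd P bnd n z.2) from Measure.measurable_rnDeriv _ _)]
      exact this) h.l0 hV hm
  filter_upwards [dis_ae measurable_snd hdis hmas, hdis.2.1, hdis.2.2.1] with η h1 h2 h3
  have h4 : ∀ᵐ β ∂(condν η), β.2 = η := by
    have hm : MeasurableSet (Prod.snd ⁻¹' {η} : Set (Boundary Γ (1 : Γ) × Boundary Γs (1 : Γs))) :=
      measurable_snd (boundary_singleton _ η)
    exact (prob_compl_eq_zero_iff hm).2 h3
  have h4' := h4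
  filter_upwards [h1, h4'] with β k1 k2
  rw [k2] at k1
  refine k1.congr' ?_
  filter_upwards [self_mem_nhdsWithin] with r hr
  have hr0 : 0 < r := hr
  congr 3
  refine measure_congr ?_
  filter_upwards [h4] with x hx
  apply propext
  change max _ _ < r ↔ max _ _ < r
  rw [max_lt_iff, max_lt_iff, qpow_lt hq2 hα0]
  rw [hx, k2, hq2.self]
  simp [hr0, Real.rpow_pos_of_pos hr0]

end Ctx

/-! ### Part 13: assembling the context -/

section Assemble
variable {Γ Γs : Type*} [Group Γ] [Group Γs] [MetricSpace Γ] [MetricSpace Γs]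
    [Countable Γ] [Countable Γs] [MeasurableSpace Γ] [DiscreteMeasurableSpace Γ]
    [MeasurableSpace Γs] [DiscreteMeasurableSpace Γs]
    {p : Γ × Γs → ℝ≥0∞} {P : Measure (ℕ → Γ × Γs)}

lemma meas_first (A : Set (Γ × Γs)) : MeasurableSet {ω : ℕ → Γ × Γs | ω 0 ∈ A} :=
  (measurable_pi_apply (X := fun _ : ℕ => Γ × Γs) 0) (DiscreteMeasurableSpace.forall_measurableSet A)

lemma step_id (hP : IsRWMeasure p P) : Step P (MonoidHom.id (Γ × Γs)) p := fun b => P_first hP b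

lemma step_snd (hP : IsRWMeasure p P) :
    Step P (MonoidHom.snd Γ Γs) (fun y => ∑' x, p (x, y)) := by
  intro b
  have e : {ω : ℕ → Γ × Γs | (MonoidHom.snd Γ Γs) (ω 0) = b} =
      ⋃ x : Γ, {ω | ω 0 ∈ ({(x, b)} : Set (Γ × Γs))} := by
    ext ω
    simp [Prod.ext_iff]
  rw [e, measure_iUnion _ fun x => meas_first _]
  · exact tsum_congr fun x => P_first hP (x, b)
  · intro x y hxy
    refine Set.disjoint_left.2 fun ω h1 h2 => hxy ?_
    have h1' : ω 0 = (x, b) := h1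
    have h2' : ω 0 = (y, b) := h2
    exact congrArg Prod.fst (h1'.symm.trans h2')

lemma step_fst (hP : IsRWMeasure p P) :
    Step P (MonoidHom.fst Γ Γs) (fun x => ∑' y, p (x, y)) := by
  intro b
  have e : {ω : ℕ → Γ × Γs | (MonoidHom.fst Γ Γs) (ω 0) = b} =
      ⋃ y : Γs, {ω | ω 0 ∈ ({(b, y)} : Set (Γ × Γs))} := by
    ext ω
    simp [Prod.ext_iff]
  rw [e, measure_iUnion _ fun x => meas_first _]
  · exact tsum_congr fun x => P_first hP (b, x)
  · intro x y hxy
    refine Set.disjoint_left.2 fun ω h1 h2 => hxy ?_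
    have h1' : ω 0 = (b, x) := h1
    have h2' : ω 0 = (b, y) := h2
    exact congrArg Prod.snd (h1'.symm.trans h2')

lemma hint_all (hP : IsRWMeasure p P) (hmom : FiniteFirstMoment p fun g => dist (1 : Γ × Γs) g)
    (F : Γ × Γs → ℝ) (hF : ∀ g, F g ≤ dist 1 g) :
    ∫⁻ ω, ENNReal.ofReal (F (ω 0)) ∂P ≠ ∞ := by
  have h1 := lint_walk hP (step_id hP) 1 (fun g => ENNReal.ofReal (F g))
  simp only [walk_one] at h1
  have h2 : ∀ g, piN p 1 g = p g := by
    intro g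
    have h3 := P_walk hP (MonoidHom.id (Γ × Γs)) (step_id hP) 1 g
    rw [← h3]
    simp only [walk_one]
    exact P_first hP g
  simp only [h2] at h1
  have h4 : ∫⁻ ω, ENNReal.ofReal (F (ω 0)) ∂P = ∑' b, p b * ENNReal.ofReal (F b) := h1
  rw [h4]
  refine ne_top_of_le_ne_top hmom (ENNReal.tsum_le_tsum fun g => ?_)
  exact mul_le_mul_right (ENNReal.ofReal_le_ofReal (hF g)) _

lemma drift_pos' {H : Type*} [Group H] [Countable H] [MetricSpace H] {q : H → ℝ≥0∞} {φ : Γ × Γs →* H}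
    (hP : IsRWMeasure p P) (hq : Step P φ q) (hH : IsHypGroupMetric H) (hne : IsNonElemMeasure q)
    {l : ℝ} (hc : Coc P (fdr φ) l) (hl : HasDrift q (fun x => dist 1 x) l) : 0 < l := by
  have := hP.1
  obtain ⟨C, v, hg⟩ := growth_of_hyp hH
  refine drift_pos hg ?_ hne (fun k => ?_) hl
  · have h1 := lint_walk hP hq 1 (fun _ => 1)
    have h2 : ∀ b, piN q 1 b = q b := by
      intro b
      rw [← P_walk hP φ hq 1 b]
      simp only [walk_one]
      exact hq b
    simp only [h2, mul_one, lintegral_const, measure_univ] at h1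
    exact h1.symm
  · have hi : Integrable (fun ω => dist 1 (φ (walk ω k))) P := hc.toCoc0.integrable hP k
    have h1 := lint_walk hP hq k (fun x => ENNReal.ofReal (dist 1 x))
    have h2 := int_walk hP hq k (fun x => dist 1 x) hi
    rw [← h1, momentSeq, ← h2]
    exact (ofReal_integral_eq_lintegral_ofReal hi (Eventually.of_forall fun ω => dist_nonneg)).symm

end Assemble

/-- the harmonic measure `ν_π` satisfies dimension conservation with
respect to the projection to `∂Γ*`. -/
theorem statement2
    (Γ Γs : Type*) [Group Γ] [Group Γs] [MetricSpace Γ] [MetricSpace Γs]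
    [Countable Γ] [Countable Γs]
    [MeasurableSpace Γ] [DiscreteMeasurableSpace Γ]
    [MeasurableSpace Γs] [DiscreteMeasurableSpace Γs]
    (hΓ : IsHypGroupMetric Γ) (hΓs : IsHypGroupMetric Γs)
    (hneΓ : HasFreeSubgroup Γ) (hneΓs : HasFreeSubgroup Γs)
    (p : Γ × Γs → ℝ≥0∞) (hp : IsProb p)
    (hmom : FiniteFirstMoment p fun g => dist (1 : Γ × Γs) g)
    (hμne : IsNonElemMeasure fun x : Γ => ∑' y : Γs, p (x, y))
    (hμsne : IsNonElemMeasure fun y : Γs => ∑' x : Γ, p (x, y))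
    (hπ hs l ls : ℝ)
    (hhπ : HasEntropy p hπ)
    (hhs : HasEntropy (fun y : Γs => ∑' x : Γ, p (x, y)) hs)
    (hl : HasDrift (fun x : Γ => ∑' y : Γs, p (x, y)) (fun x => dist (1 : Γ) x) l)
    (hls : HasDrift (fun y : Γs => ∑' x : Γ, p (x, y)) (fun y => dist (1 : Γs) y) ls)
    (P : Measure (ℕ → Γ × Γs)) (hP : IsRWMeasure p P)
    (ν : Measure (Boundary Γ (1 : Γ) × Boundary Γs (1 : Γs)))
    (hν : IsJointHarmonic (1 : Γ) (1 : Γs) P (fun ω n => (walk ω n).1)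
      (fun ω n => (walk ω n).2) ν)
    (νs : Measure (Boundary Γs (1 : Γs)))
    (condν : Boundary Γs (1 : Γs) → Measure (Boundary Γ (1 : Γ) × Boundary Γs (1 : Γs)))
    (hdis : IsDisintegration ν Prod.snd νs condν)
    (hll : ls ≤ l) :
    ∃ Dν Dc : ℝ,
      (ExactDim (qbb (1 : Γ) (1 : Γs)) ν Dν ∧ HasDim (qbb (1 : Γ) (1 : Γs)) ν Dν) ∧
      (ExactDim (qB (1 : Γs)) νs (hs / ls) ∧ HasDim (qB (1 : Γs)) νs (hs / ls)) ∧
      (∀ᵐ η ∂νs, ExactDim (qbb (1 : Γ) (1 : Γs)) (condν η) Dc ∧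
        HasDim (qbb (1 : Γ) (1 : Γs)) (condν η) Dc) ∧
      Dν = Dc + hs / ls := by
  obtain ⟨bnd, bm, rfl, good⟩ := hν
  have hPr := hP.1
  obtain ⟨δ, hδ0, hδ⟩ := hΓ.2.1
  obtain ⟨δs, hδs0, hδs⟩ := hΓs.2.1
  obtain ⟨C, v, hg⟩ := growth_of_hyp hΓ
  obtain ⟨Cs, vs, hgs⟩ := growth_of_hyp hΓs
  have st := step_id hP
  have st1 := step_fst hP
  have st2 := step_snd hP
  have hi0 : ∫⁻ ω, ENNReal.ofReal (dist 1 ((MonoidHom.id (Γ × Γs)) (ω 0))) ∂P ≠ ∞ :=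
    hint_all hP hmom (fun g => dist 1 g) fun g => le_rfl
  have hi1 : ∫⁻ ω, ENNReal.ofReal (dist 1 ((MonoidHom.fst Γ Γs) (ω 0))) ∂P ≠ ∞ :=
    hint_all hP hmom (fun g => dist 1 g.1) fun g => by
      rw [Prod.dist_eq]; exact le_max_left _ _
  have hi2 : ∫⁻ ω, ENNReal.ofReal (dist 1 ((MonoidHom.snd Γ Γs) (ω 0))) ∂P ≠ ∞ :=
    hint_all hP hmom (fun g => dist 1 g.2) fun g => by
      rw [Prod.dist_eq]; exact le_max_right _ _
  have ce := coc_ent hP st (hg.prod hgs) hi0 hhπ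
  have ces := coc_ent hP st2 hgs hi2 hhs
  have cd := coc_dr hP st1 hΓ.1 hi1 hl
  have cds := coc_dr hP st2 hΓs.1 hi2 hls
  have l0 := drift_pos' hP st1 hΓ hμne cd hl
  have ls0 := drift_pos' hP st2 hΓs hμsne cds hls
  have ctx : Ctx p (fun y : Γs => ∑' x : Γ, p (x, y)) P bnd hπ hs l ls δ δs :=
    { hP := hP, hyp := hΓ, hyps := hΓs, hδ := hδ, hδs := hδs, hδ0 := hδ0, hδs0 := hδs0,
      l0 := l0, ls0 := ls0, hll := hll, st := st, sts := st2, ce := ce, ces := ces,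
      cd := cd, cds := cds, bm := bm, good := good }
  have hνs : νs = P.map (fun ω => (bnd ω).2) := by
    rw [hdis.1, Measure.map_map measurable_snd bm]; rfl
  have hp1 : IsProbabilityMeasure (P.map bnd) := Measure.isProbabilityMeasure_map bm.aemeasurable
  have hp2 : IsProbabilityMeasure νs := by
    rw [hνs]
    exact Measure.isProbabilityMeasure_map (measurable_snd.comp bm).aemeasurable
  have d1 : ExactDim (qB (1 : Γs)) νs (hs / ls) := by
    rw [hνs]; exact ctx.dim1
  have d2 := ctx.dim2
  have hqm := qm_qbb (o := (1 : Γ)) (os := (1 : Γs)) hδ hδ0 hδs hδs0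
  have hcb : CoverBdd (qbb (1 : Γ) (1 : Γs)) := (coverBdd_qB hΓ).prod (coverBdd_qB hΓs)
  have hms := measurableSet_qball_qbb (1 : Γ) (1 : Γs)
  refine ⟨(hπ - hs) / l + hs / ls, (hπ - hs) / l, ⟨d2, d2.hasDim hqm hms hcb⟩,
    ⟨d1, d1.hasDim (qm_qB hδs hδs0) (measurableSet_qball _) (coverBdd_qB hΓs)⟩, ?_, rfl⟩
  filter_upwards [ctx.dim3 hdis, hdis.2.1] with η h1 h2
  exact ⟨h1, h1.hasDim hqm hms hcb⟩

end HMDim
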